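/- Let β > 1. There exists a constant σ₁ > 0 such that: (i) for every y ∈ ℝ, the Lebesgue measure of {x ∈ [0,1) : (log q_n(x) − (π²/(12·log 2))·n)/(σ₁·√n) ≤ y} converges to (1/√(2π)) ∫_{−∞}^{y} e^{−t²/2} dt as n → ∞; and (ii) for Lebesgue-almost all x ∈ [0,1), limsup_{n→∞} (log q_{k_n(x)}(x) − (π²/(12·log 2))·k_n(x))/(σ₁·√(2·k_n(x)·log log k_n(x))) = 1 and liminf_{n→∞} (log q_{k_n(x)}(x) − (π²/(12·log 2))·k_n(x))/(σ₁·√(2·k_n(x)·log log k_n(x))) = −1. -/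

import Mathlib

open MeasureTheory Filter Set

/-- The β-transformation `T_β x = βx - ⌊βx⌋` on `[0,1)`. -/
noncomputable def betaT (β : ℝ) (x : ℝ) : ℝ := β * x - ⌊β * x⌋

/-- The `i`-th digit (for `i ≥ 1`) of the β-expansion of `x`. -/
noncomputable def betaEps (β : ℝ) (i : ℕ) (x : ℝ) : ℤ := ⌊β * (betaT β)^[i - 1] x⌋

/-- The cylinder of order `n` of the β-expansion containing `x`. -/
def betaCyl (β : ℝ) (n : ℕ) (x : ℝ) : Set ℝ :=
  {y ∈ Set.Ico (0:ℝ) 1 | ∀ i, 1 ≤ i → i ≤ n → betaEps β i y = betaEps β i x}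

/-- The Gauss map, with `T 0 = 0`. -/
noncomputable def gaussMap (x : ℝ) : ℝ := if x = 0 then 0 else 1 / x - ⌊1 / x⌋

/-- The `i`-th partial quotient (for `i ≥ 1`) of the continued fraction expansion of `x`. -/
noncomputable def cfA (i : ℕ) (x : ℝ) : ℤ := ⌊1 / (gaussMap^[i - 1] x)⌋

/-- The cylinder of order `m` of the continued fraction expansion containing `x`. -/
def cfCyl (m : ℕ) (x : ℝ) : Set ℝ :=
  {y ∈ Set.Ico (0:ℝ) 1 | ∀ i, 1 ≤ i → i ≤ m → cfA i y = cfA i x}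

/-- `k_n(x)`: the exact number of partial quotients of the continued fraction of `x`
determined by the first `n` β-expansion digits of `x`. -/
noncomputable def kCF (β : ℝ) (n : ℕ) (x : ℝ) : ℕ :=
  sSup {m | betaCyl β n x ⊆ cfCyl m x}

/-- Denominators `q_n(x)` of the continued fraction convergents of `x`
(`q_0 = 1`, `q_1 = a_1`, `q_n = a_n q_{n-1} + q_{n-2}`). -/
noncomputable def cfQ (x : ℝ) : ℕ → ℤ
  | 0 => 1
  | 1 => cfA 1 x
  | (n + 2) => cfA (n + 2) x * cfQ x (n + 1) + cfQ x n

/-- Numerators `p_n(x)` of the continued fraction convergents of `x`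
(`p_0 = 0`, `p_1 = 1`, `p_n = a_n p_{n-1} + p_{n-2}`). -/
noncomputable def cfP (x : ℝ) : ℕ → ℤ
  | 0 => 0
  | 1 => 1
  | (n + 2) => cfA (n + 2) x * cfP x (n + 1) + cfP x n

/-- `l_n(x)`: the length of the longest string of zeros just after the `n`-th digit
of the β-expansion of `x`. -/
noncomputable def lZero (β : ℝ) (n : ℕ) (x : ℝ) : ℕ :=
  sSup {k | ∀ j, 1 ≤ j → j ≤ k → betaEps β (n + j) x = 0}

set_option linter.all false

namespace GK
section LIL
variable {Ω : Type*} {m0 : MeasurableSpace Ω}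

structure LILData (μ : Measure Ω) (ℱ : Filtration ℕ m0) (S h w : ℕ → Ω → ℝ)
    (σ B C δ : ℝ) : Prop where
  S_meas : ∀ n, Measurable[ℱ n] (S n)
  h_meas : ∀ n, Measurable[ℱ n] (h n)
  w_meas : ∀ n, Measurable[ℱ n] (w n)
  S_zero : ∀ ω, S 0 ω = 0
  hB : ∀ n ω, |h n ω| ≤ B
  wB : ∀ n ω, |w n ω| ≤ B
  σ_pos : 0 < σ
  δ_pos : 0 < δ
  δ_le : δ ≤ 1
  C_nn : 0 ≤ C
  int : ∀ t, |t| ≤ δ → ∀ m n, Integrable (fun ω => Real.exp (t * (S (m + n) ω - S m ω))) μ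
  step : ∀ t, |t| ≤ δ → ∀ n, ∀ᵐ ω ∂μ,
    |(μ[fun ω => Real.exp (t * (S (n+1) ω - S n ω + h (n+1) ω - h n ω)
      + t^2/2 * (w (n+1) ω - w n ω)) | ℱ n]) ω - (1 + t^2 * σ^2 / 2)| ≤ C * |t|^3

/-- The exponential ratio process. -/
noncomputable def XX (S h w : ℕ → Ω → ℝ) (t : ℝ) (m n : ℕ) (ω : Ω) : ℝ :=
  Real.exp (t * (S (m+n) ω - S m ω + h (m+n) ω - h m ω) + t^2/2 * (w (m+n) ω - w m ω))

variable {μ : Measure Ω} [IsProbabilityMeasure μ] {ℱ : Filtration ℕ m0} {S h w : ℕ → Ω → ℝ}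
    {σ B C δ : ℝ}

namespace LILData
variable (H : LILData μ ℱ S h w σ B C δ)
include H

lemma B_nn (ω : Ω) : 0 ≤ B := (abs_nonneg _).trans (H.hB 0 ω)

lemma neg : LILData μ ℱ (fun n ω => - S n ω) (fun n ω => - h n ω) w σ B C δ where
  S_meas n := (H.S_meas n).neg
  h_meas n := (H.h_meas n).neg
  w_meas := H.w_meas
  S_zero ω := by simp [H.S_zero]
  hB n ω := by rw [abs_neg]; exact H.hB n ω
  wB := H.wB
  σ_pos := H.σ_pos
  δ_pos := H.δ_pos
  δ_le := H.δ_le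
  C_nn := H.C_nn
  int t ht m n := by
    have := H.int (-t) (by rwa [abs_neg]) m n
    refine this.congr (ae_of_all _ fun ω => ?_)
    simp only; congr 1; ring
  step t ht n := by
    have := H.step (-t) (by rwa [abs_neg]) n
    simp only [abs_neg, neg_sq] at this
    have e : (fun ω => Real.exp (t * (-S (n+1) ω - -S n ω + -h (n+1) ω - -h n ω)
      + t^2/2 * (w (n+1) ω - w n ω))) = (fun ω => Real.exp (-t * (S (n+1) ω - S n ω + h (n+1) ω - h n ω)
      + t^2/2 * (w (n+1) ω - w n ω))) := by
      funext ω; congr 1; ring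
    rw [e]; exact this

lemma corr_bound {t : ℝ} (ht : |t| ≤ δ) (m n : ℕ) (ω : Ω) :
    |t * (h n ω - h m ω) + t^2/2 * (w n ω - w m ω)| ≤ 3 * B := by
  have h1 : |t| ≤ 1 := ht.trans H.δ_le
  have hb : |h n ω - h m ω| ≤ 2 * B := by
    have := abs_sub (h n ω) (h m ω); linarith [H.hB n ω, H.hB m ω]
  have wb : |w n ω - w m ω| ≤ 2 * B := by
    have := abs_sub (w n ω) (w m ω); linarith [H.wB n ω, H.wB m ω]
  have hB := H.B_nn ω
  calc _ ≤ |t * (h n ω - h m ω)| + |t^2/2 * (w n ω - w m ω)| := abs_add_le _ _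
    _ = |t| * |h n ω - h m ω| + |t|^2/2 * |w n ω - w m ω| := by
        rw [abs_mul, abs_mul, abs_div, abs_pow, abs_two]
    _ ≤ 1 * (2 * B) + 1^2/2 * (2*B) := by gcongr
    _ = 3 * B := by ring

lemma XX_le {t : ℝ} (ht : |t| ≤ δ) (m n : ℕ) (ω : Ω) :
    XX S h w t m n ω ≤ Real.exp (3*B) * Real.exp (t * (S (m+n) ω - S m ω)) := by
  rw [XX, ← Real.exp_add]
  apply Real.exp_le_exp.2
  have := abs_le.1 (H.corr_bound ht m (m+n) ω)
  linarith [this.2]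

lemma le_XX {t : ℝ} (ht : |t| ≤ δ) (m n : ℕ) (ω : Ω) :
    Real.exp (-(3*B)) * Real.exp (t * (S (m+n) ω - S m ω)) ≤ XX S h w t m n ω := by
  rw [XX, ← Real.exp_add]
  apply Real.exp_le_exp.2
  have := abs_le.1 (H.corr_bound ht m (m+n) ω)
  linarith [this.1]

lemma XX_measF (t : ℝ) (m n : ℕ) : Measurable[ℱ (m+n)] (XX S h w t m n) := by
  have a1 := H.S_meas (m+n)
  have a2 := H.h_meas (m+n)
  have a3 := H.w_meas (m+n)
  have b1 := (H.S_meas m).mono (ℱ.mono (Nat.le_add_right m n)) le_rfl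
  have b2 := (H.h_meas m).mono (ℱ.mono (Nat.le_add_right m n)) le_rfl
  have b3 := (H.w_meas m).mono (ℱ.mono (Nat.le_add_right m n)) le_rfl
  unfold XX
  exact Real.measurable_exp.comp (((((a1.sub b1).add a2).sub b2).const_mul t).add
    ((a3.sub b3).const_mul _))

lemma XX_int {t : ℝ} (ht : |t| ≤ δ) (m n : ℕ) : Integrable (XX S h w t m n) μ := by
  refine ((H.int t ht m n).const_mul (Real.exp (3*B))).mono'
    ((H.XX_measF t m n).mono (ℱ.le _) le_rfl).aestronglyMeasurable (ae_of_all _ fun ω => ?_)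
  rw [Real.norm_of_nonneg (show 0 ≤ XX S h w t m n ω from (Real.exp_pos _).le)]
  exact H.XX_le ht m n ω

omit H [IsProbabilityMeasure μ] in
lemma XX_succ (t : ℝ) (m n : ℕ) (ω : Ω) :
    XX S h w t m (n+1) ω = XX S h w t m n ω * XX S h w t (m+n) 1 ω := by
  simp only [XX, ← Real.exp_add, ← add_assoc]
  congr 1; ring

omit [IsProbabilityMeasure μ] in
lemma XX_nonneg (t : ℝ) (m n : ℕ) (ω : Ω) : 0 ≤ XX S h w t m n ω := (Real.exp_pos _).le

lemma cond_step {t : ℝ} (ht : |t| ≤ δ) (m n : ℕ) :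
    ∀ᵐ ω ∂μ, (1 + t^2*σ^2/2 - C*|t|^3) * XX S h w t m n ω ≤ (μ[XX S h w t m (n+1) | ℱ (m+n)]) ω ∧
      (μ[XX S h w t m (n+1) | ℱ (m+n)]) ω ≤ (1 + t^2*σ^2/2 + C*|t|^3) * XX S h w t m n ω := by
  have e : XX S h w t m (n+1) = XX S h w t m n * XX S h w t (m+n) 1 := by
    funext ω; exact XX_succ t m n ω
  have hp := condExp_mul_of_stronglyMeasurable_left (μ := μ) (m := ℱ (m+n))
    (f := XX S h w t m n) (g := XX S h w t (m+n) 1)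
    (H.XX_measF t m n).stronglyMeasurable (by rw [← e]; exact H.XX_int ht m (n+1))
    (H.XX_int ht _ _)
  have hs := H.step t ht (m+n)
  rw [e]
  filter_upwards [hp, hs] with ω h1 h2
  rw [h1]
  have h3 := abs_le.1 h2
  have h4 := H.XX_nonneg t m n ω
  change -(C * |t|^3) ≤ (μ[XX S h w t (m+n) 1 | ℱ (m+n)]) ω - _ ∧
    (μ[XX S h w t (m+n) 1 | ℱ (m+n)]) ω - _ ≤ _ at h3
  simp only [Pi.mul_apply]
  constructor
  · nlinarith
  · nlinarith

lemma cond_pow {t : ℝ} (ht : |t| ≤ δ) (hlo : 0 ≤ 1 + t^2*σ^2/2 - C*|t|^3) (m n : ℕ) :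
    ∀ᵐ ω ∂μ, (1 + t^2*σ^2/2 - C*|t|^3)^n ≤ (μ[XX S h w t m n | ℱ m]) ω ∧
      (μ[XX S h w t m n | ℱ m]) ω ≤ (1 + t^2*σ^2/2 + C*|t|^3)^n := by
  have hhi : 0 ≤ 1 + t^2*σ^2/2 + C*|t|^3 := by
    have := H.C_nn; positivity
  induction n with
  | zero =>
    have : XX S h w t m 0 = fun _ => (1:ℝ) := by funext ω; simp [XX]
    rw [this, condExp_const (ℱ.le m)]
    simp
  | succ n ih =>
    have hs := H.cond_step ht m n
    have tower : μ[μ[XX S h w t m (n+1) | ℱ (m+n)] | ℱ m] =ᵐ[μ] μ[XX S h w t m (n+1) | ℱ m] :=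
      condExp_condExp_of_le (ℱ.mono (Nat.le_add_right m n)) (ℱ.le _)
    have i1 := H.XX_int ht m n
    have l1 : μ[(1 + t^2*σ^2/2 - C*|t|^3) • XX S h w t m n | ℱ m] ≤ᵐ[μ] μ[μ[XX S h w t m (n+1) | ℱ (m+n)] | ℱ m] :=
      condExp_mono (i1.smul _) integrable_condExp (by filter_upwards [hs] with ω h using h.1)
    have l2 : μ[μ[XX S h w t m (n+1) | ℱ (m+n)] | ℱ m] ≤ᵐ[μ] μ[(1 + t^2*σ^2/2 + C*|t|^3) • XX S h w t m n | ℱ m] :=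
      condExp_mono integrable_condExp (i1.smul _) (by filter_upwards [hs] with ω h using h.2)
    have e1 := condExp_smul (μ := μ) (1 + t^2*σ^2/2 - C*|t|^3) (XX S h w t m n) (ℱ m)
    have e2 := condExp_smul (μ := μ) (1 + t^2*σ^2/2 + C*|t|^3) (XX S h w t m n) (ℱ m)
    filter_upwards [ih, tower, l1, l2, e1, e2] with ω h1 h2 h3 h4 h5 h6
    rw [h5, h2] at h3
    rw [h6, h2] at h4
    simp only [Pi.smul_apply, smul_eq_mul] at h3 h4
    constructor
    · calc _ = (1 + t^2*σ^2/2 - C*|t|^3) * (1 + t^2*σ^2/2 - C*|t|^3)^n := by ring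
        _ ≤ _ := mul_le_mul_of_nonneg_left h1.1 hlo
        _ ≤ _ := h3
    · calc _ ≤ _ := h4
        _ ≤ (1 + t^2*σ^2/2 + C*|t|^3) * (1 + t^2*σ^2/2 + C*|t|^3)^n :=
           mul_le_mul_of_nonneg_left h1.2 hhi
        _ = _ := by ring

/-- small parameters -/
lemma exists_small {η : ℝ} (hη : 0 < η) (hη1 : η < 1) : ∃ δ' : ℝ, 0 < δ' ∧ δ' ≤ δ ∧ ∀ t, |t| ≤ δ' →
    Real.exp ((1-η) * (σ^2*t^2/2)) ≤ 1 + t^2*σ^2/2 - C*|t|^3 ∧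
    1 + t^2*σ^2/2 + C*|t|^3 ≤ Real.exp ((1+η) * (σ^2*t^2/2)) := by
  have hσ := H.σ_pos
  have hC := H.C_nn
  refine ⟨min δ (min (η*σ^2/(4*(C+1))) (min (1/σ) (η/(2*σ)))), ?_, min_le_left _ _, ?_⟩
  · have := H.δ_pos; positivity
  intro t ht
  simp only [le_min_iff] at ht
  obtain ⟨_, h2, h3, h4⟩ := ht
  have h2' : C * |t| ≤ η*σ^2/4 := by
    rw [le_div_iff₀ (by positivity)] at h2
    nlinarith [abs_nonneg t]
  have h3' : σ * |t| ≤ 1 := by rw [le_div_iff₀ hσ] at h3; linarith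
  have h4' : σ * |t| ≤ η/2 := by
    rw [le_div_iff₀ (by positivity)] at h4; linarith
  have hc : C*|t|^3 ≤ η/2 * (σ^2*t^2/2) := by
    have : C*|t|^3 = (C*|t|)*t^2 := by rw [← sq_abs t]; ring
    rw [this]
    nlinarith [sq_nonneg t]
  set a := σ^2*t^2/2 with ha
  have ha' : a = (σ*|t|)^2/2 := by rw [mul_pow, sq_abs]
  have hst : 0 ≤ σ*|t| := by positivity
  have a0 : 0 ≤ a := by positivity
  have a1 : a ≤ 1 := by rw [ha']; nlinarith
  have a2 : a ≤ η/2 := by rw [ha']; nlinarith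
  have ea : t^2*σ^2/2 = a := by rw [ha]; ring
  rw [ea]
  constructor
  · have hz : |(1-η)*a| ≤ 1 := by
      rw [abs_of_nonneg (by nlinarith)]; nlinarith
    have := Real.abs_exp_sub_one_sub_id_le hz
    have := (abs_le.1 this).2
    have h5 : ((1-η)*a)^2 ≤ a * a := by
      have : (1-η)^2 ≤ 1 := by nlinarith
      nlinarith [mul_nonneg a0 a0]
    nlinarith
  · have := Real.add_one_le_exp ((1+η)*a)
    nlinarith

lemma cond_exp_bounds {η : ℝ} (hη : 0 < η) (hη1 : η < 1) : ∃ δ' : ℝ, 0 < δ' ∧ ∀ t, |t| ≤ δ' →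
    Integrable (fun _ : Ω => (0:ℝ)) μ ∧ ∀ m n, 
    Integrable (fun ω => Real.exp (t * (S (m+n) ω - S m ω))) μ ∧ ∀ᵐ ω ∂μ, 
      Real.exp (-(3*B)) * Real.exp ((1-η) * (σ^2*t^2/2) * n) ≤
        (μ[fun ω => Real.exp (t * (S (m+n) ω - S m ω)) | ℱ m]) ω ∧
      (μ[fun ω => Real.exp (t * (S (m+n) ω - S m ω)) | ℱ m]) ω ≤
        Real.exp (3*B) * Real.exp ((1+η) * (σ^2*t^2/2) * n) := by
  obtain ⟨δ', h0, hle, hd⟩ := H.exists_small hη hη1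
  refine ⟨δ', h0, fun t ht => ⟨by simp, fun m n => ⟨H.int t (ht.trans hle) m n, ?_⟩⟩⟩
  have ht' := ht.trans hle
  obtain ⟨d1, d2⟩ := hd t ht
  have hlo := (Real.exp_pos _).le.trans d1
  have hp := H.cond_pow ht' hlo m n
  have i1 := H.XX_int ht' m n
  have i2 := H.int t ht' m n
  have l1 : μ[Real.exp (-(3*B)) • XX S h w t m n | ℱ m] ≤ᵐ[μ] _ :=
    condExp_mono (i1.smul _) i2 (ae_of_all _ fun ω => by
      have := H.XX_le ht' m n ω
      simp only [Pi.smul_apply, smul_eq_mul]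
      rw [Real.exp_neg, inv_mul_le_iff₀ (Real.exp_pos _)]
      exact this)
  have l2 : _ ≤ᵐ[μ] μ[Real.exp (3*B) • XX S h w t m n | ℱ m]  :=
    condExp_mono i2 (i1.smul _) (ae_of_all _ fun ω => by
      have := H.le_XX ht' m n ω
      simp only [Pi.smul_apply, smul_eq_mul]
      rw [Real.exp_neg, inv_mul_le_iff₀ (Real.exp_pos _)] at this
      exact this)
  have e1 := condExp_smul (μ := μ) (Real.exp (-(3*B))) (XX S h w t m n) (ℱ m)
  have e2 := condExp_smul (μ := μ) (Real.exp (3*B)) (XX S h w t m n) (ℱ m)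
  filter_upwards [hp, l1, l2, e1, e2] with ω h1 h3 h4 h5 h6
  rw [h5] at h3
  rw [h6] at h4
  simp only [Pi.smul_apply, smul_eq_mul] at h3 h4
  have g1 : Real.exp ((1-η) * (σ^2*t^2/2) * n) ≤ (1 + t^2*σ^2/2 - C*|t|^3)^n := by
    rw [mul_comm _ (n:ℝ), Real.exp_nat_mul]
    gcongr
  have g2 : (1 + t^2*σ^2/2 + C*|t|^3)^n ≤ Real.exp ((1+η) * (σ^2*t^2/2) * n) := by
    rw [mul_comm _ (n:ℝ), Real.exp_nat_mul]
    have := H.C_nn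
    gcongr
  constructor
  · refine le_trans ?_ h3
    gcongr
    exact g1.trans h1.1
  · refine h4.trans ?_
    gcongr
    exact h1.2.trans g2

lemma maximal {η : ℝ} (hη : 0 < η) (hη1 : η < 1) : ∃ δ' : ℝ, 0 < δ' ∧ ∀ t, 0 < t → t ≤ δ' →
    ∀ n x, μ {ω | ∃ k ≤ n, x ≤ S k ω} ≤
      ENNReal.ofReal (Real.exp (3*B - t*x + (1+η) * (σ^2*t^2/2) * n)) := by
  obtain ⟨δ', h0, hle, hd⟩ := H.exists_small hη hη1
  refine ⟨δ', h0, fun t ht0 htd n x => ?_⟩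
  have ht : |t| ≤ δ' := by rwa [abs_of_pos ht0]
  have ht' := ht.trans hle
  obtain ⟨d1, d2⟩ := hd t ht
  have hlo := (Real.exp_pos _).le.trans d1
  have hsub : Submartingale (fun n => XX S h w t 0 n) ℱ μ := by
    refine submartingale_nat (fun n => ?_) (fun n => H.XX_int ht' 0 n) (fun n => ?_)
    · have := (H.XX_measF t 0 n); rw [zero_add] at this
      exact this.stronglyMeasurable
    · filter_upwards [H.cond_step ht' 0 n] with ω h1
      rw [zero_add] at h1
      refine le_trans ?_ h1.1
      have : 1 ≤ 1 + t^2*σ^2/2 - C*|t|^3 := le_trans (Real.one_le_exp (by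
        have : 0 ≤ 1 - η := by linarith
        positivity)) d1
      nlinarith [H.XX_nonneg t 0 n ω]
  have hmax := maximal_ineq hsub (fun k ω => H.XX_nonneg t 0 k ω)
    (ε := (⟨Real.exp (t*x - 3*B), (Real.exp_pos _).le⟩ : NNReal)) n
  set A := {ω | ((⟨Real.exp (t*x - 3*B), (Real.exp_pos _).le⟩ : NNReal) : ℝ) ≤
    (Finset.range (n + 1)).sup' Finset.nonempty_range_add_one fun k => XX S h w t 0 k ω} with hA
  have hsubset : {ω | ∃ k ≤ n, x ≤ S k ω} ⊆ A := by
    rintro ω ⟨k, hk, hx⟩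
    simp only [hA, mem_setOf_eq, NNReal.coe_mk, Finset.le_sup'_iff]
    refine ⟨k, by simp; omega, ?_⟩
    refine le_trans ?_ (H.le_XX ht' 0 k ω)
    rw [← Real.exp_add, Real.exp_le_exp, zero_add, H.S_zero]
    nlinarith
  have hint : ∫ ω in A, XX S h w t 0 n ω ∂μ ≤ Real.exp ((1+η) * (σ^2*t^2/2) * n) := by
    calc _ ≤ ∫ ω, XX S h w t 0 n ω ∂μ := setIntegral_le_integral (H.XX_int ht' 0 n)
            (ae_of_all _ fun ω => H.XX_nonneg t 0 n ω)
      _ = ∫ ω, (μ[XX S h w t 0 n | ℱ 0]) ω ∂μ := (integral_condExp (ℱ.le 0)).symm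
      _ ≤ ∫ ω, (1 + t^2*σ^2/2 + C*|t|^3)^n ∂μ := by
          refine integral_mono_ae integrable_condExp (by simp) ?_
          filter_upwards [H.cond_pow ht' hlo 0 n] with ω h using h.2
      _ = (1 + t^2*σ^2/2 + C*|t|^3)^n := by simp
      _ ≤ _ := by
        rw [mul_comm _ (n:ℝ), Real.exp_nat_mul]
        have := H.C_nn
        gcongr
  have h5 : ENNReal.ofReal (Real.exp (t*x - 3*B)) * μ A ≤
      ENNReal.ofReal (Real.exp ((1+η) * (σ^2*t^2/2) * n)) := by
    refine le_trans (le_of_eq ?_) (hmax.trans (ENNReal.ofReal_le_ofReal hint))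
    congr 1
    rw [ENNReal.ofReal, Real.toNNReal_of_nonneg (Real.exp_pos _).le]
    rfl
  refine (measure_mono hsubset).trans ?_
  have e : Real.exp (3*B - t*x + (1+η) * (σ^2*t^2/2) * n) =
    Real.exp ((1+η) * (σ^2*t^2/2) * n) / Real.exp (t*x - 3*B) := by
    rw [← Real.exp_sub]; congr 1; ring
  rw [e, ENNReal.ofReal_div_of_pos (Real.exp_pos _), ENNReal.le_div_iff_mul_le, mul_comm]
  · exact h5
  · left; simp [Real.exp_pos]
  · left; simp

end LILData
end LIL
end GK

namespace GK

lemma bc_helper {Ω : Type*} {m0 : MeasurableSpace Ω} {μ : Measure Ω} {E : ℕ → Set Ω} {g : ℕ → ℝ}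
    (hg : Summable g) (hE : ∀ᶠ j in atTop, μ (E j) ≤ ENNReal.ofReal (g j)) :
    ∀ᵐ ω ∂μ, ∀ᶠ j in atTop, ω ∉ E j := by
  obtain ⟨J, hJ⟩ := eventually_atTop.1 hE
  have h1 : ∑' j, μ (E (j + J)) ≠ ⊤ := by
    have hs : Summable (fun j => g (j + J)) := (summable_nat_add_iff J).2 hg
    refine ne_top_of_le_ne_top (hs.tsum_ofReal_ne_top) (ENNReal.tsum_le_tsum fun j => hJ _ (by omega))
  filter_upwards [ae_eventually_notMem h1] with ω hω
  obtain ⟨K, hK⟩ := eventually_atTop.1 hω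
  refine eventually_atTop.2 ⟨K + J, fun j hj => ?_⟩
  have := hK (j - J) (by omega)
  rwa [Nat.sub_add_cancel (by omega)] at this

noncomputable def phi (σ x : ℝ) : ℝ := σ * Real.sqrt (2 * x * Real.log (Real.log x))

lemma phi_mono {σ x y : ℝ} (hσ : 0 ≤ σ) (hx : Real.exp 1 ≤ x) (hxy : x ≤ y) :
    phi σ x ≤ phi σ y := by
  have h0 : 0 < x := (Real.exp_pos 1).trans_le hx
  have h1 : 1 ≤ Real.log x := by rwa [Real.le_log_iff_exp_le h0]
  have h2 : Real.log x ≤ Real.log y := Real.log_le_log h0 hxy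
  have h3 : 0 ≤ Real.log (Real.log x) := Real.log_nonneg h1
  have h4 : Real.log (Real.log x) ≤ Real.log (Real.log y) := Real.log_le_log (by linarith) h2
  unfold phi
  have h5 : 0 ≤ 2 * y := by linarith
  gcongr

lemma phi_nonneg {σ x : ℝ} (hσ : 0 ≤ σ) : 0 ≤ phi σ x := by unfold phi; positivity

/-- `L_j / α^j → 0`. -/
lemma loglog_div_tendsto {α : ℝ} (hα : 1 < α) :
    Tendsto (fun j : ℕ => Real.log (Real.log (α^j)) / α^j) atTop (nhds 0) := by
  have hl : 0 < Real.log α := Real.log_pos hα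
  have h1 : Tendsto (fun j : ℕ => (j:ℝ)^1 / α^j * Real.log α) atTop (nhds 0) := by
    have := (tendsto_pow_const_div_const_pow_of_one_lt 1 hα).mul_const (Real.log α)
    simpa using this
  have hev : ∀ᶠ j : ℕ in atTop, 1 ≤ (j:ℝ) * Real.log α := by
    have : Tendsto (fun j : ℕ => (j:ℝ) * Real.log α) atTop atTop :=
      tendsto_natCast_atTop_atTop.atTop_mul_const hl
    exact this.eventually_ge_atTop 1
  refine squeeze_zero' ?_ ?_ h1
  · filter_upwards [hev] with j hj
    rw [Real.log_pow]
    have := Real.log_nonneg hj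
    positivity
  · filter_upwards [hev] with j hj
    rw [Real.log_pow, pow_one, div_mul_eq_mul_div]
    gcongr
    have := Real.log_le_sub_one_of_pos (show 0 < (j:ℝ) * Real.log α by linarith)
    linarith

lemma logj_ge {α : ℝ} (hα : 1 < α) (M : ℝ) :
    ∀ᶠ j : ℕ in atTop, M ≤ Real.log (Real.log (α^j)) := by
  have hl : 0 < Real.log α := Real.log_pos hα
  have h1 : Tendsto (fun j : ℕ => (j:ℝ) * Real.log α) atTop atTop :=
    tendsto_natCast_atTop_atTop.atTop_mul_const hl
  have h2 := Real.tendsto_log_atTop.comp h1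
  filter_upwards [h2.eventually_ge_atTop M] with j hj
  rw [Real.log_pow]; exact hj

section LIL
variable {Ω : Type*} {m0 : MeasurableSpace Ω} {μ : Measure Ω} [IsProbabilityMeasure μ]
    {ℱ : Filtration ℕ m0} {S h w : ℕ → Ω → ℝ} {σ B C δ : ℝ}
namespace LILData
variable (H : LILData μ ℱ S h w σ B C δ)
include H

lemma upper {ε : ℝ} (hε : 0 < ε) (hε1 : ε < 1) :
    ∀ᵐ ω ∂μ, ∀ᶠ n : ℕ in atTop, S n ω ≤ (1+ε) * phi σ n := by
  have hσ := H.σ_pos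
  set α := 1 + ε with hα
  have hα1 : 1 < α := by linarith
  have hα0 : 0 < α := by linarith
  have hlα : 0 < Real.log α := Real.log_pos hα1
  obtain ⟨δ', hδ'0, hmax⟩ := H.maximal (η := ε/4) (by linarith) (by linarith)
  set x : ℕ → ℝ := fun j => α * phi σ (α^j) with hx
  set E : ℕ → Set Ω := fun j => {ω | ∃ k ≤ ⌊α^(j+1)⌋₊, x j ≤ S k ω} with hE
  set t : ℕ → ℝ := fun j => x j / (σ^2 * α^(j+1)) with ht
  have ht_eq : ∀ᶠ j in atTop, t j = Real.sqrt (2 * (Real.log (Real.log (α^j)) / α^j)) / σ := by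
    filter_upwards [logj_ge hα1 0] with j hj
    simp only [ht, hx, phi]
    have e : 2 * α^j * Real.log (Real.log (α^j)) = (α^j)^2 * (2 * (Real.log (Real.log (α^j)) / α^j)) := by
      field_simp
    rw [e, Real.sqrt_mul (by positivity), Real.sqrt_sq (by positivity)]
    field_simp
    ring
  have ht0 : Tendsto t atTop (nhds 0) := by
    have h1 : Tendsto (fun j : ℕ => Real.sqrt (2 * (Real.log (Real.log (α^j)) / α^j)) / σ) atTop (nhds 0) := by
      have := ((loglog_div_tendsto hα1).const_mul 2).sqrt.div_const σ
      simpa using this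
    exact h1.congr' (ht_eq.mono fun j hj => hj.symm)
  have hsum : Summable (fun j : ℕ => Real.exp (3*B) * ((j:ℝ) * Real.log α)^(-(1+ε/2))) := by
    have : Summable (fun j : ℕ => Real.exp (3*B) * (Real.log α)^(-(1+ε/2)) * (j:ℝ)^(-(1+ε/2))) :=
      (Real.summable_nat_rpow.2 (by linarith)).mul_left _
    refine this.congr fun j => ?_
    rw [Real.mul_rpow (by positivity) hlα.le]; ring
  have hbound : ∀ᶠ j in atTop, μ (E j) ≤ ENNReal.ofReal (Real.exp (3*B) * ((j:ℝ) * Real.log α)^(-(1+ε/2))) := by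
    filter_upwards [ht0.eventually_lt_const hδ'0, logj_ge hα1 1, eventually_gt_atTop 0] with j h1 h2 h3
    have hxpos : 0 < x j := by
      simp only [hx, phi]; positivity
    have htpos : 0 < t j := by simp only [ht]; positivity
    refine (hmax (t j) htpos h1.le _ (x j)).trans (ENNReal.ofReal_le_ofReal ?_)
    have hj : 0 < (j:ℝ) * Real.log α := by positivity
    rw [Real.rpow_def_of_pos hj, ← Real.exp_add, Real.exp_le_exp]
    rw [Real.log_pow] at h2
    have hn : ((⌊α^(j+1)⌋₊ : ℕ) : ℝ) ≤ α^(j+1) := Nat.floor_le (by positivity)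
    have hx2 : (x j)^2 = 2 * σ^2 * α^(j+1) * (α * Real.log (j * Real.log α)) := by
      simp only [hx, phi]
      rw [mul_pow, mul_pow, Real.sq_sqrt (by rw [Real.log_pow]; positivity), Real.log_pow]
      ring
    have e1 : t j * x j = 2 * (α * Real.log (j * Real.log α)) := by
      simp only [ht]
      rw [div_mul_eq_mul_div, ← sq, hx2]; field_simp
    have e2 : σ^2 * (t j)^2/2 * α^(j+1) = α * Real.log (j * Real.log α) := by
      simp only [ht]
      rw [div_pow, hx2]; field_simp
    have e3 : (1+ε/4) * (σ^2 * (t j)^2/2) * (⌊α^(j+1)⌋₊ : ℕ) ≤ (1+ε/4) * (α * Real.log (j * Real.log α)) := by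
      rw [← e2, ← mul_assoc]
      gcongr
    set l := Real.log (j * Real.log α)
    rw [e1]
    have : (1 + ε/2) * l ≤ (1-ε/4) * (α * l) := by
      have : (1 + ε/2) ≤ (1-ε/4) * α := by rw [hα]; nlinarith
      nlinarith
    nlinarith
  filter_upwards [bc_helper hsum hbound] with ω hω
  obtain ⟨J, hJ⟩ := eventually_atTop.1 hω
  obtain ⟨J2, hJ2⟩ := eventually_atTop.1 (logj_ge hα1 1)
  have hJ3 : ∀ᶠ j : ℕ in atTop, Real.exp 1 ≤ α^j :=
    (tendsto_pow_atTop_atTop_of_one_lt hα1).eventually_ge_atTop _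
  obtain ⟨J3, hJ3⟩ := eventually_atTop.1 hJ3
  set K := max J J3 with hK
  filter_upwards [eventually_ge_atTop ⌈α^K⌉₊] with k hk
  have hk' : α^K ≤ (k:ℝ) := (Nat.le_ceil _).trans (by exact_mod_cast hk)
  have hk1 : (1:ℝ) ≤ k := (one_le_pow₀ hα1.le).trans hk'
  obtain ⟨j, hj1, hj2⟩ := exists_nat_pow_near hk1 hα1
  have hjK : K ≤ j := by
    by_contra hcon
    push Not at hcon
    have : α^(j+1) ≤ α^K := pow_le_pow_right₀ hα1.le (by omega)
    linarith
  have := hJ j (le_trans (le_max_left _ _) hjK)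
  simp only [hE, mem_setOf_eq, not_exists, not_and, not_le] at this
  have h5 := this k (Nat.le_floor hj2.le)
  refine h5.le.trans ?_
  simp only [hx]
  gcongr
  exact phi_mono hσ.le (hJ3 j (le_trans (le_max_right _ _) hjK)) hj1

omit H [IsProbabilityMeasure μ] in
lemma pointwise_lower {D b τ u d : ℝ} (hτ : 0 ≤ τ) (hb : 0 ≤ b) (hd : 0 ≤ d) (hu : d ≤ u) :
    Real.exp (-(τ*u*(u+d)*b)) * (Real.exp (τ*u*D) - Real.exp (-(τ*d*(u+d)*b)) * Real.exp (τ*(u+d)*D)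
      - Real.exp (τ*d*(u-d)*b) * Real.exp (τ*(u-d)*D)) ≤ if (u-d)*b ≤ D then 1 else 0 := by
  have p1 := Real.exp_pos (-(τ*d*(u+d)*b) + τ*(u+d)*D)
  have p2 := Real.exp_pos (τ*d*(u-d)*b + τ*(u-d)*D)
  rw [← Real.exp_add, ← Real.exp_add]
  split_ifs with h1
  · by_cases h2 : D ≤ (u+d)*b
    · calc _ ≤ Real.exp (-(τ*u*(u+d)*b)) * Real.exp (τ*u*D) := by gcongr; linarith
        _ ≤ 1 := by
          rw [← Real.exp_add, Real.exp_le_one_iff]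
          have := mul_le_mul_of_nonneg_left h2 (show 0 ≤ τ*u by nlinarith)
          linarith
    · push Not at h2
      have : Real.exp (τ*u*D) ≤ Real.exp (-(τ*d*(u+d)*b) + τ*(u+d)*D) := by
        rw [Real.exp_le_exp]
        have := mul_le_mul_of_nonneg_left h2.le (show 0 ≤ τ*d by positivity)
        linarith
      refine le_trans (mul_nonpos_of_nonneg_of_nonpos (Real.exp_pos _).le (by linarith)) zero_le_one
  · push Not at h1
    have : Real.exp (τ*u*D) ≤ Real.exp (τ*d*(u-d)*b + τ*(u-d)*D) := by
      rw [Real.exp_le_exp]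
      have := mul_le_mul_of_nonneg_left h1.le (show 0 ≤ τ*d by positivity)
      linarith
    exact mul_nonpos_of_nonneg_of_nonpos (Real.exp_pos _).le (by linarith)

omit H [IsProbabilityMeasure μ] in
lemma block_arith {d B L τ b F1 F2 F3 : ℝ} (hd : 0 < d) (hd1 : d ≤ 1/8) (hL : 0 ≤ L)
    (hLB : (2/d^2) * (Real.log 4 + 6*B) ≤ L) (hτb : τ * b = 2 * L)
    (q1 : Real.exp (-(3*B)) * Real.exp ((1-d^2/4)*((1-2*d)^2*L)) ≤ F1)
    (g2 : F2 ≤ Real.exp (3*B) * Real.exp ((1+d^2/4)*((1-2*d+d)^2*L)))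
    (g3 : F3 ≤ Real.exp (3*B) * Real.exp ((1+d^2/4)*((1-2*d-d)^2*L))) :
    Real.exp (-(3*B)) / 2 * Real.exp (-L) ≤ Real.exp (-(τ*(1-2*d)*((1-2*d)+d)*b)) *
      (F1 - Real.exp (-(τ*d*(1-2*d+d)*b)) * F2 - Real.exp (τ*d*(1-2*d-d)*b) * F3) := by
  have hA1' : Real.exp (-(τ*(1-2*d)*((1-2*d)+d)*b)) = Real.exp (-(2*((1-2*d)*(1-d)))*L) := by
    congr 1; linear_combination (-((1-2*d)*((1-2*d)+d)))*hτb
  have hA2' : Real.exp (-(τ*d*(1-2*d+d)*b)) = Real.exp (-(2*(d*(1-d)))*L) := by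
    congr 1; linear_combination (-(d*(1-2*d+d)))*hτb
  have hA3' : Real.exp (τ*d*(1-2*d-d)*b) = Real.exp ((2*(d*(1-3*d)))*L) := by
    congr 1; linear_combination (d*(1-2*d-d))*hτb
  rw [hA1', hA2', hA3']
  set P := Real.exp (((1-2*d)^2-d^2/4)*L) with hP
  have hPpos : 0 < P := Real.exp_pos _
  have hd2 : 0 < d^2 := by positivity
  have r1 : Real.exp (-(3*B)) * P ≤ Real.exp (-(3*B)) * Real.exp ((1-d^2/4)*((1-2*d)^2*L)) := by
    rw [hP]
    refine mul_le_mul_of_nonneg_left (Real.exp_le_exp.2 ?_) (Real.exp_pos _).le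
    have h1 : (1-2*d)^2 ≤ 1 := by nlinarith
    have : ((1-2*d)^2-d^2/4) ≤ (1-d^2/4)*(1-2*d)^2 := by nlinarith
    linarith [mul_le_mul_of_nonneg_right this hL]
  set Q := Real.exp (3*B) * Real.exp (-(d^2/2*L)) with hQ
  have q2 := mul_le_mul_of_nonneg_left g2 (Real.exp_pos (-(2*(d*(1-d)))*L)).le
  have q3 := mul_le_mul_of_nonneg_left g3 (Real.exp_pos ((2*(d*(1-3*d)))*L)).le
  have r2 : Real.exp (-(2*(d*(1-d)))*L) * (Real.exp (3*B) * Real.exp ((1+d^2/4)*((1-2*d+d)^2*L))) ≤ P * Q := by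
    rw [hP, hQ, ← Real.exp_add, ← Real.exp_add, ← Real.exp_add, ← Real.exp_add, Real.exp_le_exp]
    have h1 : (1-d)^2 ≤ 1 := by nlinarith
    have : -(2*(d*(1-d))) + (1+d^2/4)*(1-d)^2 ≤ ((1-2*d)^2-d^2/4) - d^2/2 := by nlinarith
    linarith [mul_le_mul_of_nonneg_right this hL]
  have r3 : Real.exp ((2*(d*(1-3*d)))*L) * (Real.exp (3*B) * Real.exp ((1+d^2/4)*((1-2*d-d)^2*L))) ≤ P * Q := by
    rw [hP, hQ, ← Real.exp_add, ← Real.exp_add, ← Real.exp_add, ← Real.exp_add, Real.exp_le_exp]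
    have h1 : (1-3*d)^2 ≤ 1 := by nlinarith
    have : (2*(d*(1-3*d))) + (1+d^2/4)*(1-3*d)^2 ≤ ((1-2*d)^2-d^2/4) - d^2/2 := by nlinarith
    linarith [mul_le_mul_of_nonneg_right this hL]
  have hQs : Q ≤ Real.exp (-(3*B)) / 4 := by
    have : Real.exp (-(3*B)) / 4 = Real.exp (-(3*B) - Real.log 4) := by
      rw [Real.exp_sub, Real.exp_log (by norm_num)]
    rw [this, hQ, ← Real.exp_add, Real.exp_le_exp]
    have h2 : Real.log 4 + 6*B ≤ d^2/2*L := by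
      have := mul_le_mul_of_nonneg_left hLB (show 0 ≤ d^2/2 by positivity)
      have e : d^2/2 * ((2/d^2) * (Real.log 4 + 6*B)) = Real.log 4 + 6*B := by field_simp
      linarith
    linarith
  have hfin : Real.exp (-(3*B))/2 * P ≤ F1 - Real.exp (-(2*(d*(1-d)))*L) * F2 - Real.exp ((2*(d*(1-3*d)))*L) * F3 := by
    have := mul_le_mul_of_nonneg_left hQs hPpos.le
    linarith
  refine le_trans ?_ (mul_le_mul_of_nonneg_left hfin (Real.exp_pos _).le)
  rw [hP, show Real.exp (-(2*((1-2*d)*(1-d)))*L) * (Real.exp (-(3*B))/2 * Real.exp (((1-2*d)^2-d^2/4)*L)) =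
          Real.exp (-(3*B))/2 * (Real.exp (-(2*((1-2*d)*(1-d)))*L) * Real.exp (((1-2*d)^2-d^2/4)*L)) by ring, ← Real.exp_add]
  gcongr
  have : 2*((1-2*d)*(1-d)) - ((1-2*d)^2 - d^2/4) ≤ 1 := by nlinarith
  linarith [mul_le_mul_of_nonneg_right this hL]

/-- conditional lower bound for one block -/
lemma block {d : ℝ} (hd : 0 < d) (hd1 : d ≤ 1/8) : ∃ τ0 L0 : ℝ, 0 < τ0 ∧ ∀ (m N : ℕ) (L τ b : ℝ),
    0 < τ → τ ≤ τ0 → 0 ≤ b → L0 ≤ L → 0 ≤ L → τ * b = 2 * L → σ^2*τ^2/2 * N = L →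
    ∀ᵐ ω ∂μ, Real.exp (-(3*B)) / 2 * Real.exp (-L) ≤
      (μ[({ω | (1-3*d)*b ≤ S (m+N) ω - S m ω}).indicator (1 : Ω → ℝ) | ℱ m]) ω := by
  set η := d^2/4 with hη
  have hη0 : 0 < η := by positivity
  have hη1 : η < 1 := by nlinarith
  obtain ⟨δ', hδ', hc⟩ := H.cond_exp_bounds hη0 hη1
  set L0 := max 0 ((2/d^2) * (Real.log 4 + 6*B)) with hL0
  refine ⟨δ', L0, hδ', ?_⟩
  intro m N L τ b hτ hτ0 hb hL0L hL hτb hN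
  set u := 1 - 2*d with hu
  have hbd : ∀ v : ℝ, 0 ≤ v → v ≤ 1 → |τ * v| ≤ δ' := by
    intro v hv0 hv1
    rw [abs_of_nonneg (by positivity)]
    nlinarith
  have hexp : ∀ v : ℝ, σ^2*(τ*v)^2/2 * N = v^2 * L := by
    intro v; rw [← hN]; ring
  obtain ⟨i1, c1⟩ := (hc (τ*u) (hbd u (by linarith) (by linarith))).2 m N
  obtain ⟨i2, c2⟩ := (hc (τ*(u+d)) (hbd (u+d) (by linarith) (by linarith))).2 m N
  obtain ⟨i3, c3⟩ := (hc (τ*(u-d)) (hbd (u-d) (by linarith) (by linarith))).2 m N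
  set f1 : Ω → ℝ := fun ω => Real.exp (τ*u * (S (m+N) ω - S m ω)) with hf1
  set f2 : Ω → ℝ := fun ω => Real.exp (τ*(u+d) * (S (m+N) ω - S m ω)) with hf2
  set f3 : Ω → ℝ := fun ω => Real.exp (τ*(u-d) * (S (m+N) ω - S m ω)) with hf3
  set A2 := Real.exp (-(τ*d*(u+d)*b)) with hA2
  set A3 := Real.exp (τ*d*(u-d)*b) with hA3
  set A1 := Real.exp (-(τ*u*(u+d)*b)) with hA1
  set G := {ω | (1-3*d)*b ≤ S (m+N) ω - S m ω} with hG
  have hGm : MeasurableSet G := by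
    have a1 := (H.S_meas (m+N)).mono (ℱ.le _) le_rfl
    have a2 := (H.S_meas m).mono (ℱ.le _) le_rfl
    exact measurableSet_le measurable_const (a1.sub a2)
  have hmono : μ[A1 • (f1 - A2 • f2 - A3 • f3) | ℱ m] ≤ᵐ[μ] μ[G.indicator (1 : Ω → ℝ) | ℱ m] := by
    refine condExp_mono (((i1.sub (i2.smul A2)).sub (i3.smul A3)).smul A1)
      ((integrable_const (1:ℝ)).indicator hGm) (ae_of_all _ fun ω => ?_)
    have := pointwise_lower (D := S (m+N) ω - S m ω) hτ.le hb hd.le (show d ≤ u by linarith)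
    have e : u - d = 1 - 3*d := by rw [hu]; ring
    simp only [Pi.smul_apply, Pi.sub_apply, smul_eq_mul]
    refine this.trans (le_of_eq ?_)
    rw [e, Set.indicator_apply]; rfl
  have s1 := condExp_smul (μ := μ) A1 (f1 - A2 • f2 - A3 • f3) (ℱ m)
  have s2 := condExp_sub (μ := μ) (i1.sub (i2.smul A2)) (i3.smul A3) (ℱ m)
  have s3 := condExp_sub (μ := μ) i1 (i2.smul A2) (ℱ m)
  have s4 := condExp_smul (μ := μ) A2 f2 (ℱ m)
  have s5 := condExp_smul (μ := μ) A3 f3 (ℱ m)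
  filter_upwards [hmono, s1, s2, s3, s4, s5, c1, c2, c3] with ω k0 k1 k2 k3 k4 k5 g1 g2 g3
  refine le_trans ?_ k0
  rw [k1]
  simp only [Pi.smul_apply, smul_eq_mul]
  rw [k2]
  simp only [Pi.sub_apply]
  rw [k3]
  simp only [Pi.sub_apply]
  rw [k4, k5]
  simp only [Pi.smul_apply, smul_eq_mul]
  rw [mul_assoc (1-η), hexp] at g1
  rw [mul_assoc (1+η), hexp] at g2 g3
  exact block_arith hd hd1 hL ((le_max_right _ _).trans hL0L) hτb g1.1 g2.2 g3.2

lemma lower_blocks {d : ℝ} (hd : 0 < d) (hd1 : d ≤ 1/8) (θ : ℕ) (hθ : 2 ≤ θ) :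
    ∀ᵐ ω ∂μ, ∃ᶠ j : ℕ in atTop,
      (1-3*d) * (σ * Real.sqrt (2 * ((θ:ℝ)^(j+1) - (θ:ℝ)^j) * Real.log (Real.log ((θ:ℝ)^(j+1))))) ≤
        S (θ^(j+1)) ω - S (θ^j) ω := by
  have hσ := H.σ_pos
  obtain ⟨τ0, L0, hτ0, hblock⟩ := H.block hd hd1
  have hθ1 : (1:ℝ) < θ := by exact_mod_cast (by omega : 1 < θ)
  have hθ2 : (2:ℝ) ≤ θ := by exact_mod_cast hθ
  have hlθ : 0 < Real.log θ := Real.log_pos hθ1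
  set L : ℕ → ℝ := fun j => Real.log (Real.log ((θ:ℝ)^(j+1))) with hL
  set N : ℕ → ℝ := fun j => (θ:ℝ)^(j+1) - (θ:ℝ)^j with hN
  set b : ℕ → ℝ := fun j => σ * Real.sqrt (2 * N j * L j) with hb
  have hNge : ∀ j, (θ:ℝ)^j ≤ N j := by
    intro j; simp only [hN, pow_succ]
    have : 0 < (θ:ℝ)^j := by positivity
    nlinarith
  have hNpos : ∀ j, 0 < N j := fun j => lt_of_lt_of_le (by positivity) (hNge j)
  have hθp : 0 < θ := by omega
  let 𝒢 : Filtration ℕ m0 :=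
    { seq := fun j => ℱ (θ^j)
      mono' := fun i j hij => ℱ.mono (Nat.pow_le_pow_right hθp hij)
      le' := fun j => ℱ.le _ }
  let s : ℕ → Set Ω := fun j => Nat.casesOn j ∅
    (fun j => {ω | (1-3*d) * b j ≤ S (θ^(j+1)) ω - S (θ^j) ω})
  have hs : ∀ j, MeasurableSet[𝒢 j] (s j) := by
    intro j
    cases j with
    | zero => exact @MeasurableSet.empty _ (𝒢 0)
    | succ j =>
      have a1 := (H.S_meas (θ^(j+1)))
      have a2 := (H.S_meas (θ^j)).mono (ℱ.mono (Nat.pow_le_pow_right (by omega) (Nat.le_succ j))) le_rfl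
      exact (a1.sub a2) (measurableSet_Ici (a := (1-3*d) * b j))
  have hbc := ae_mem_limsup_atTop_iff (ℱ := 𝒢) μ hs
  -- τ
  set τ : ℕ → ℝ := fun j => Real.sqrt (2 * L j / N j) / σ with hτ
  have hτlim : Tendsto τ atTop (nhds 0) := by
    have h1 : Tendsto (fun j => L j / N j) atTop (nhds 0) := by
      have h2 : Tendsto (fun j : ℕ => θ * (Real.log (Real.log ((θ:ℝ)^(j+1))) / (θ:ℝ)^(j+1))) atTop (nhds 0) := by
        have := ((loglog_div_tendsto hθ1).comp (tendsto_add_atTop_nat 1)).const_mul (θ:ℝ)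
        simpa using this
      refine squeeze_zero' ?_ ?_ h2
      · filter_upwards [(tendsto_add_atTop_nat 1).eventually (logj_ge hθ1 0)] with j hj
        exact div_nonneg hj (hNpos j).le
      · filter_upwards [(tendsto_add_atTop_nat 1).eventually (logj_ge hθ1 0)] with j hj
        have : (θ:ℝ) * (Real.log (Real.log ((θ:ℝ)^(j+1))) / (θ:ℝ)^(j+1)) = L j / (θ:ℝ)^j := by
          simp only [hL]
          generalize Real.log (Real.log ((θ:ℝ)^(j+1))) = l
          rw [pow_succ]; field_simp
        rw [this]
        exact div_le_div_of_nonneg_left hj (by positivity) (hNge j)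
    have := ((h1.const_mul 2).sqrt).div_const σ
    simp only [mul_zero, Real.sqrt_zero, zero_div] at this
    refine this.congr fun j => ?_
    simp only [hτ, mul_div_assoc]
  have hev : ∀ᶠ j : ℕ in atTop, ∀ᵐ ω ∂μ, Real.exp (-(3*B)) / 2 / Real.log θ * (1 / ((j:ℝ)+1)) ≤
      (μ[(s (j+1)).indicator (1 : Ω → ℝ) | 𝒢 j]) ω := by
    filter_upwards [hτlim.eventually_lt_const hτ0, (tendsto_add_atTop_nat 1).eventually (logj_ge hθ1 1),
      (tendsto_add_atTop_nat 1).eventually (logj_ge hθ1 L0)] with j h1 h2 h3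
    change 1 ≤ L j at h2
    change L0 ≤ L j at h3
    have hNj := hNpos j
    have hτp : 0 < τ j := by simp only [hτ]; positivity
    have hnat : θ^j ≤ θ^(j+1) := Nat.pow_le_pow_right (by omega) (Nat.le_succ j)
    have hcast : ((θ^(j+1) - θ^j : ℕ) : ℝ) = N j := by
      rw [Nat.cast_sub hnat]; push_cast; rfl
    have := hblock (θ^j) (θ^(j+1) - θ^j) (L j) (τ j) (b j) hτp h1.le (by simp only [hb]; positivity) h3
      (by linarith) (by
        simp only [hτ, hb]
        have : Real.sqrt (2 * L j / N j) * Real.sqrt (2 * N j * L j) = 2 * L j := by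
          rw [← Real.sqrt_mul (by positivity)]
          rw [show 2 * L j / N j * (2 * N j * L j) = (2 * L j)^2 by field_simp]
          exact Real.sqrt_sq (by positivity)
        rw [div_mul_eq_mul_div, ← mul_assoc, mul_comm _ σ, mul_assoc, this, mul_div_cancel_left₀ _ hσ.ne']) (by
        rw [hcast]; simp only [hτ]
        rw [div_pow, Real.sq_sqrt (by positivity)]; field_simp)
    rw [Nat.add_sub_cancel' hnat] at this
    filter_upwards [this] with ω hω
    refine le_trans (le_of_eq ?_) hω
    rw [Real.exp_neg (L j)]
    simp only [hL]
    rw [Real.exp_log, Real.log_pow]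
    · push_cast; field_simp
    · rw [Real.log_pow]; positivity
  obtain ⟨J, hJ⟩ := eventually_atTop.1 hev
  have hall : ∀ᵐ ω ∂μ, ∀ j : ℕ, J ≤ j → Real.exp (-(3*B)) / 2 / Real.log θ * (1 / ((j:ℝ)+1)) ≤
      (μ[(s (j+1)).indicator (1 : Ω → ℝ) | 𝒢 j]) ω := by
    rw [ae_all_iff]; intro j
    by_cases hj : J ≤ j
    · filter_upwards [hJ j hj] with ω h _ using h
    · exact ae_of_all _ fun ω h => absurd h hj
  have hnn : ∀ᵐ ω ∂μ, ∀ j : ℕ, 0 ≤ (μ[(s (j+1)).indicator (1 : Ω → ℝ) | 𝒢 j]) ω := by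
    rw [ae_all_iff]; intro j
    exact condExp_nonneg (ae_of_all _ fun ω => Set.indicator_nonneg (fun _ _ => zero_le_one) _)
  filter_upwards [hbc, hall, hnn] with ω h1 h2 h3
  set c := Real.exp (-(3*B)) / 2 / Real.log θ with hc
  have hc0 : 0 < c := by positivity
  have hlim : Tendsto (fun n => ∑ k ∈ Finset.range n,
      (μ[(s (k + 1)).indicator (1 : Ω → ℝ) | 𝒢 k]) ω) atTop atTop := by
    have t1 := (Real.tendsto_sum_range_one_div_nat_succ_atTop.const_mul_atTop hc0)
    have t2 := tendsto_atTop_add_const_right atTop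
      (-(∑ k ∈ Finset.range J, c * (1 / ((k:ℝ)+1)))) t1
    refine tendsto_atTop_mono' _ ?_ t2
    filter_upwards [eventually_ge_atTop J] with n hn
    rw [Finset.mul_sum, ← Finset.sum_range_add_sum_Ico _ hn]
    have h4 : ∑ k ∈ Finset.Ico J n, c * (1 / ((k:ℝ)+1)) ≤ ∑ k ∈ Finset.Ico J n,
      (μ[(s (k + 1)).indicator (1 : Ω → ℝ) | 𝒢 k]) ω :=
      Finset.sum_le_sum fun k hk => h2 k (Finset.mem_Ico.1 hk).1
    have h5 : ∑ k ∈ Finset.Ico J n, (μ[(s (k + 1)).indicator (1 : Ω → ℝ) | 𝒢 k]) ω ≤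
       ∑ k ∈ Finset.range n, (μ[(s (k + 1)).indicator (1 : Ω → ℝ) | 𝒢 k]) ω := by
      refine Finset.sum_le_sum_of_subset_of_nonneg ?_ (fun k _ _ => h3 k)
      intro k hk; simp at hk ⊢; omega
    linarith
  have hmem := h1.2 hlim
  rw [mem_limsup_iff_frequently_mem] at hmem
  rw [frequently_atTop] at hmem ⊢
  intro a
  obtain ⟨j, hj, hjs⟩ := hmem (a+1)
  obtain ⟨i, rfl⟩ : ∃ i, j = i+1 := ⟨j-1, by omega⟩
  exact ⟨i, by omega, hjs⟩

lemma lower {ε : ℝ} (hε : 0 < ε) (hε1 : ε < 1) :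
    ∀ᵐ ω ∂μ, ∃ᶠ n : ℕ in atTop, (1-ε) * phi σ n ≤ S n ω := by
  have hσ := H.σ_pos
  obtain ⟨K, hK⟩ := exists_nat_ge (max 2 (6/ε))
  have hK2 : (2:ℝ) ≤ K := (le_max_left _ _).trans hK
  have hK6 : 6/ε ≤ (K:ℝ) := (le_max_right _ _).trans hK
  have hK6' : 1/(K:ℝ) ≤ ε/6 := by
    rw [div_le_div_iff₀ (by linarith) (by norm_num)]
    rw [div_le_iff₀ hε] at hK6; linarith
  have hK2n : 2 ≤ K := by exact_mod_cast hK2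
  have hθ : 2 ≤ K^2 := by nlinarith
  have hθ1 : (1:ℝ) < ((K^2:ℕ):ℝ) := by exact_mod_cast (by omega : 1 < K^2)
  set d := ε/8 with hd
  have h1 := H.lower_blocks (d := d) (by positivity) (by linarith) (K^2) hθ
  have h2 := H.neg.upper (ε := 1/2) (by norm_num) (by norm_num)
  filter_upwards [h1, h2] with ω h1 h2
  have htend : Tendsto (fun j : ℕ => (K^2)^(j+1)) atTop atTop :=
    (tendsto_pow_atTop_atTop_of_one_lt (by omega : 1 < K^2)).comp (tendsto_add_atTop_nat 1)
  refine htend.frequently ?_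
  have h2' := (tendsto_pow_atTop_atTop_of_one_lt (by omega : 1 < K^2)).eventually h2
  refine (h1.and_eventually (h2'.and (logj_ge hθ1 1))).mono ?_
  rintro j ⟨g1, g2, g3⟩
  set θ : ℝ := ((K^2:ℕ):ℝ) with hθd
  have hθK : θ = (K:ℝ)^2 := by rw [hθd]; push_cast; rfl
  have hKpos : (0:ℝ) < K := by linarith
  have hθpos : 0 < θ := by linarith
  push_cast at g1 g2 ⊢
  rw [← hθK] at g2 ⊢
  set L := Real.log (Real.log (θ^(j+1))) with hL
  have hLL : Real.log (Real.log (θ^j)) ≤ L := by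
    have : 0 < Real.log (θ^j) := by
      by_contra hcon
      push Not at hcon
      have h0 : 0 ≤ Real.log (θ^j) := Real.log_nonneg (one_le_pow₀ hθ1.le)
      have : Real.log (θ^j) = 0 := le_antisymm hcon h0
      rw [this, Real.log_zero] at g3; linarith
    refine Real.log_le_log this (Real.log_le_log (by positivity) ?_)
    exact pow_le_pow_right₀ hθ1.le (Nat.le_succ j)
  have hL1 : 1 ≤ L := g3.trans hLL
  set F := phi σ (θ^(j+1)) with hF
  have hF0 : 0 ≤ F := phi_nonneg hσ.le
  have e1 : (1 - 1/(K:ℝ)) * F ≤ σ * Real.sqrt (2 * (θ^(j+1) - θ^j) * L) := by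
    rw [hF, phi, ← mul_assoc, mul_comm _ σ, mul_assoc]
    refine mul_le_mul_of_nonneg_left ?_ hσ.le
    have hk1 : 0 ≤ 1 - 1/(K:ℝ) := by linarith
    rw [← Real.sqrt_sq hk1, ← Real.sqrt_mul (by positivity)]
    apply Real.sqrt_le_sqrt
    have : (1 - 1/(K:ℝ))^2 * θ^(j+1) ≤ θ^(j+1) - θ^j := by
      have e : θ^(j+1) - θ^j = θ^(j+1) * (1 - (1/(K:ℝ))^2) := by
        rw [hθK]; field_simp; ring
      rw [e, mul_comm]
      refine mul_le_mul_of_nonneg_left ?_ (by positivity)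
      have : 0 < 1/(K:ℝ) := by positivity
      nlinarith
    nlinarith
  have e2 : phi σ (θ^j) ≤ 1/(K:ℝ) * F := by
    rw [hF, phi, phi, mul_left_comm]
    refine mul_le_mul_of_nonneg_left ?_ hσ.le
    rw [← Real.sqrt_sq (show 0 ≤ 1/(K:ℝ) by positivity), ← Real.sqrt_mul (by positivity)]
    apply Real.sqrt_le_sqrt
    have e : (1/(K:ℝ))^2 * (2*θ^(j+1)*L) = 2 * θ^j * L := by
      clear_value L
      rw [pow_succ, hθK]; field_simp; ring
    rw [e]
    gcongr
  have hd8 : 0 ≤ 1 - 3*d := by rw [hd]; linarith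
  have e3 := mul_le_mul_of_nonneg_left e1 hd8
  have e4 : (1 - 3*d) * ((1 - 1/(K:ℝ)) * F) - (1+1/2) * (1/(K:ℝ) * F) ≥ (1 - ε) * F := by
    have : (1 - 3*d) * (1 - 1/(K:ℝ)) - (1+1/2) * (1/(K:ℝ)) ≥ 1 - ε := by
      have : 0 < 1/(K:ℝ) := by positivity
      rw [hd]; nlinarith
    nlinarith
  nlinarith

theorem lil : ∀ᵐ ω ∂μ, ∀ ε : ℝ, 0 < ε → (∀ᶠ n : ℕ in atTop, S n ω ≤ (1+ε) * phi σ n) ∧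
    (∃ᶠ n : ℕ in atTop, (1-ε) * phi σ n ≤ S n ω) := by
  have hσ := H.σ_pos
  have h1 : ∀ᵐ ω ∂μ, ∀ k : ℕ, (∀ᶠ n : ℕ in atTop, S n ω ≤ (1+1/((k:ℝ)+2)) * phi σ n) ∧
    (∃ᶠ n : ℕ in atTop, (1-1/((k:ℝ)+2)) * phi σ n ≤ S n ω) := by
    rw [ae_all_iff]; intro k
    have a : 0 < 1/((k:ℝ)+2) := by positivity
    have b : 1/((k:ℝ)+2) < 1 := by
      rw [div_lt_one (by positivity)]; have : (0:ℝ) ≤ k := by positivity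
      linarith
    filter_upwards [H.upper a b, H.lower a b] with ω p q using ⟨p, q⟩
  filter_upwards [h1] with ω h ε hε
  obtain ⟨k, hk⟩ := exists_nat_one_div_lt hε
  have hk2 : 1/((k:ℝ)+2) ≤ ε := le_trans (by gcongr; norm_num) hk.le
  refine ⟨(h k).1.mono fun n hn => hn.trans ?_, (h k).2.mono fun n hn => le_trans ?_ hn⟩
  · have := phi_nonneg (x := n) hσ.le
    gcongr
  · have := phi_nonneg (x := n) hσ.le
    gcongr

end LILData
end LIL
end GK

namespace GK

noncomputable def wt (y : ℝ) (j : ℕ) : ℝ := (1+y)/((j+1+y)*(j+2+y))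
noncomputable def nx (y : ℝ) (j : ℕ) : ℝ := 1/(j+1+y)
noncomputable def Pop (F : ℝ → ℝ) (y : ℝ) : ℝ := ∑' j, wt y j * F (nx y j)

lemma wt_nonneg {y : ℝ} (hy : 0 ≤ y) (j : ℕ) : 0 ≤ wt y j := by unfold wt; positivity
lemma wt_pos {y : ℝ} (hy : 0 ≤ y) (j : ℕ) : 0 < wt y j := by unfold wt; positivity
lemma nx_pos {y : ℝ} (hy : 0 ≤ y) (j : ℕ) : 0 < nx y j := by unfold nx; positivity
lemma nx_mem {y : ℝ} (hy : 0 ≤ y) (j : ℕ) : nx y j ∈ Icc (0:ℝ) 1 := by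
  refine ⟨(nx_pos hy j).le, ?_⟩
  unfold nx
  rw [div_le_one (by positivity)]
  have : (0:ℝ) ≤ j := by positivity
  linarith

lemma wt_sum (y : ℝ) (hy : 0 ≤ y) (n : ℕ) :
    ∑ j ∈ Finset.range n, wt y j = 1 - (1+y)/(n+1+y) := by
  induction n with
  | zero => simp; field_simp; ring
  | succ n ih =>
    rw [Finset.sum_range_succ, ih, wt]; push_cast; field_simp; ring

lemma wt_hasSum {y : ℝ} (hy : 0 ≤ y) : HasSum (wt y) 1 := by
  rw [hasSum_iff_tendsto_nat_of_nonneg (wt_nonneg hy)]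
  simp_rw [wt_sum y hy]
  have : Tendsto (fun n : ℕ => (1+y)/((n:ℝ)+1+y)) atTop (nhds 0) := by
    refine Tendsto.div_atTop tendsto_const_nhds ?_
    simp_rw [add_assoc]
    exact tendsto_atTop_add_const_right _ _ tendsto_natCast_atTop_atTop
  simpa using this.const_sub 1

lemma wt_le {y : ℝ} (hy : y ∈ Icc (0:ℝ) 1) (j : ℕ) : wt y j ≤ 2/((j:ℝ)+1)^2 := by
  unfold wt
  have h1 := hy.1; have h2 := hy.2
  have h3 : (0:ℝ) ≤ j := by positivity
  apply div_le_div₀ (by norm_num) (by linarith) (by positivity)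
  nlinarith

lemma wt_lip {x y : ℝ} (hx : x ∈ Icc (0:ℝ) 1) (hy : y ∈ Icc (0:ℝ) 1) (j : ℕ) :
    |wt x j - wt y j| ≤ 5/((j:ℝ)+1)^2 * |x - y| := by
  have h1 := hy.1; have h2 := hy.2; have h1' := hx.1; have h2' := hx.2
  have h3 : (0:ℝ) ≤ j := by positivity
  set a : ℝ := (j:ℝ)+1 with ha
  have ha1 : 1 ≤ a := by linarith
  have e : wt x j - wt y j = (a*(a+1) - x*y - (x+y+2*a+1)) / (((a+x)*(a+1+x))*((a+y)*(a+1+y))) * (x-y) := by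
    unfold wt
    rw [show (j:ℝ)+2 = a+1 by rw [ha]; ring]
    field_simp
    ring
  rw [e, abs_mul]
  refine mul_le_mul_of_nonneg_right ?_ (abs_nonneg _)
  have hD : 0 < ((a+x)*(a+1+x))*((a+y)*(a+1+y)) := by positivity
  rw [abs_div, abs_of_pos hD, div_le_div_iff₀ hD (by positivity)]
  have n1 : |a*(a+1) - x*y - (x+y+2*a+1)| ≤ 5*(a*(a+1)) := by
    have : 0 ≤ x*y := by positivity
    have : x*y ≤ 1 := by nlinarith
    rw [abs_le]; constructor <;> nlinarith
  have d1 : a*(a+1) ≤ (a+x)*(a+1+x) := by nlinarith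
  have d2 : a^2 ≤ (a+y)*(a+1+y) := by nlinarith
  calc _ ≤ 5*(a*(a+1)) * a^2 := by gcongr
    _ ≤ 5 * (((a+x)*(a+1+x))*((a+y)*(a+1+y))) := by
      rw [mul_assoc]; gcongr

lemma summ32 : Summable (fun j : ℕ => Real.sqrt ((j:ℝ)+1) / ((j:ℝ)+1)^2) := by
  have h : Summable (fun j : ℕ => ((j:ℝ)+1)^(-(3/2:ℝ))) := by
    have := (summable_nat_add_iff 1).2 (Real.summable_nat_rpow.2 (show -(3/2:ℝ) < -1 by norm_num))
    simpa using this
  refine h.congr fun j => ?_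
  have hj : (0:ℝ) < (j:ℝ)+1 := by positivity
  rw [Real.sqrt_eq_rpow, ← Real.rpow_natCast, ← Real.rpow_sub hj]; norm_num

/-- crude summability -/
lemma wt_summable {E : Type*} [NormedAddCommGroup E] [NormedSpace ℝ E] [CompleteSpace E]
    {y M : ℝ} (hy : y ∈ Icc (0:ℝ) 1) {g : ℕ → E}
    (hg : ∀ j, ‖g j‖ ≤ M * Real.sqrt ((j:ℝ)+1)) :
    Summable (fun j => wt y j • g j) := by
  refine Summable.of_norm_bounded (summ32.mul_left (2*M)) fun j => ?_
  rw [norm_smul, Real.norm_of_nonneg (wt_nonneg hy.1 j)]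
  have hM := (norm_nonneg _).trans (hg j)
  calc _ ≤ 2/((j:ℝ)+1)^2 * (M * Real.sqrt ((j:ℝ)+1)) := by
        gcongr
        · exact wt_le hy j
        · exact hg j
    _ = _ := by ring

lemma wt_tsum_le {E : Type*} [NormedAddCommGroup E] [NormedSpace ℝ E] [CompleteSpace E]
    {y M : ℝ} (hy : y ∈ Icc (0:ℝ) 1) {g : ℕ → E}
    (hg : ∀ j, ‖g j‖ ≤ M * Real.sqrt ((j:ℝ)+1)) :
    ‖∑' j, wt y j • g j‖ ≤ 2 * M * ∑' j : ℕ, Real.sqrt ((j:ℝ)+1) / ((j:ℝ)+1)^2 := by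
  rw [← tsum_mul_left]
  refine tsum_of_norm_bounded (summ32.mul_left (2*M)).hasSum fun j => ?_
  rw [norm_smul, Real.norm_of_nonneg (wt_nonneg hy.1 j)]
  have hM := (norm_nonneg _).trans (hg j)
  calc _ ≤ 2/((j:ℝ)+1)^2 * (M * Real.sqrt ((j:ℝ)+1)) := by
        gcongr
        · exact wt_le hy j
        · exact hg j
    _ = _ := by ring

def Lip (L : ℝ) (F : ℝ → ℝ) : Prop := ∀ x ∈ Icc (0:ℝ) 1, ∀ y ∈ Icc (0:ℝ) 1, |F x - F y| ≤ L * |x - y|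

/-- crude Lipschitz bound -/
lemma crude_lip {G : ℕ → ℝ → ℝ} {M : ℝ} (hM : 0 ≤ M)
    (h1 : ∀ j, ∀ y ∈ Icc (0:ℝ) 1, |G j y| ≤ M * Real.sqrt ((j:ℝ)+1))
    (h2 : ∀ j, ∀ x ∈ Icc (0:ℝ) 1, ∀ y ∈ Icc (0:ℝ) 1, |G j x - G j y| ≤ M * Real.sqrt ((j:ℝ)+1) * |x-y|) :
    ∃ L, 0 ≤ L ∧ Lip L (fun y => ∑' j, wt y j * G j y) := by
  set Sg := ∑' j : ℕ, Real.sqrt ((j:ℝ)+1) / ((j:ℝ)+1)^2 with hSg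
  have hSg0 : 0 ≤ Sg := tsum_nonneg fun j => by positivity
  refine ⟨7 * M * Sg, by positivity, fun x hx y hy => ?_⟩
  have s1 := wt_summable (E := ℝ) hx (g := fun j => G j x) (fun j => h1 j x hx)
  have s2 := wt_summable (E := ℝ) hy (g := fun j => G j y) (fun j => h1 j y hy)
  simp only [smul_eq_mul] at s1 s2
  simp only
  rw [← s1.tsum_sub s2]
  have : 7 * M * Sg * |x - y| = ∑' j : ℕ, (7 * M * |x-y|) * (Real.sqrt ((j:ℝ)+1) / ((j:ℝ)+1)^2) := by
    rw [tsum_mul_left]; ring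
  rw [this, ← Real.norm_eq_abs]
  refine tsum_of_norm_bounded (summ32.mul_left _).hasSum fun j => ?_
  rw [Real.norm_eq_abs]
  have e : wt x j * G j x - wt y j * G j y = wt x j * (G j x - G j y) + (wt x j - wt y j) * G j y := by ring
  rw [e]
  refine (abs_add_le _ _).trans ?_
  rw [abs_mul, abs_mul, abs_of_nonneg (wt_nonneg hx.1 j)]
  calc _ ≤ 2/((j:ℝ)+1)^2 * (M * Real.sqrt ((j:ℝ)+1) * |x-y|) + (5/((j:ℝ)+1)^2 * |x - y|) * (M * Real.sqrt ((j:ℝ)+1)) := by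
        gcongr
        · exact wt_le hx j
        · exact h2 j x hx y hy
        · exact wt_lip hx hy j
        · exact h1 j y hy
    _ = _ := by ring

lemma nx_diff {x y : ℝ} (hx : 0 ≤ x) (hy : 0 ≤ y) (j : ℕ) :
    |nx x j - nx y j| = |x - y| / ((j+1+x)*(j+1+y)) := by
  have : nx x j - nx y j = (y - x)/((j+1+x)*(j+1+y)) := by
    unfold nx; field_simp; ring
  rw [this, abs_div, abs_sub_comm, abs_of_pos (show 0 < ((j:ℝ)+1+x)*(j+1+y) by positivity)]

lemma nx_lip {x y : ℝ} (hx : 0 ≤ x) (hy : 0 ≤ y) (j : ℕ) : |nx x j - nx y j| ≤ |x - y| := by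
  rw [nx_diff hx hy]
  apply div_le_self (abs_nonneg _)
  have : (0:ℝ) ≤ j := by positivity
  nlinarith [mul_nonneg hx hy]

lemma lip_bdd {F : ℝ → ℝ} {L : ℝ} (hL : 0 ≤ L) (hF : Lip L F) : ∀ y ∈ Icc (0:ℝ) 1, |F y| ≤ |F 0| + L := by
  intro y hy
  have := hF y hy 0 (by simp)
  have h2 := abs_sub_abs_le_abs_sub (F y) (F 0)
  have h3 : L * |y - 0| ≤ L * 1 := by
    gcongr; rw [sub_zero, abs_of_nonneg hy.1]; exact hy.2
  linarith

lemma one_le_rt (j : ℕ) : 1 ≤ Real.sqrt ((j:ℝ)+1) := by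
  rw [Real.one_le_sqrt]; have : (0:ℝ) ≤ j := by positivity
  linarith

lemma Pop_summable {F : ℝ → ℝ} {M : ℝ} (hF : ∀ y ∈ Icc (0:ℝ) 1, |F y| ≤ M) {y : ℝ} (hy : y ∈ Icc (0:ℝ) 1) :
    Summable (fun j => wt y j * F (nx y j)) := by
  have := wt_summable (E := ℝ) hy (g := fun j => F (nx y j)) (M := M) (fun j => by
    have h1 := hF _ (nx_mem hy.1 j)
    have := one_le_rt j
    rw [Real.norm_eq_abs]
    nlinarith [abs_nonneg (F (nx y j))])
  simpa using this

lemma abel (x y : ℝ) (hx : 0 ≤ x) (hy : 0 ≤ y) (F : ℕ → ℝ) (n : ℕ) :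
    ∑ j ∈ Finset.range (n+1), (wt x j - wt y j) * F j =
     ∑ j ∈ Finset.range n, ((x-y) * (j+1) / ((j+2+x)*(j+2+y))) * (F (j+1) - F j)
      - ((x-y) * (n+1) / ((n+2+x)*(n+2+y))) * F n := by
  induction n with
  | zero => simp [wt]; field_simp; ring
  | succ n ih =>
    rw [Finset.sum_range_succ, ih, Finset.sum_range_succ]
    have : wt x (n+1) - wt y (n+1) = ((x-y) * (n+1) / ((n+2+x)*(n+2+y))) - ((x-y) * (n+2) / ((n+3+x)*(n+3+y))) := by
      simp only [wt]; push_cast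
      rw [show (n:ℝ)+1+1+x = n+2+x by ring, show (n:ℝ)+1+1+y = n+2+y by ring,
        show (n:ℝ)+1+2+x = n+3+x by ring, show (n:ℝ)+1+2+y = n+3+y by ring]
      have a1 : (n:ℝ)+2+x ≠ 0 := by positivity
      have a2 : (n:ℝ)+2+y ≠ 0 := by positivity
      have a3 : (n:ℝ)+3+x ≠ 0 := by positivity
      have a4 : (n:ℝ)+3+y ≠ 0 := by positivity
      field_simp; ring
    rw [this]; push_cast
    rw [show (n:ℝ)+1+1 = n+2 by ring, show (n:ℝ)+1+2 = n+3 by ring]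
    ring

lemma part2 {F : ℝ → ℝ} {L : ℝ} (hL : 0 ≤ L) (hF : Lip L F) {x y : ℝ} (hx : x ∈ Icc (0:ℝ) 1) (hy : y ∈ Icc (0:ℝ) 1) :
    |∑' j, (wt x j - wt y j) * F (nx y j)| ≤ 1/4 * L * |x-y| := by
  set M := |F 0| + L with hMd
  have hM : 0 ≤ M := by positivity
  have hb := lip_bdd hL hF
  have hs : Summable (fun j => (wt x j - wt y j) * F (nx y j)) := by
    have s1 := wt_summable (E := ℝ) hx (g := fun j => F (nx y j)) (M := M) (fun j => by
      have h1 := hb _ (nx_mem hy.1 j)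
      have := one_le_rt j
      rw [Real.norm_eq_abs]
      nlinarith [abs_nonneg (F (nx y j))])
    have s2 := Pop_summable hb hy
    simp only [smul_eq_mul] at s1
    refine (s1.sub s2).congr fun j => by ring
  have ht := (hs.hasSum.tendsto_sum_nat.comp (tendsto_add_atTop_nat 1)).abs
  have hr : Tendsto (fun n : ℕ => 1/4 * L * |x-y| + M * |x - y| * (1/((n:ℝ)+1))) atTop (nhds (1/4 * L * |x-y| + M * |x-y| * 0)) :=
    (tendsto_one_div_add_atTop_nhds_zero_nat.const_mul _).const_add _
  rw [mul_zero, add_zero] at hr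
  refine le_of_tendsto_of_tendsto' ht hr fun n => ?_
  simp only [Function.comp]
  rw [abel x y hx.1 hy.1 (fun j => F (nx y j)) n]
  refine (abs_sub _ _).trans (add_le_add ?_ ?_)
  · refine (Finset.abs_sum_le_sum_abs _ _).trans ?_
    have key : ∀ j ∈ Finset.range n, |((x-y) * (j+1) / ((j+2+x)*(j+2+y))) * (F (nx y (j+1)) - F (nx y j))| ≤
        (L * |x-y|) * (1/2 * (1/(((j:ℝ)+1)*(j+2)) - 1/(((j:ℝ)+2)*(j+3)))) := by
      intro j _
      have hj : (0:ℝ) ≤ j := by positivity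
      have d1 : |F (nx y (j+1)) - F (nx y j)| ≤ L * (1/((j+1)*(j+2))) := by
        refine (hF _ (nx_mem hy.1 _) _ (nx_mem hy.1 _)).trans ?_
        gcongr
        have : nx y (j+1) - nx y j = -(1/((j+1+y)*(j+2+y))) := by
          have := hy.1
          unfold nx; push_cast; field_simp; ring
        rw [this, abs_neg, abs_of_pos (by have := hy.1; positivity)]
        have := hy.1
        apply one_div_le_one_div_of_le (by positivity)
        nlinarith
      rw [abs_mul, abs_div, abs_mul, abs_of_pos (show (0:ℝ) < (j:ℝ)+1 by positivity),
        abs_of_pos (show 0 < ((j:ℝ)+2+x)*(j+2+y) by have := hx.1; have := hy.1; positivity)]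
      calc _ ≤ |x-y| * (j+1) / ((j+2)*(j+2)) * (L * (1/((j+1)*(j+2)))) := by
            have := hx.1; have := hy.1
            have k1 : (j:ℝ)+2 ≤ j+2+x := by linarith
            have k2 : (j:ℝ)+2 ≤ j+2+y := by linarith
            refine mul_le_mul (div_le_div_of_nonneg_left (by positivity) (by positivity) (mul_le_mul k1 k2 (by positivity) (by positivity))) d1 (abs_nonneg _) (by positivity)
        _ = (L * |x-y|) * (1/((j+2)*(j+2)*(j+2))) := by field_simp
        _ ≤ _ := by
          gcongr
          rw [show 1/2 * (1/(((j:ℝ)+1)*(j+2)) - 1/(((j:ℝ)+2)*(j+3))) = 1/((j+1)*(j+2)*(j+3)) by field_simp; ring]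
          apply one_div_le_one_div_of_le (by positivity)
          nlinarith
    refine (Finset.sum_le_sum key).trans ?_
    rw [← Finset.mul_sum, ← Finset.mul_sum]
    have tel : ∑ j ∈ Finset.range n, (1/(((j:ℝ)+1)*(j+2)) - 1/(((j:ℝ)+2)*(j+3))) = 1/2 - 1/(((n:ℝ)+1)*(n+2)) := by
      induction n with
      | zero => norm_num
      | succ n ih =>
        rw [Finset.sum_range_succ, ih (fun j hj => key j (by simp at hj ⊢; omega))]
        push_cast; field_simp; ring
    rw [tel]
    have : 0 ≤ 1/(((n:ℝ)+1)*(n+2)) := by positivity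
    have hLx : 0 ≤ L * |x-y| := by positivity
    nlinarith
  · have hn : (0:ℝ) ≤ n := by positivity
    have := hx.1; have := hy.1
    rw [abs_mul, abs_div, abs_mul, abs_of_pos (show (0:ℝ) < (n:ℝ)+1 by positivity),
        abs_of_pos (show 0 < ((n:ℝ)+2+x)*(n+2+y) by positivity)]
    calc _ ≤ |x-y| * (n+1) / ((n+1)*(n+1)) * M := by
          refine mul_le_mul (div_le_div_of_nonneg_left (by positivity) (by positivity) (mul_le_mul (by linarith) (by linarith) (by positivity) (by positivity))) (hb _ (nx_mem hy.1 _)) (abs_nonneg _) (by positivity)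
      _ = _ := by field_simp

lemma part1 {F : ℝ → ℝ} {L : ℝ} (hL : 0 ≤ L) (hF : Lip L F) {x y : ℝ} (hx : x ∈ Icc (0:ℝ) 1) (hy : y ∈ Icc (0:ℝ) 1) :
    |∑' j, wt x j * (F (nx x j) - F (nx y j))| ≤ 2/3 * L * |x-y| := by
  have hx1 := hx.1; have hy1 := hy.1; have hx2 := hx.2
  have hs : HasSum (fun j : ℕ => 1/(((j:ℝ)+1)*(j+2))) 1 := by
    have := wt_hasSum (y := 0) le_rfl
    refine this.congr_fun ?_ 
    intro j; simp [wt]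
  have hs1 : HasSum (fun j : ℕ => (L*|x-y|) * ((if j = 0 then (1/3:ℝ) else 0) + (1/3) * (1/(((j:ℝ)+1)*(j+2))))) ((L*|x-y|) * (1/3 + 1/3 * 1)) :=
    ((hasSum_ite_eq 0 (1/3:ℝ)).add (hs.mul_left (1/3))).mul_left _
  have : (L*|x-y|) * (1/3 + 1/3 * 1) ≤ 2/3 * L * |x-y| := by nlinarith [mul_nonneg hL (abs_nonneg (x-y))]
  refine le_trans ?_ this
  rw [← Real.norm_eq_abs]
  refine tsum_of_norm_bounded hs1 fun j => ?_
  rw [Real.norm_eq_abs, abs_mul, abs_of_nonneg (wt_nonneg hx1 j)]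
  have h1 := hF _ (nx_mem hx1 j) _ (nx_mem hy1 j)
  rw [nx_diff hx1 hy1] at h1
  refine (mul_le_mul_of_nonneg_left h1 (wt_nonneg hx1 j)).trans ?_
  rw [show wt x j * (L * (|x - y| / ((j+1+x)*(j+1+y)))) = (L * |x-y|) * (wt x j / ((j+1+x)*(j+1+y))) by ring]
  refine mul_le_mul_of_nonneg_left ?_ (by positivity)
  rcases Nat.eq_zero_or_pos j with rfl | hj
  · simp only [wt]; norm_num
    have : (1+x)/((1+x)*(2+x))/((1+x)*(1+y)) ≤ 1/2 := by
      rw [div_div, div_le_div_iff₀ (by positivity) (by norm_num)]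
      nlinarith [mul_nonneg hx1 hy1, mul_nonneg hx1 hx1, mul_nonneg (mul_nonneg hx1 hx1) hy1, mul_nonneg (mul_nonneg hx1 hx1) hx1, mul_nonneg (mul_nonneg (mul_nonneg hx1 hx1) hx1) hy1]
    refine this.trans (by norm_num)
  · have hj1 : (1:ℝ) ≤ j := by exact_mod_cast hj
    rw [if_neg (by omega), zero_add]
    unfold wt
    rw [div_div, div_mul_div_comm, one_mul, div_le_div_iff₀ (by positivity) (by positivity)]
    set a : ℝ := (j:ℝ)+1 with ha
    rw [show (j:ℝ)+2 = a+1 by rw [ha]; ring]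
    have ha2 : 2 ≤ a := by linarith
    have e1 : (1+x)*(a+1) ≤ 2*(a+x) := by nlinarith
    have e2 : 6 ≤ (a+1+x)*(a+y) := by nlinarith
    have e3 : a ≤ a + x := by linarith
    nlinarith [mul_le_mul (mul_le_mul e1 e2 (by norm_num) (by positivity)) e3 (by positivity) (by positivity)]

lemma contraction {F : ℝ → ℝ} {L : ℝ} (hL : 0 ≤ L) (hF : Lip L F) : Lip (11/12*L) (Pop F) := by
  intro x hx y hy
  have hb := lip_bdd hL hF
  have s1 := Pop_summable hb hx
  have s2 := Pop_summable hb hy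
  have s3 : Summable (fun j => wt x j * F (nx y j)) := by
    have := wt_summable (E := ℝ) hx (g := fun j => F (nx y j)) (M := |F 0| + L) (fun j => by
      have h1 := hb _ (nx_mem hy.1 j)
      have := one_le_rt j
      rw [Real.norm_eq_abs]
      nlinarith [abs_nonneg (F (nx y j))])
    simpa using this
  have e : Pop F x - Pop F y = ∑' j, wt x j * (F (nx x j) - F (nx y j)) + ∑' j, (wt x j - wt y j) * F (nx y j) := by
    simp only [Pop, mul_sub, sub_mul]
    rw [s1.tsum_sub s3, s3.tsum_sub s2]; ring
  rw [e]
  refine (abs_add_le _ _).trans ((add_le_add (part1 hL hF hx hy) (part2 hL hF hx hy)).trans (le_of_eq ?_))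
  ring

end GK

namespace GK

lemma Pop_const {y : ℝ} (hy : y ∈ Icc (0:ℝ) 1) (c : ℝ) : Pop (fun _ => c) y = c := by
  simp only [Pop]; rw [tsum_mul_right, (wt_hasSum hy.1).tsum_eq, one_mul]

lemma Pop_sub_const {F : ℝ → ℝ} {M : ℝ} (hF : ∀ y ∈ Icc (0:ℝ) 1, |F y| ≤ M) {y : ℝ} (hy : y ∈ Icc (0:ℝ) 1) (c : ℝ) :
    ∑' j, wt y j * (F (nx y j) - c) = Pop F y - c := by
  simp only [mul_sub]
  rw [(Pop_summable hF hy).tsum_sub ((wt_hasSum hy.1).summable.mul_right c), tsum_mul_right,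
    (wt_hasSum hy.1).tsum_eq, one_mul, Pop]

lemma Pop_dist {F : ℝ → ℝ} {L : ℝ} (hL : 0 ≤ L) (hF : Lip L F) {y z : ℝ} (hy : y ∈ Icc (0:ℝ) 1) (hz : z ∈ Icc (0:ℝ) 1) :
    |Pop F y - F z| ≤ L := by
  rw [← Pop_sub_const (lip_bdd hL hF) hy, ← Real.norm_eq_abs]
  have := (wt_hasSum hy.1).mul_right L
  rw [one_mul] at this
  refine tsum_of_norm_bounded this fun j => ?_
  rw [Real.norm_eq_abs, abs_mul, abs_of_nonneg (wt_nonneg hy.1 j)]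
  gcongr
  · exact wt_nonneg hy.1 j
  · have hm := nx_mem hy.1 j
    refine (hF _ hm _ hz).trans ?_
    have : |nx y j - z| ≤ 1 := by rw [abs_le]; constructor <;> linarith [hm.1, hm.2, hz.1, hz.2]
    nlinarith

lemma poisson {v : ℝ → ℝ} {L : ℝ} (hL : 0 ≤ L) (hv : Lip L v) :
    ∃ (c : ℝ) (u : ℝ → ℝ) (L' : ℝ), 0 ≤ L' ∧ Lip L' u ∧ ∀ y ∈ Icc (0:ℝ) 1, u y - Pop u y = v y - c := by
  set θ : ℝ := 11/12 with hθ
  set V : ℕ → ℝ → ℝ := fun n => Pop^[n] v with hV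
  have hVs : ∀ n, V (n+1) = Pop (V n) := fun n => Function.iterate_succ_apply' Pop n v
  have hlip : ∀ n, Lip (L*θ^n) (V n) := by
    intro n
    induction n with
    | zero => simpa [hV] using hv
    | succ n ih =>
      rw [hVs]
      have := contraction (by positivity) ih
      intro x hx y hy
      refine (this x hx y hy).trans (le_of_eq ?_)
      rw [pow_succ, hθ]; ring
  have h0 : (0:ℝ) ∈ Icc (0:ℝ) 1 := by simp
  have hstep : ∀ n, dist (V n 0) (V (n+1) 0) ≤ L * θ^n := by
    intro n
    rw [dist_comm, Real.dist_eq, hVs]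
    exact Pop_dist (by positivity) (hlip n) h0 h0
  have hcau := cauchySeq_of_le_geometric θ L (by norm_num) hstep
  obtain ⟨c, hc⟩ := cauchySeq_tendsto_of_complete hcau
  have hdc : ∀ n, |V n 0 - c| ≤ 12 * L * θ^n := by
    intro n
    have := dist_le_of_le_geometric_of_tendsto θ L (by norm_num) hstep hc n
    rw [Real.dist_eq] at this
    refine this.trans (le_of_eq ?_)
    rw [hθ]; ring
  have hb : ∀ n, ∀ y ∈ Icc (0:ℝ) 1, |V n y - c| ≤ 13 * L * θ^n := by
    intro n y hy
    have h1 := hlip n y hy 0 h0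
    have h2 := hdc n
    have h3 : L*θ^n*|y-0| ≤ L*θ^n*1 := by
      gcongr; rw [sub_zero, abs_of_nonneg hy.1]; exact hy.2
    have := abs_sub_le (V n y) (V n 0) c
    linarith
  have hgeo : Summable (fun n : ℕ => θ^n) := summable_geometric_of_lt_one (by norm_num) (by norm_num)
  have hsum : ∀ y ∈ Icc (0:ℝ) 1, Summable (fun n => V n y - c) := fun y hy =>
    Summable.of_norm_bounded (hgeo.mul_left (13*L)) fun n => hb n y hy
  have htg : ∑' n : ℕ, θ^n = 12 := by
    rw [tsum_geometric_of_lt_one (by norm_num) (by norm_num)]; norm_num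
  refine ⟨c, fun y => ∑' n, (V n y - c), 12*L, by positivity, ?_, ?_⟩
  · intro x hx y hy
    simp only
    rw [← (hsum x hx).tsum_sub (hsum y hy), ← Real.norm_eq_abs]
    have : HasSum (fun n : ℕ => (L*|x-y|) * θ^n) ((L*|x-y|)*12) := by
      rw [← htg]; exact hgeo.hasSum.mul_left _
    refine (tsum_of_norm_bounded this fun n => ?_).trans (le_of_eq (by ring))
    rw [Real.norm_eq_abs]
    have := hlip n x hx y hy
    calc _ = |V n x - V n y| := by congr 1; ring
      _ ≤ _ := this
      _ = _ := by ring
  · intro y hy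
    have hprod : Summable (Function.uncurry fun (j n : ℕ) => wt y j * (V n (nx y j) - c)) := by
      have s : Summable (fun p : ℕ × ℕ => wt y p.1 * (13*L*θ^p.2)) :=
        (wt_hasSum hy.1).summable.mul_of_nonneg (hgeo.mul_left (13*L)) (fun j => wt_nonneg hy.1 j) (fun n => by positivity)
      refine Summable.of_norm_bounded s fun p => ?_
      obtain ⟨j, n⟩ := p
      simp only [Function.uncurry]
      rw [Real.norm_eq_abs, abs_mul, abs_of_nonneg (wt_nonneg hy.1 j)]
      exact mul_le_mul_of_nonneg_left (hb n _ (nx_mem hy.1 j)) (wt_nonneg hy.1 j)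
    have e : Pop (fun y => ∑' n, (V n y - c)) y = ∑' n, (V (n+1) y - c) := by
      simp only [Pop]
      calc _ = ∑' j, ∑' n, wt y j * (V n (nx y j) - c) := by
            refine tsum_congr fun j => (tsum_mul_left).symm
        _ = ∑' n, ∑' j, wt y j * (V n (nx y j) - c) := hprod.tsum_comm.symm
        _ = _ := by
            refine tsum_congr fun n => ?_
            rw [hVs, Pop_sub_const (lip_bdd (by positivity) (hlip n)) hy]
    rw [e]
    simp only
    rw [(hsum y hy).tsum_eq_zero_add]
    simp [hV]

lemma log_add_le {y : ℝ} (hy : y ∈ Icc (0:ℝ) 1) (j : ℕ) :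
    0 ≤ Real.log (j+1+y) ∧ Real.log (j+1+y) ≤ Real.log (j+1) + 1 := by
  have hj : (0:ℝ) ≤ j := by positivity
  have h1 := hy.1; have h2 := hy.2
  refine ⟨Real.log_nonneg (by linarith), ?_⟩
  have e : Real.log ((j:ℝ)+1) + 1 = Real.log (((j:ℝ)+1) * Real.exp 1) := by
    rw [Real.log_mul (by positivity) (Real.exp_pos 1).ne', Real.log_exp]
  rw [e]
  apply Real.log_le_log (by positivity)
  have := Real.add_one_le_exp 1
  nlinarith

lemma log_lip {x y : ℝ} (hx : x ∈ Icc (0:ℝ) 1) (hy : y ∈ Icc (0:ℝ) 1) (j : ℕ) :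
    |Real.log (j+1+x) - Real.log (j+1+y)| ≤ |x - y| := by
  have key : ∀ x ∈ Icc (0:ℝ) 1, ∀ y ∈ Icc (0:ℝ) 1, Real.log (j+1+x) - Real.log (j+1+y) ≤ |x - y| := by
    intro x hx y hy
    have h1 := hx.1; have h2 := hy.1
    have hj : (0:ℝ) ≤ j := by positivity
    rw [← Real.log_div (by positivity) (by positivity)]
    refine (Real.log_le_sub_one_of_pos (by positivity)).trans ?_
    rw [div_sub_one (by positivity), div_le_iff₀ (by positivity)]
    have := le_abs_self (x-y)
    nlinarith [abs_nonneg (x-y)]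
  rw [abs_le]
  have a := key x hx y hy
  have b := key y hy x hx
  rw [abs_sub_comm] at b
  constructor <;> linarith

/-- growth: `X = log(j+1)+b`. -/
lemma X_growth {b : ℝ} (hb : 0 ≤ b) (j : ℕ) :
    (Real.log (j+1) + b)^3 * Real.exp ((Real.log (j+1) + b)/4) ≤ 384 * Real.exp (b/2) * Real.sqrt ((j:ℝ)+1) := by
  have hj0 : (0:ℝ) ≤ j := by positivity
  have hl : 0 ≤ Real.log ((j:ℝ)+1) := Real.log_nonneg (by linarith)
  set X := Real.log ((j:ℝ)+1) + b with hX
  have h1 : X^3 ≤ 384 * Real.exp (X/4) := by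
    have := Real.pow_div_factorial_le_exp (X/4) (by positivity) 3
    simp [Nat.factorial] at this
    have e : (X/4)^3/6 = X^3/384 := by ring
    rw [e] at this; linarith
  calc _ ≤ 384 * Real.exp (X/4) * Real.exp (X/4) := by gcongr
    _ = 384 * Real.exp (b/2) * Real.exp (Real.log ((j:ℝ)+1)/2) := by
      rw [mul_assoc, mul_assoc, ← Real.exp_add, ← Real.exp_add]; congr 2; rw [hX]; ring
    _ = _ := by
      rw [Real.sqrt_eq_rpow, Real.rpow_def_of_pos (by positivity)]; congr 2; ring

lemma X_sq {b : ℝ} (hb : 1 ≤ b) (j : ℕ) :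
    1 ≤ Real.log (j+1) + b ∧ 
    (Real.log (j+1) + b)^2 ≤ 384 * Real.exp (b/2) * Real.sqrt ((j:ℝ)+1) ∧
    (Real.log (j+1) + b) ≤ 384 * Real.exp (b/2) * Real.sqrt ((j:ℝ)+1) ∧
    (Real.log (j+1) + b)^3 ≤ 384 * Real.exp (b/2) * Real.sqrt ((j:ℝ)+1) := by
  have hj0 : (0:ℝ) ≤ j := by positivity
  have hl : 0 ≤ Real.log ((j:ℝ)+1) := Real.log_nonneg (by linarith)
  have h := X_growth (by linarith : 0 ≤ b) j
  set X := Real.log ((j:ℝ)+1) + b with hX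
  have hX1 : 1 ≤ X := by linarith
  have h3 : X^3 ≤ 384 * Real.exp (b/2) * Real.sqrt ((j:ℝ)+1) := by
    refine le_trans ?_ h
    have : 1 ≤ Real.exp (X/4) := Real.one_le_exp (by linarith)
    have : 0 ≤ X^3 := by positivity
    nlinarith
  refine ⟨hX1, le_trans ?_ h3, le_trans ?_ h3, h3⟩
  · exact pow_le_pow_right₀ hX1 (by norm_num)
  · calc X = X^1 := (pow_one X).symm
      _ ≤ X^3 := pow_le_pow_right₀ hX1 (by norm_num)

/-- the bundle of data -/
structure OpData (c σ b : ℝ) (h w : ℝ → ℝ) : Prop where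
  σ_pos : 0 < σ
  b_ge : 1 ≤ b
  h_lip : ∃ L, 0 ≤ L ∧ Lip L h
  h_bd : ∀ y ∈ Icc (0:ℝ) 1, |h y| ≤ b
  w_bd : ∀ y ∈ Icc (0:ℝ) 1, |w y| ≤ b
  A_bd : ∀ y ∈ Icc (0:ℝ) 1, ∀ j : ℕ, |Real.log (j+1+y) - c + h (nx y j) - h y| ≤ Real.log (j+1) + b
  eq1 : ∀ y ∈ Icc (0:ℝ) 1, ∑' j : ℕ, wt y j * (Real.log (j+1+y) - c + h (nx y j) - h y) = 0
  eq2 : ∀ y ∈ Icc (0:ℝ) 1, ∑' j : ℕ, wt y j * ((Real.log (j+1+y) - c + h (nx y j) - h y)^2 + (w (nx y j) - w y)) = σ^2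

theorem opData_exists : ∃ (c σ b : ℝ) (h w : ℝ → ℝ), OpData c σ b h w := by
  -- first Poisson equation
  have hg : ∃ L, 0 ≤ L ∧ Lip L (fun y => ∑' j : ℕ, wt y j * Real.log (j+1+y)) := by
    refine crude_lip (G := fun j y => Real.log (j+1+y)) (M := 384 * Real.exp (1/2)) (by positivity) ?_ ?_
    · intro j y hy
      obtain ⟨a1, a2⟩ := log_add_le hy j
      rw [abs_of_nonneg a1]
      exact a2.trans (X_sq le_rfl j).2.2.1
    · intro j x hx y hy
      refine (log_lip hx hy j).trans ?_
      have h1 := (X_sq (b := 1) le_rfl j).1.trans (X_sq le_rfl j).2.2.1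
      nlinarith [abs_nonneg (x-y)]
  obtain ⟨L0, hL0, hlip0⟩ := hg
  obtain ⟨c, h, L1, hL1, hlip1, hpo1⟩ := poisson hL0 hlip0
  set b1 : ℝ := |h 0| + L1 with hb1
  have hh : ∀ y ∈ Icc (0:ℝ) 1, |h y| ≤ b1 := lip_bdd hL1 hlip1
  set A : ℕ → ℝ → ℝ := fun j y => Real.log (j+1+y) - c + h (nx y j) - h y with hA
  set b2 : ℝ := 1 + |c| + 2 * b1 with hb2
  have hb1n : 0 ≤ b1 := by positivity
  have hb2n : 1 ≤ b2 := by have := abs_nonneg c; linarith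
  have hAb : ∀ y ∈ Icc (0:ℝ) 1, ∀ j, |A j y| ≤ Real.log (j+1) + b2 := by
    intro y hy j
    obtain ⟨a1, a2⟩ := log_add_le hy j
    have h1 := abs_le.1 (hh _ (nx_mem hy.1 j))
    have h2 := abs_le.1 (hh y hy)
    have h3 := abs_le.1 (le_refl |c|)
    rw [abs_le]; simp only [hA]
    constructor <;> linarith
  have hAsum : ∀ y ∈ Icc (0:ℝ) 1, Summable (fun j => wt y j * A j y) := by
    intro y hy
    have := wt_summable (E := ℝ) hy (g := fun j => A j y) (M := 384 * Real.exp (b2/2))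
      (fun j => (hAb y hy j).trans (X_sq hb2n j).2.2.1)
    simpa using this
  have heq1 : ∀ y ∈ Icc (0:ℝ) 1, ∑' j, wt y j * A j y = 0 := by
    intro y hy
    have s0 : Summable (fun j : ℕ => wt y j * Real.log (j+1+y)) := by
      have := wt_summable (E := ℝ) hy (g := fun j : ℕ => Real.log (j+1+y)) (M := 384 * Real.exp (1/2)) (fun j => by
        obtain ⟨a1, a2⟩ := log_add_le hy j
        rw [Real.norm_of_nonneg a1]
        exact a2.trans (X_sq le_rfl j).2.2.1)
      simpa using this
    have s1 := Pop_summable hh hy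
    have s2 := (wt_hasSum hy.1).summable.mul_right (c + h y)
    have e : (fun j => wt y j * A j y) = fun j : ℕ => (wt y j * Real.log (j+1+y) + wt y j * h (nx y j)) - wt y j * (c + h y) := by
      funext j; simp only [hA]; ring
    rw [e, (s0.add s1).tsum_sub s2, s0.tsum_add s1, tsum_mul_right, (wt_hasSum hy.1).tsum_eq]
    have := hpo1 y hy
    simp only [Pop] at this
    linarith
  have hAlip : ∀ j, ∀ x ∈ Icc (0:ℝ) 1, ∀ y ∈ Icc (0:ℝ) 1, |A j x - A j y| ≤ (1 + 2*L1) * |x-y| := by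
    intro j x hx y hy
    have e : A j x - A j y = (Real.log (j+1+x) - Real.log (j+1+y)) + (h (nx x j) - h (nx y j)) + (h y - h x) := by
      simp only [hA]; ring
    rw [e]
    refine (abs_add_three _ _ _).trans ?_
    have k1 := log_lip hx hy j
    have k2 := hlip1 _ (nx_mem hx.1 j) _ (nx_mem hy.1 j)
    have k3 := hlip1 y hy x hx
    have k4 := mul_le_mul_of_nonneg_left (nx_lip hx.1 hy.1 j) hL1
    rw [abs_sub_comm y x] at k3
    linarith
  -- second Poisson equation
  have hg2 : ∃ L, 0 ≤ L ∧ Lip L (fun y => ∑' j : ℕ, wt y j * (A j y)^2) := by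
    set K := 384 * Real.exp (b2/2) with hK
    refine crude_lip (G := fun j y => (A j y)^2) (M := (1 + 2*(1+2*L1))*K) (by positivity) ?_ ?_
    · intro j y hy
      obtain ⟨x1, x2, x3, x4⟩ := X_sq hb2n j
      rw [abs_of_nonneg (sq_nonneg _), ← sq_abs]
      have : |A j y|^2 ≤ (Real.log (j+1)+b2)^2 := by gcongr; exact hAb y hy j
      have : 0 ≤ 2*(1+2*L1)*(K * Real.sqrt ((j:ℝ)+1)) := by positivity
      linarith
    · intro j x hx y hy
      obtain ⟨x1, x2, x3, x4⟩ := X_sq hb2n j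
      have e : A j x^2 - A j y^2 = (A j x + A j y) * (A j x - A j y) := by ring
      simp only [e, abs_mul]
      have k1 : |A j x + A j y| ≤ 2 * (K * Real.sqrt ((j:ℝ)+1)) := by
        refine (abs_add_le _ _).trans ?_
        linarith [hAb x hx j, hAb y hy j]
      have k2 := hAlip j x hx y hy
      calc _ ≤ (2 * (K * Real.sqrt ((j:ℝ)+1))) * ((1 + 2*L1) * |x-y|) := by gcongr
        _ ≤ _ := by
          have : 0 ≤ K * Real.sqrt ((j:ℝ)+1) * |x-y| := by positivity
          linarith
  obtain ⟨L2, hL2, hlip2⟩ := hg2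
  obtain ⟨s, w, L3, hL3, hlip3, hpo2⟩ := poisson hL2 hlip2
  set b3 : ℝ := |w 0| + L3 with hb3
  have hw : ∀ y ∈ Icc (0:ℝ) 1, |w y| ≤ b3 := lip_bdd hL3 hlip3
  have hA2sum : ∀ y ∈ Icc (0:ℝ) 1, Summable (fun j => wt y j * (A j y)^2) := by
    intro y hy
    have := wt_summable (E := ℝ) hy (g := fun j => (A j y)^2) (M := 384 * Real.exp (b2/2))
      (fun j => by
        rw [Real.norm_of_nonneg (sq_nonneg _), ← sq_abs]
        have : |A j y|^2 ≤ (Real.log (j+1)+b2)^2 := by gcongr; exact hAb y hy j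
        exact this.trans (X_sq hb2n j).2.1)
    simpa using this
  have hs : 0 < s := by
    have hcont : ContinuousOn w (Icc 0 1) := by
      have : LipschitzOnWith ⟨L3, hL3⟩ w (Icc 0 1) := LipschitzOnWith.of_dist_le_mul fun x hx y hy => by
        rw [Real.dist_eq, Real.dist_eq]; exact hlip3 x hx y hy
      exact this.continuousOn
    obtain ⟨y0, hy0, hmin⟩ := isCompact_Icc.exists_isMinOn (nonempty_Icc.2 zero_le_one) hcont
    have k1 : w y0 ≤ Pop w y0 := by
      have e := Pop_sub_const hw hy0 (w y0)
      have : 0 ≤ ∑' j, wt y0 j * (w (nx y0 j) - w y0) := tsum_nonneg fun j =>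
        mul_nonneg (wt_nonneg hy0.1 j) (sub_nonneg.2 (hmin (nx_mem hy0.1 j)))
      linarith
    have k2 := hpo2 y0 hy0
    have k3 : 0 < ∑' j, wt y0 j * (A j y0)^2 := by
      obtain ⟨J, hJ⟩ := exists_nat_gt (Real.exp b2)
      have hJ1 : b2 < Real.log (J+1+y0) := by
        rw [Real.lt_log_iff_exp_lt (by have := hy0.1; positivity)]; linarith [hy0.1]
      have hAJ : 0 < A J y0 := by
        have h1 := abs_le.1 (hh _ (nx_mem hy0.1 J))
        have h2 := abs_le.1 (hh y0 hy0)
        have h3 := le_abs_self c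
        simp only [hA]; linarith
      exact (hA2sum y0 hy0).tsum_pos (fun j => mul_nonneg (wt_nonneg hy0.1 j) (sq_nonneg _)) J
        (mul_pos (wt_pos hy0.1 J) (by positivity))
    linarith
  have hb3n : 0 ≤ b3 := by positivity
  refine ⟨c, Real.sqrt s, b2 + b3, h, w, ⟨Real.sqrt_pos.2 hs, by linarith, ⟨L1, hL1, hlip1⟩, ?_, ?_, ?_, heq1, ?_⟩⟩
  · intro y hy; have := hh y hy; have := abs_nonneg c; linarith
  · intro y hy; have := hw y hy; linarith
  · intro y hy j; have := hAb y hy j; simp only [hA] at this; linarith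
  · intro y hy
    rw [Real.sq_sqrt hs.le]
    have e : (fun j : ℕ => wt y j * ((Real.log (j+1+y) - c + h (nx y j) - h y)^2 + (w (nx y j) - w y))) =
      fun j : ℕ => (wt y j * (A j y)^2 + wt y j * w (nx y j)) - wt y j * w y := by
      funext j; simp only [hA]; ring
    have s1 := Pop_summable hw hy
    rw [e, ((hA2sum y hy).add s1).tsum_sub ((wt_hasSum hy.1).summable.mul_right _), (hA2sum y hy).tsum_add s1, tsum_mul_right, (wt_hasSum hy.1).tsum_eq]
    have := hpo2 y hy
    simp only [Pop] at this
    linarith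

end GK

namespace GK

/-- the exponent -/
noncomputable def ZZ (c : ℝ) (h w : ℝ → ℝ) (t : ℂ) (y : ℝ) (j : ℕ) : ℂ :=
  t * ((Real.log (j+1+y) - c + h (nx y j) - h y : ℝ) : ℂ) + t^2/2 * ((w (nx y j) - w y : ℝ) : ℂ)

lemma ZZ_norm {c σ b : ℝ} {h w : ℝ → ℝ} (H : OpData c σ b h w) {t : ℂ} (ht : ‖t‖ ≤ 1/4) {y : ℝ}
    (hy : y ∈ Icc (0:ℝ) 1) (j : ℕ) : ‖ZZ c h w t y j‖ ≤ ‖t‖ * (Real.log (j+1) + 2*b) := by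
  unfold ZZ
  refine (norm_add_le _ _).trans ?_
  rw [norm_mul, norm_mul, Complex.norm_real, Complex.norm_real, norm_div, norm_pow, Complex.norm_ofNat,
    Real.norm_eq_abs, Real.norm_eq_abs]
  have h1 := H.A_bd y hy j
  have h2 : |w (nx y j) - w y| ≤ 2*b := by
    refine (abs_sub _ _).trans ?_
    linarith [H.w_bd y hy, H.w_bd _ (nx_mem hy.1 j)]
  have ht0 := norm_nonneg t
  have hb := H.b_ge
  have h3 : ‖t‖^2/2 * |w (nx y j) - w y| ≤ ‖t‖ * b := by
    calc _ ≤ ‖t‖^2/2 * (2*b) := by gcongr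
      _ = ‖t‖ * b * ‖t‖ := by ring
      _ ≤ ‖t‖ * b * 1 := by gcongr; linarith
      _ = _ := by ring
  have h4 := mul_le_mul_of_nonneg_left h1 ht0
  linarith

theorem OpData.expansion {c σ b : ℝ} {h w : ℝ → ℝ} (H : OpData c σ b h w) :
    ∃ C, 0 ≤ C ∧ ∀ t : ℂ, ‖t‖ ≤ 1/4 → ∀ y ∈ Icc (0:ℝ) 1,
      ‖∑' j, (wt y j : ℂ) * Complex.exp (ZZ c h w t y j) - (1 + t^2*σ^2/2)‖ ≤ C * ‖t‖^3 := by
  set Sg := ∑' j : ℕ, Real.sqrt ((j:ℝ)+1) / ((j:ℝ)+1)^2 with hSg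
  have hSg0 : 0 ≤ Sg := tsum_nonneg fun j => by positivity
  set K := 384 * Real.exp (2*b/2) with hK
  have hK0 : 0 < K := by positivity
  refine ⟨2 * (2*K) * Sg, by positivity, fun t ht y hy => ?_⟩
  have hb := H.b_ge
  have hA := H.A_bd y hy
  have e1 := H.eq1 y hy
  have e2 := H.eq2 y hy
  have hD : ∀ j, |w (nx y j) - w y| ≤ 2*b := fun j => by
    refine (abs_sub _ _).trans ?_
    linarith [H.w_bd y hy, H.w_bd _ (nx_mem hy.1 j)]
  have hZ := ZZ_norm H ht hy
  have ht0 := norm_nonneg t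
  unfold ZZ at *
  set A : ℕ → ℝ := fun j => Real.log (j+1+y) - c + h (nx y j) - h y with hAdef
  set D : ℕ → ℝ := fun j => w (nx y j) - w y with hDdef
  have X1 : ∀ j : ℕ, 1 ≤ Real.log (j+1) + 2*b ∧ (Real.log (j+1) + 2*b)^2 ≤ K * Real.sqrt ((j:ℝ)+1) ∧ 
     Real.log (j+1) + 2*b ≤ K * Real.sqrt ((j:ℝ)+1) := fun j => by
    have := X_sq (b := 2*b) (by linarith) j
    exact ⟨this.1, this.2.1, this.2.2.1⟩
  have hl : ∀ j : ℕ, 0 ≤ Real.log ((j:ℝ)+1) := fun j => Real.log_nonneg (by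
    have : (0:ℝ) ≤ j := by positivity
    linarith)
  have hA' : ∀ j, |A j| ≤ Real.log (j+1) + 2*b := fun j => (hA j).trans (by linarith)
  have hD' : ∀ j, |D j| ≤ Real.log (j+1) + 2*b := fun j => (hD j).trans (by linarith [hl j])
  set R : ℕ → ℂ := fun j => Complex.exp (t * (A j : ℂ) + t^2/2 * (D j:ℂ)) - (1 + t * (A j:ℂ) + t^2/2 * ((A j)^2 + D j : ℝ)) with hR
  have hRb : ∀ j, ‖R j‖ ≤ (2 * K * ‖t‖^3) * Real.sqrt ((j:ℝ)+1) := by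
    intro j
    set Z : ℂ := t * (A j : ℂ) + t^2/2 * (D j:ℂ) with hZd
    set X := Real.log ((j:ℝ)+1) + 2*b with hX
    obtain ⟨x1, x2, x3⟩ := X1 j
    have hb0 : 0 ≤ 2*b := by linarith
    have hgr := X_growth hb0 j
    have hZj : ‖Z‖ ≤ ‖t‖ * X := hZ j
    have r1 : ‖Complex.exp Z - (1 + Z + Z^2/2)‖ ≤ ‖t‖^3 * (K * Real.sqrt ((j:ℝ)+1)) := by
      have := Complex.norm_exp_sub_sum_le_norm_mul_exp Z 3
      simp only [Finset.sum_range_succ, Finset.sum_range_zero, zero_add, pow_zero, pow_one, Nat.factorial] at this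
      have e : (1:ℂ) / ((1:ℕ):ℂ) + Z / ((((0+1) * 1 : ℕ)):ℂ) + Z^2/(((1+1)*((0+1)*1) : ℕ) : ℂ) = 1 + Z + Z^2/2 := by
        push_cast; ring
      rw [show Complex.exp Z - (1 + Z + Z^2/2) = Complex.exp Z - ((1:ℂ) / ((1:ℕ):ℂ) + Z / ((((0+1) * 1 : ℕ)):ℂ) + Z^2/(((1+1)*((0+1)*1) : ℕ) : ℂ)) by rw [e]]
      refine this.trans ?_
      calc ‖Z‖^3 * Real.exp ‖Z‖ ≤ (‖t‖ * X)^3 * Real.exp (X/4) := by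
            gcongr
            refine hZj.trans ?_
            nlinarith
        _ = ‖t‖^3 * (X^3 * Real.exp (X/4)) := by ring
        _ ≤ _ := mul_le_mul_of_nonneg_left hgr (by positivity)
    have r2 : ‖t^3 * (A j:ℂ) * (D j:ℂ)/2 + t^4 * (D j:ℂ)^2/8‖ ≤ ‖t‖^3 * (K * Real.sqrt ((j:ℝ)+1)) := by
      refine (norm_add_le _ _).trans ?_
      simp only [norm_div, norm_mul, norm_pow, Complex.norm_real, Complex.norm_ofNat, Real.norm_eq_abs]
      have t4 : ‖t‖^4 ≤ ‖t‖^3 := by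
        rw [pow_succ]; nlinarith [pow_nonneg ht0 3]
      have a1 : |A j| * |D j| ≤ X^2 := by
        rw [sq]; exact mul_le_mul (hA' j) (hD' j) (abs_nonneg _) (by linarith)
      have a2 : |D j|^2 ≤ X^2 := by gcongr; exact hD' j
      calc _ = ‖t‖^3 * (|A j| * |D j|)/2 + ‖t‖^4 * |D j|^2/8 := by ring
        _ ≤ ‖t‖^3 * X^2/2 + ‖t‖^3 * X^2/8 := by gcongr
        _ ≤ ‖t‖^3 * X^2 := by
          have : 0 ≤ ‖t‖^3 * X^2 := by positivity
          linarith
        _ ≤ _ := by gcongr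
    have e : R j = (Complex.exp Z - (1 + Z + Z^2/2)) + (t^3 * (A j:ℂ) * (D j:ℂ)/2 + t^4 * (D j:ℂ)^2/8) := by
      simp only [hR]; rw [← hZd]; rw [hZd]; push_cast; ring
    rw [e]
    refine (norm_add_le _ _).trans ?_
    linarith
  have sR := wt_summable hy hRb
  have bR := wt_tsum_le hy hRb
  have sA : HasSum (fun j => wt y j * A j) 0 := by
    rw [← e1]; refine Summable.hasSum ?_
    have := wt_summable (E := ℝ) hy (g := A) (M := K) (fun j => (hA' j).trans (X1 j).2.2)
    simpa using this
  have sB : HasSum (fun j => wt y j * ((A j)^2 + D j)) (σ^2) := by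
    rw [← e2]; refine Summable.hasSum ?_
    have := wt_summable (E := ℝ) hy (g := fun j => (A j)^2 + D j) (M := 2*K) (fun j => by
      refine (norm_add_le _ _).trans ?_
      rw [norm_pow, Real.norm_eq_abs, Real.norm_eq_abs]
      have := (hD' j).trans (X1 j).2.2
      have : |A j|^2 ≤ (Real.log (j+1) + 2*b)^2 := by gcongr; exact hA' j
      linarith [(X1 j).2.1])
    simpa using this
  have sA' := (Complex.hasSum_ofReal.2 sA).mul_left t
  have sB' := (Complex.hasSum_ofReal.2 sB).mul_left (t^2/2)
  have s1' := Complex.hasSum_ofReal.2 (wt_hasSum hy.1)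
  have tot := ((s1'.add sA').add sB').add sR.hasSum
  have e : (fun j => (wt y j : ℂ) * Complex.exp (t * (A j : ℂ) + t^2/2 * (D j:ℂ))) = fun j => (wt y j:ℂ) + t * ((wt y j * A j : ℝ):ℂ) + t^2/2 * ((wt y j * ((A j)^2 + D j) : ℝ) : ℂ) + wt y j • R j := by
    funext j
    simp only [hR, Complex.real_smul]; push_cast; ring
  have := tot.tsum_eq
  change ‖∑' j, (fun j => (wt y j : ℂ) * Complex.exp (t * (A j : ℂ) + t^2/2 * (D j:ℂ))) j - _‖ ≤ _
  rw [e, this]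
  calc _ = ‖∑' j, wt y j • R j‖ := by congr 1; push_cast; ring
    _ ≤ _ := bR
    _ = _ := by ring

end GK

namespace GK

lemma alt_zeta : HasSum (fun n : ℕ => (-1:ℝ)^n * (1/((n:ℝ)+1)^2)) (Real.pi^2/12) := by
  have h0 : HasSum (fun n : ℕ => 1/((n:ℝ)+1)^2) (Real.pi^2/6) := by
    have := (hasSum_nat_add_iff' (f := fun n : ℕ => 1/(n:ℝ)^2) 1).2 hasSum_zeta_two
    simpa using this
  have ho : HasSum (fun k : ℕ => 1/(((2*k+1 : ℕ):ℝ)+1)^2) (Real.pi^2/24) := by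
    have := h0.mul_left (1/4)
    rw [show Real.pi^2/24 = 1/4 * (Real.pi^2/6) by ring]
    refine this.congr_fun ?_ |> id
    intro k; push_cast
    rw [show (2*(k:ℝ)+1+1) = 2*(k+1) by ring]
    field_simp; norm_num
  have he' : Summable (fun k : ℕ => 1/(((2*k : ℕ):ℝ)+1)^2) :=
    h0.summable.comp_injective (i := fun k : ℕ => 2*k) (fun a b h => by simpa using h)
  have he := he'.hasSum
  have hs := HasSum.even_add_odd (f := fun n : ℕ => 1/((n:ℝ)+1)^2) he ho
  have hE := hs.unique h0
  have := HasSum.even_add_odd (f := fun n : ℕ => (-1:ℝ)^n * (1/((n:ℝ)+1)^2)) (m := ∑' k : ℕ, 1/(((2*k : ℕ):ℝ)+1)^2) (m' := -(Real.pi^2/24)) (by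
      refine he.congr_fun ?_ |> id
      intro k; simp [pow_mul]) (by
      refine ho.neg.congr_fun ?_ |> id
      intro k; simp [pow_mul, pow_succ])
  convert this using 1
  linarith

lemma int_pow_log (n : ℕ) : ∫ u in (0:ℝ)..1, -(u^n * Real.log u) = 1/((n:ℝ)+1)^2 := by
  have := intervalIntegral.integral_eq_sub_of_hasDerivAt_of_le (a := 0) (b := 1)
    (f := fun u : ℝ => u^(n+1)/((n:ℝ)+1)^2 - u^n * (u * Real.log u)/((n:ℝ)+1)) (f' := fun u => -(u^n * Real.log u)) zero_le_one
    (by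
      have := Real.continuous_mul_log
      apply Continuous.continuousOn
      fun_prop)
    (by
      intro x hx
      have h1 := ((hasDerivAt_pow (n+1) x).div_const (((n:ℝ)+1)^2)).sub
        ((((hasDerivAt_pow (n+1) x).mul (Real.hasDerivAt_log hx.1.ne')).div_const ((n:ℝ)+1)))
      have e : (fun u : ℝ => u^(n+1)/((n:ℝ)+1)^2 - u^n * (u * Real.log u)/((n:ℝ)+1)) = (fun u : ℝ => u^(n+1)/((n:ℝ)+1)^2) - fun u : ℝ => ((fun u : ℝ => u^(n+1)) * Real.log) u/((n:ℝ)+1) := by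
        funext u; simp [pow_succ]; ring
      rw [e]
      convert h1 using 1
      have := hx.1.ne'
      simp only [Nat.add_sub_cancel]
      push_cast
      field_simp
      ring)
    (by
      have := (intervalIntegral.intervalIntegrable_log' (a := 0) (b := 1)).mul_continuousOn (g := fun u => -u^n) (by fun_prop)
      refine this.congr ?_
      refine fun x hx => ?_
      simp; ring)
  rw [this]; simp

lemma int_log_val : ∫ u in (0:ℝ)..1, -Real.log u * (1+u)⁻¹ = Real.pi^2/12 := by
  have hint : ∀ n : ℕ, IntervalIntegrable (fun u : ℝ => -(u^n * Real.log u)) volume 0 1 := by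
    intro n
    have := (intervalIntegral.intervalIntegrable_log' (a := 0) (b := 1)).mul_continuousOn (g := fun u => -u^n) (by fun_prop)
    refine this.congr ?_
    refine fun x hx => ?_
    simp; ring
  have h := hasSum_integral_of_summable_integral_norm (μ := volume.restrict (Ioc (0:ℝ) 1))
    (F := fun (n : ℕ) (u : ℝ) => (-1:ℝ)^n * -(u^n * Real.log u))
    (fun n => by
      have := (intervalIntegrable_iff_integrableOn_Ioc_of_le zero_le_one).1 (hint n)
      exact this.const_mul _)
    (by
      have : ∀ n : ℕ, ∫ u in Ioc (0:ℝ) 1, ‖(-1:ℝ)^n * -(u^n * Real.log u)‖ = 1/((n:ℝ)+1)^2 := by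
        intro n
        rw [← int_pow_log n, intervalIntegral.integral_of_le zero_le_one]
        refine setIntegral_congr_fun measurableSet_Ioc fun u hu => ?_
        have : Real.log u ≤ 0 := Real.log_nonpos hu.1.le hu.2
        have : 0 ≤ -(u^n * Real.log u) := by nlinarith [pow_nonneg hu.1.le n]
        simp only [norm_mul, norm_pow, norm_neg, norm_one, one_pow, one_mul]
        rw [← norm_pow, ← norm_mul, ← norm_neg, Real.norm_of_nonneg this]
      simp_rw [this]
      have := alt_zeta.summable.norm
      refine this.congr fun n => ?_
      simp)
  have e : ∀ n : ℕ, ∫ u in Ioc (0:ℝ) 1, (-1:ℝ)^n * -(u^n * Real.log u) = (-1:ℝ)^n * (1/((n:ℝ)+1)^2) := by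
    intro n
    rw [integral_const_mul, ← intervalIntegral.integral_of_le zero_le_one, int_pow_log]
  simp_rw [e] at h
  rw [alt_zeta.unique h, intervalIntegral.integral_of_le zero_le_one, integral_Ioc_eq_integral_Ioo, integral_Ioc_eq_integral_Ioo]
  refine setIntegral_congr_fun measurableSet_Ioo fun u hu => ?_
  have hg := (hasSum_geometric_of_abs_lt_one (r := -u) (by rw [abs_neg, abs_of_pos hu.1]; exact hu.2)).mul_left (-Real.log u)
  rw [sub_neg_eq_add] at hg
  rw [← hg.tsum_eq]
  refine tsum_congr fun n => ?_
  rw [neg_pow]; ring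

theorem OpData.c_eq {c σ b : ℝ} {h w : ℝ → ℝ} (H : OpData c σ b h w) : c = Real.pi^2/(12 * Real.log 2) := by
  obtain ⟨L, hL, hlip⟩ := H.h_lip
  have hcont : ContinuousOn h (Icc 0 1) := by
    have : LipschitzOnWith ⟨L, hL⟩ h (Icc 0 1) := LipschitzOnWith.of_dist_le_mul fun x hx y hy => by
      rw [Real.dist_eq, Real.dist_eq]; exact hlip x hx y hy
    exact this.continuousOn
  set G : ℝ → ℝ := fun u => -Real.log u + h u with hG
  set g : ℝ → ℝ := fun u => G u * (1+u)⁻¹ with hg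
  have hinv : ContinuousOn (fun u : ℝ => (1+u)⁻¹) (uIcc 0 1) := by
    refine ContinuousOn.inv₀ (by fun_prop) fun u hu => ?_
    rw [uIcc_of_le zero_le_one] at hu
    linarith [hu.1]
  have hlogint : IntervalIntegrable (fun u => -Real.log u * (1+u)⁻¹) volume 0 1 :=
    (intervalIntegral.intervalIntegrable_log' (a := 0) (b := 1)).neg.mul_continuousOn hinv
  have hhint : IntervalIntegrable (fun u => h u * (1+u)⁻¹) volume 0 1 := by
    refine ContinuousOn.intervalIntegrable ?_
    refine ContinuousOn.mul ?_ hinv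
    rwa [uIcc_of_le zero_le_one]
  have hcint : IntervalIntegrable (fun u => c * (1+u)⁻¹) volume 0 1 :=
    (continuousOn_const.mul hinv).intervalIntegrable
  have hgint : IntervalIntegrable g volume 0 1 := by
    refine (hlogint.add hhint).congr (fun u hu => ?_)
    simp only [hg, hG]; ring
  have hGc : ContinuousOn g (Ioc 0 1) := by
    refine ContinuousOn.mul (ContinuousOn.add (ContinuousOn.neg ?_) (hcont.mono Ioc_subset_Icc_self)) (hinv.mono ?_)
    · exact Real.continuousOn_log.mono fun u hu => by simpa using hu.1.ne'
    · rw [uIcc_of_le zero_le_one]; exact Ioc_subset_Icc_self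
  set a : ℕ → ℝ := fun k => 1/((k:ℝ)+1) with ha
  have ha_mem : ∀ k, a k ∈ Ioc (0:ℝ) 1 := fun k => by
    have : (0:ℝ) ≤ k := by positivity
    refine ⟨by simp only [ha]; positivity, ?_⟩
    simp only [ha]; rw [div_le_one (by positivity)]; linarith
  set F : ℕ → ℝ → ℝ := fun j y => g (nx y j) * (1/(j+1+y)^2) with hF
  have hsub : ∀ j, ∫ y in (0:ℝ)..1, F j y = - ∫ u in a j..a (j+1), g u := by
    intro j
    have := intervalIntegral.integral_comp_mul_deriv' (a := 0) (b := 1) (f := fun y => nx y j) (f' := fun y => -(1/(j+1+y)^2)) (g := g)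
      (by
        intro x hx
        rw [uIcc_of_le zero_le_one] at hx
        have hx1 := hx.1
        have h1 : HasDerivAt (fun y : ℝ => (j:ℝ)+1+y) 1 x := by
          simpa using (hasDerivAt_id x).const_add ((j:ℝ)+1)
        have h2 := h1.inv (by positivity)
        have e : (fun y => nx y j) = (fun y : ℝ => (j:ℝ)+1+y)⁻¹ := by funext y; simp [nx]
        rw [e]; refine h2.congr_deriv ?_; field_simp)
      (by
        rw [uIcc_of_le zero_le_one]
        refine ContinuousOn.neg (ContinuousOn.div (by fun_prop) (by fun_prop) fun x hx => ?_)
        have := hx.1; positivity)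
      (by
        refine hGc.mono ?_
        rintro _ ⟨y, hy, rfl⟩
        rw [uIcc_of_le zero_le_one] at hy
        exact ⟨nx_pos hy.1 j, (nx_mem hy.1 j).2⟩)
    have e0 : nx 0 j = a j := by simp [nx, ha]
    have e1 : nx 1 j = a (j+1) := by simp [nx, ha]
    simp only [e0, e1] at this
    rw [← this, ← intervalIntegral.integral_neg]
    refine intervalIntegral.integral_congr fun y hy => ?_
    simp [hF]
  have hFeq : ∀ j, ∀ y ∈ Icc (0:ℝ) 1, F j y = (wt y j * (Real.log (j+1+y) + h (nx y j))) * (1+y)⁻¹ := by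
    intro j y hy
    have := hy.1
    have hl : Real.log (nx y j) = - Real.log (j+1+y) := by simp [nx, Real.log_inv]
    simp only [hF, hg, hG, hl, neg_neg]
    have e : (1 + nx y j)⁻¹ * (1/(j+1+y)^2) = wt y j * (1+y)⁻¹ := by
      unfold nx wt; field_simp; ring
    calc _ = (Real.log (j+1+y) + h (nx y j)) * ((1 + nx y j)⁻¹ * (1/(j+1+y)^2)) := by ring
      _ = _ := by rw [e]; ring
  set K := 384 * Real.exp ((b+1)/2) with hK
  have hb := H.b_ge
  have hGb : ∀ j : ℕ, ∀ y ∈ Icc (0:ℝ) 1, |Real.log (j+1+y) + h (nx y j)| ≤ K * Real.sqrt ((j:ℝ)+1) := by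
    intro j y hy
    obtain ⟨a1, a2⟩ := log_add_le hy j
    have h1 := abs_le.1 (H.h_bd _ (nx_mem hy.1 j))
    refine le_trans ?_ (X_sq (b := b+1) (by linarith) j).2.2.1
    rw [abs_le]; constructor <;> linarith
  have hsumy : ∀ y ∈ Icc (0:ℝ) 1, HasSum (fun j => F j y) ((c + h y) * (1+y)⁻¹) := by
    intro y hy
    have s := wt_summable (E := ℝ) hy (g := fun j : ℕ => Real.log (j+1+y) + h (nx y j)) (M := K) (fun j => hGb j y hy)
    simp only [smul_eq_mul] at s
    have s2 := (wt_hasSum hy.1).mul_right (c + h y)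
    have e := H.eq1 y hy
    have e2 : (fun j : ℕ => wt y j * (Real.log (j+1+y) - c + h (nx y j) - h y)) = fun j : ℕ => wt y j * (Real.log (j+1+y) + h (nx y j)) - wt y j * (c + h y) := by
      funext j; ring
    rw [e2, s.tsum_sub s2.summable, s2.tsum_eq] at e
    have s3 := s.hasSum
    rw [show ∑' j : ℕ, wt y j * (Real.log (j+1+y) + h (nx y j)) = c + h y by linarith] at s3
    refine (s3.mul_right ((1+y)⁻¹)).congr_fun ?_ |> id
    intro j; exact hFeq j y hy
  have hdom := intervalIntegral.hasSum_integral_of_dominated_convergence (a := 0) (b := 1) (μ := volume) (F := F)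
    (f := fun y => (c + h y) * (1+y)⁻¹) (fun j _ => 2 * K * (Real.sqrt ((j:ℝ)+1)/((j:ℝ)+1)^2))
    (fun j => by
      rw [uIoc_of_le zero_le_one]
      have : ContinuousOn (F j) (Ioc 0 1) := by
        refine ContinuousOn.mul ?_ ?_
        · refine ContinuousOn.comp hGc ?_ ?_
          · unfold nx
            refine ContinuousOn.div (by fun_prop) (by fun_prop) fun x hx => ?_
            have := hx.1; positivity
          · intro y hy; exact ⟨nx_pos hy.1.le j, (nx_mem hy.1.le j).2⟩
        · refine ContinuousOn.div (by fun_prop) (by fun_prop) fun x hx => ?_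
          have := hx.1; positivity
      exact this.aestronglyMeasurable measurableSet_Ioc)
    (fun j => Eventually.of_forall fun y hy => by
      rw [uIoc_of_le zero_le_one] at hy
      have hy' : y ∈ Icc (0:ℝ) 1 := Ioc_subset_Icc_self hy
      rw [hFeq j y hy', norm_mul, norm_mul, Real.norm_of_nonneg (wt_nonneg hy'.1 j)]
      have i1 : ‖(1+y)⁻¹‖ ≤ 1 := by
        rw [norm_inv, Real.norm_of_nonneg (by linarith [hy'.1])]
        exact inv_le_one_of_one_le₀ (by linarith [hy'.1])
      have i2 := hGb j y hy'
      rw [← Real.norm_eq_abs] at i2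
      have i3 := wt_le hy' j
      calc _ ≤ (2/((j:ℝ)+1)^2 * (K * Real.sqrt ((j:ℝ)+1))) * 1 := by gcongr
        _ = _ := by ring)
    (Eventually.of_forall fun y hy => summ32.mul_left (2*K))
    (by simp)
    (Eventually.of_forall fun y hy => by
      rw [uIoc_of_le zero_le_one] at hy
      exact hsumy y (Ioc_subset_Icc_self hy))
  have hlim := hdom.tendsto_sum_nat
  have hpart : ∀ n, ∑ j ∈ Finset.range n, ∫ y in (0:ℝ)..1, F j y = - ∫ u in (1:ℝ)..a n, g u := by
    intro n
    simp_rw [hsub]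
    rw [Finset.sum_neg_distrib, intervalIntegral.sum_integral_adjacent_intervals]
    · simp [ha]
    · intro k _
      refine hgint.mono_set ?_
      rw [uIcc_of_le zero_le_one]
      exact uIcc_subset_Icc (Ioc_subset_Icc_self (ha_mem k)) (Ioc_subset_Icc_self (ha_mem (k+1)))
  simp_rw [hpart] at hlim
  have hcon := intervalIntegral.continuousOn_primitive_interval' hgint (a := 1) (by simp)
  have hat : Tendsto a atTop (nhdsWithin 0 (uIcc 0 1)) := by
    refine tendsto_nhdsWithin_iff.2 ⟨tendsto_one_div_add_atTop_nhds_zero_nat, Eventually.of_forall fun k => ?_⟩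
    rw [uIcc_of_le zero_le_one]; exact Ioc_subset_Icc_self (ha_mem k)
  have hlim2 := ((hcon 0 (by simp)).tendsto.comp hat).neg
  have heq := tendsto_nhds_unique hlim hlim2
  rw [← intervalIntegral.integral_symm] at heq
  have e1 : ∫ u in (0:ℝ)..1, g u = (∫ u in (0:ℝ)..1, -Real.log u * (1+u)⁻¹) + ∫ u in (0:ℝ)..1, h u * (1+u)⁻¹ := by
    rw [← intervalIntegral.integral_add hlogint hhint]
    refine intervalIntegral.integral_congr fun u hu => ?_
    simp only [hg, hG]; ring
  have e2 : ∫ u in (0:ℝ)..1, (c + h u) * (1+u)⁻¹ = (∫ u in (0:ℝ)..1, c * (1+u)⁻¹) + ∫ u in (0:ℝ)..1, h u * (1+u)⁻¹ := by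
    rw [← intervalIntegral.integral_add hcint hhint]
    refine intervalIntegral.integral_congr fun u hu => ?_
    ring
  have e3 : ∫ u in (0:ℝ)..1, c * (1+u)⁻¹ = c * Real.log 2 := by
    rw [intervalIntegral.integral_const_mul]
    have := intervalIntegral.integral_comp_add_left (a := 0) (b := 1) (fun x : ℝ => x⁻¹) 1
    rw [this, integral_inv_of_pos (by norm_num) (by norm_num)]
    norm_num
  rw [e1, e2, e3, int_log_val] at heq
  have : 0 < Real.log 2 := Real.log_pos (by norm_num)
  rw [eq_div_iff (by positivity)]
  linarith

end GK

namespace GK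

noncomputable def dig (n : ℕ) (x : ℝ) : ℕ := (⌊1 / (gaussMap^[n] x)⌋).toNat - 1

noncomputable def hist : ℕ → ℝ → List ℕ
  | 0, _ => []
  | n+1, x => dig n x :: hist n x

noncomputable def qv : List ℕ → ℝ × ℝ
  | [] => (1, 0)
  | j :: l => ((j+1) * (qv l).1 + (qv l).2, (qv l).1)

noncomputable def pv : List ℕ → ℝ × ℝ
  | [] => (0, 1)
  | j :: l => ((j+1) * (pv l).1 + (pv l).2, (pv l).1)

noncomputable def yv (l : List ℕ) : ℝ := (qv l).2 / (qv l).1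

noncomputable def ph (l : List ℕ) (u : ℝ) : ℝ := ((pv l).1 + u * (pv l).2) / ((qv l).1 + u * (qv l).2)

lemma hist_length (n : ℕ) (x : ℝ) : (hist n x).length = n := by
  induction n with
  | zero => rfl
  | succ n ih => simp [hist, ih]

lemma qv_bd (l : List ℕ) : 1 ≤ (qv l).1 ∧ 0 ≤ (qv l).2 ∧ (qv l).2 ≤ (qv l).1 := by
  induction l with
  | nil => simp [qv]
  | cons j l ih =>
    obtain ⟨a, b, c⟩ := ih
    have hj : (0:ℝ) ≤ j := by positivity
    simp only [qv]
    refine ⟨by nlinarith, by linarith, by nlinarith⟩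

lemma yv_mem (l : List ℕ) : yv l ∈ Icc (0:ℝ) 1 := by
  obtain ⟨a, b, c⟩ := qv_bd l
  exact ⟨by unfold yv; positivity, by unfold yv; rw [div_le_one (by linarith)]; exact c⟩

lemma qv_cons (j : ℕ) (l : List ℕ) : (qv (j::l)).1 = (qv l).1 * (j + 1 + yv l) := by
  obtain ⟨a, b, c⟩ := qv_bd l
  have : (qv l).1 ≠ 0 := by linarith
  simp only [qv, yv]; field_simp

lemma yv_cons (j : ℕ) (l : List ℕ) : yv (j::l) = 1/(j+1+yv l) := by
  obtain ⟨a, b, c⟩ := qv_bd l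
  rw [yv, qv_cons]
  have h0 : (0:ℝ) < (qv l).1 := by linarith
  have h1 : (0:ℝ) < j+1+yv l := by have := (yv_mem l).1; positivity
  show (qv l).1 / _ = _
  field_simp

lemma det_pm (l : List ℕ) : (pv l).2 * (qv l).1 - (pv l).1 * (qv l).2 = (-1)^l.length := by
  induction l with
  | nil => simp [pv, qv]
  | cons j l ih =>
    simp only [pv, qv, List.length_cons, pow_succ, ← ih]; ring

lemma ph_cons (j : ℕ) (l : List ℕ) {u : ℝ} (hu : 0 ≤ u) : ph (j::l) u = ph l (1/(j+1+u)) := by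
  obtain ⟨a, b, c⟩ := qv_bd l
  have h1 : (0:ℝ) < j+1+u := by positivity
  have h2 : 0 < (qv l).1 := by linarith
  simp only [ph, pv, qv]
  rw [div_eq_div_iff]
  · field_simp; ring
  · positivity
  · positivity

lemma ph_sub_zero (l : List ℕ) {u : ℝ} (hu : 0 ≤ u) :
    ph l u - ph l 0 = (-1)^l.length * (u / ((qv l).1 * ((qv l).1 + u * (qv l).2))) := by
  obtain ⟨a, b, c⟩ := qv_bd l
  have h2 : 0 < (qv l).1 := by linarith
  have h3 : 0 < (qv l).1 + u * (qv l).2 := by positivity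
  simp only [ph, ← det_pm]
  rw [zero_mul, zero_mul, add_zero, add_zero]
  field_simp; ring

lemma ph_one_sub (l : List ℕ) {u : ℝ} (hu : 0 ≤ u) :
    ph l 1 - ph l u = (-1)^l.length * ((1-u) / (((qv l).1 + (qv l).2) * ((qv l).1 + u * (qv l).2))) := by
  obtain ⟨a, b, c⟩ := qv_bd l
  have h2 : 0 < (qv l).1 := by linarith
  have h3 : 0 < (qv l).1 + u * (qv l).2 := by positivity
  simp only [ph, ← det_pm, one_mul]
  field_simp; ring

lemma gm_mem {y : ℝ} : gaussMap y ∈ Ico (0:ℝ) 1 := by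
  unfold gaussMap
  split_ifs
  · simp
  · exact ⟨Int.fract_nonneg _, Int.fract_lt_one _⟩

lemma gm_iter_mem {y : ℝ} (hy : y ∈ Ico (0:ℝ) 1) (n : ℕ) : gaussMap^[n] y ∈ Ico (0:ℝ) 1 := by
  cases n with
  | zero => exact hy
  | succ n => rw [Function.iterate_succ_apply']; exact gm_mem

lemma gm_irr {y : ℝ} (hy : Irrational y) : Irrational (gaussMap y) := by
  unfold gaussMap
  rw [if_neg hy.ne_zero, one_div]
  exact (irrational_inv_iff.2 hy).sub_intCast _

lemma gm_iter_irr {y : ℝ} (hy : Irrational y) (n : ℕ) : Irrational (gaussMap^[n] y) := by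
  induction n with
  | zero => exact hy
  | succ n ih => rw [Function.iterate_succ_apply']; exact gm_irr ih

lemma gm_iter_Ioo {y : ℝ} (hy : Irrational y) (hy' : y ∈ Ico (0:ℝ) 1) (n : ℕ) : gaussMap^[n] y ∈ Ioo (0:ℝ) 1 := by
  have h := gm_iter_mem hy' n
  exact ⟨lt_of_le_of_ne h.1 (gm_iter_irr hy n).ne_zero.symm, h.2⟩

lemma dig_spec {x : ℝ} {n : ℕ} (h : gaussMap^[n] x ∈ Ioo (0:ℝ) 1) : cfA (n+1) x = (dig n x : ℤ) + 1 := by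
  have h1 : 1 ≤ ⌊1 / (gaussMap^[n] x)⌋ := by
    rw [Int.le_floor]; push_cast; rw [le_div_iff₀ h.1]; linarith [h.2]
  simp only [cfA, dig, Nat.add_sub_cancel]
  omega

lemma gm_rec {x : ℝ} {n : ℕ} (h : gaussMap^[n] x ∈ Ioo (0:ℝ) 1) :
    gaussMap^[n] x = 1/((dig n x : ℝ) + 1 + gaussMap^[n+1] x) := by
  have h1 := dig_spec h
  simp only [cfA, Nat.add_sub_cancel] at h1
  rw [Function.iterate_succ_apply']
  conv_rhs => rw [gaussMap]
  rw [if_neg h.1.ne', h1]; push_cast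
  rw [show (dig n x:ℝ) + 1 + (1 / gaussMap^[n] x - (dig n x + 1)) = 1/gaussMap^[n] x by ring, one_div_one_div]

/-- reconstruct -/
lemma ph_hist {x : ℝ} {n : ℕ} (hx : x ∈ Ico (0:ℝ) 1) (h : ∀ i < n, gaussMap^[i] x ≠ 0) :
    x = ph (hist n x) (gaussMap^[n] x) := by
  induction n with
  | zero => simp [hist, ph, pv, qv]
  | succ n ih =>
    have h1 := gm_iter_mem hx n
    have h2 : gaussMap^[n] x ∈ Ioo (0:ℝ) 1 := ⟨lt_of_le_of_ne h1.1 (h n (by omega)).symm, h1.2⟩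
    have h3 := gm_iter_mem hx (n+1)
    rw [hist, ph_cons _ _ h3.1, ← gm_rec h2]
    exact ih fun i hi => h i (by omega)

lemma hist_ph (l : List ℕ) {u : ℝ} (hu : u ∈ Ioo (0:ℝ) 1) :
    hist l.length (ph l u) = l ∧ gaussMap^[l.length] (ph l u) = u := by
  induction l generalizing u with
  | nil => simp [hist, ph, pv, qv]
  | cons j l ih =>
    have hj : (0:ℝ) ≤ j := by positivity
    have hpos : (0:ℝ) < j+1+u := by linarith [hu.1]
    have hv : 1/((j:ℝ)+1+u) ∈ Ioo (0:ℝ) 1 := ⟨by positivity, by rw [div_lt_one hpos]; linarith [hu.1]⟩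
    obtain ⟨i1, i2⟩ := ih hv
    rw [ph_cons _ _ hu.1.le, List.length_cons, Function.iterate_succ_apply', hist, i1, i2]
    have hfl : ⌊(j:ℝ)+1+u⌋ = (j:ℤ)+1 := by
      rw [Int.floor_eq_iff]; push_cast; constructor <;> linarith [hu.1, hu.2]
    constructor
    · congr 1
      rw [dig, i2, one_div_one_div, hfl]; omega
    · rw [gaussMap, if_neg hv.1.ne', one_div_one_div, hfl]; push_cast; ring

lemma hist_succ_eq (n : ℕ) (x : ℝ) : hist (n+1) x = dig n x :: hist n x := rfl

lemma ph_mem_Ico (l : List ℕ) {u : ℝ} (hu : u ∈ Ioo (0:ℝ) 1) : ph l u ∈ Ioo (0:ℝ) 1 := by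
  induction l generalizing u with
  | nil => simpa [ph, pv, qv] using hu
  | cons j l ih =>
    have hj : (0:ℝ) ≤ j := by positivity
    have hpos : (0:ℝ) < j+1+u := by linarith [hu.1]
    rw [ph_cons _ _ hu.1.le]
    exact ih ⟨by positivity, by rw [div_lt_one hpos]; linarith [hu.1]⟩

lemma cfQ_eq {x : ℝ} (hx : Irrational x) (hx' : x ∈ Ico (0:ℝ) 1) (n : ℕ) :
    (cfQ x n : ℝ) = (qv (hist n x)).1 ∧ (cfQ x (n+1) : ℝ) = (qv (hist (n+1) x)).1 := by
  induction n with
  | zero =>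
    have := dig_spec (gm_iter_Ioo hx hx' 0)
    simp [cfQ, hist, qv, this]
  | succ n ih =>
    refine ⟨ih.2, ?_⟩
    have := dig_spec (gm_iter_Ioo hx hx' (n+1))
    rw [cfQ, this]; push_cast
    rw [ih.1, ih.2]
    simp [hist, qv]

lemma cfA_iff_hist {x y : ℝ} (hx : Irrational x) (hx' : x ∈ Ico (0:ℝ) 1) (hy : y ∈ Ico (0:ℝ) 1) (n : ℕ) :
    (∀ i, 1 ≤ i → i ≤ n → cfA i y = cfA i x) ↔ ((∀ i < n, gaussMap^[i] y ≠ 0) ∧ hist n y = hist n x) := by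
  induction n with
  | zero => simp [hist]; omega
  | succ n ih =>
    have hX := dig_spec (gm_iter_Ioo hx hx' n)
    constructor
    · intro h
      obtain ⟨h1, h2⟩ := ih.1 fun i hi hi' => h i hi (by omega)
      have h3 := h (n+1) (by omega) le_rfl
      rw [hX] at h3
      have h0 : gaussMap^[n] y ≠ 0 := by
        intro h0
        simp only [cfA, Nat.add_sub_cancel, h0] at h3
        simp at h3; omega
      have hm := gm_iter_mem hy n
      have hY := dig_spec (x := y) (n := n) ⟨lt_of_le_of_ne hm.1 h0.symm, hm.2⟩
      refine ⟨fun i hi => ?_, ?_⟩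
      · rcases Nat.lt_succ_iff_lt_or_eq.1 hi with h | h
        · exact h1 i h
        · rw [h]; exact h0
      · rw [hist, hist, h2]; congr 1; omega
    · rintro ⟨h1, h2⟩
      rw [hist, hist] at h2
      injection h2 with h3 h4
      have hm := gm_iter_mem hy n
      have hY := dig_spec (x := y) (n := n) ⟨lt_of_le_of_ne hm.1 (h1 n (by omega)).symm, hm.2⟩
      intro i hi hi'
      rcases Nat.lt_or_ge i (n+1) with h | h
      · exact ih.2 ⟨fun i hi => h1 i (by omega), h4⟩ i hi (by omega)
      · have : i = n+1 := by omega
        rw [this, hX, hY, h3]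

end GK

namespace GK
open ProbabilityTheory

instance instMSL : MeasurableSpace (List ℕ) := ⊤
instance instDMSL : DiscreteMeasurableSpace (List ℕ) := ⟨fun _ => trivial⟩

noncomputable def lam : Measure ℝ := volume.restrict (Ico (0:ℝ) 1)

instance instProbLam : IsProbabilityMeasure lam := ⟨by simp [lam]⟩

lemma ae_irr : ∀ᵐ x ∂lam, Irrational x ∧ x ∈ Ico (0:ℝ) 1 := by
  have h1 : ∀ᵐ x : ℝ ∂volume, Irrational x := by
    have := (Set.countable_range ((↑) : ℚ → ℝ)).ae_notMem volume
    filter_upwards [this] with x hx using hx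
  have h2 := ae_restrict_mem (μ := volume) (measurableSet_Ico (a := (0:ℝ)) (b := 1))
  filter_upwards [ae_restrict_of_ae h1, h2] with x a b using ⟨a, b⟩

lemma ph_cont (l : List ℕ) : ContinuousOn (ph l) (Icc 0 1) := by
  obtain ⟨a, b, c⟩ := qv_bd l
  unfold ph
  refine ContinuousOn.div (by fun_prop) (by fun_prop) fun u hu => ?_
  have := mul_nonneg hu.1 b
  linarith

lemma cyl_meas (l : List ℕ) :
    lam {x | hist l.length x = l} = ENNReal.ofReal (1/((qv l).1 * ((qv l).1 + (qv l).2))) := by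
  obtain ⟨qa, qb, qc⟩ := qv_bd l
  have h01 := ph_sub_zero l (u := 1) zero_le_one
  rw [one_mul] at h01
  have hpos : 0 < 1/((qv l).1 * ((qv l).1 + (qv l).2)) := by positivity
  set D := 1/((qv l).1 * ((qv l).1 + (qv l).2)) with hD
  have hdist : ∀ u ∈ Icc (0:ℝ) 1, 0 ≤ u / ((qv l).1 * ((qv l).1 + u * (qv l).2)) ∧ 0 ≤ (1-u) / (((qv l).1 + (qv l).2) * ((qv l).1 + u * (qv l).2)) := by
    intro u hu
    have := hu.1
    have : 0 ≤ 1 - u := by linarith [hu.2]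
    constructor <;> positivity
  -- generic: sandwich
  have key : ∀ A B : ℝ, B - A = D → Ioo A B ⊆ ph l '' Ioo 0 1 → (∀ u ∈ Icc (0:ℝ) 1, ph l u ∈ Icc A B) →
      lam {x | hist l.length x = l} = ENNReal.ofReal D := by
    intro A B hAB hsub hsup
    apply le_antisymm
    · have : lam {x | hist l.length x = l} ≤ lam (Icc A B) := by
        refine measure_mono_ae ?_
        filter_upwards [ae_irr] with x hx hxl
        have hxl' : hist l.length x = l := hxl
        have := ph_hist (n := l.length) hx.2 (fun i _ => (gm_iter_irr hx.1 i).ne_zero)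
        rw [hxl'] at this
        have h3 := hsup _ (Ico_subset_Icc_self (gm_iter_mem hx.2 l.length))
        rw [← this] at h3; exact h3
      refine this.trans ?_
      refine (Measure.restrict_apply_le _ _).trans ?_
      rw [Real.volume_Icc, hAB]
    · have : lam (Ioo A B) ≤ lam {x | hist l.length x = l} := by
        refine measure_mono fun x hx => ?_
        obtain ⟨u, hu, rfl⟩ := hsub hx
        exact (hist_ph l hu).1
      refine le_trans ?_ this
      rw [lam, Measure.restrict_apply measurableSet_Ioo, inter_eq_left.2, Real.volume_Ioo, hAB]
      intro x hx
      obtain ⟨u, hu, rfl⟩ := hsub hx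
      exact Ioo_subset_Ico_self (ph_mem_Ico l hu)
  rcases neg_one_pow_eq_or ℝ l.length with hs | hs
  · refine key (ph l 0) (ph l 1) (by rw [h01, hs]; ring) (intermediate_value_Ioo zero_le_one (ph_cont l)) fun u hu => ?_
    have e1 := ph_sub_zero l hu.1
    have e2 := ph_one_sub l hu.1
    rw [hs] at e1 e2
    obtain ⟨d1, d2⟩ := hdist u hu
    constructor <;> linarith
  · refine key (ph l 1) (ph l 0) (by rw [hs] at h01; linarith) (intermediate_value_Ioo' zero_le_one (ph_cont l)) fun u hu => ?_
    have e1 := ph_sub_zero l hu.1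
    have e2 := ph_one_sub l hu.1
    rw [hs] at e1 e2
    obtain ⟨d1, d2⟩ := hdist u hu
    constructor <;> linarith

noncomputable def kap : Kernel (List ℕ) ℕ where
  toFun l := Measure.sum (fun j => ENNReal.ofReal (wt (yv l) j) • Measure.dirac j)
  measurable' := Measurable.of_discrete

lemma kap_apply (l : List ℕ) : kap l = Measure.sum (fun j => ENNReal.ofReal (wt (yv l) j) • Measure.dirac j) := rfl

lemma kap_single (l : List ℕ) (j : ℕ) : kap l {j} = ENNReal.ofReal (wt (yv l) j) := by
  rw [kap_apply, Measure.sum_apply _ (measurableSet_singleton j), tsum_eq_single j]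
  · simp
  · intro i hi; simp [hi]

instance instKap : IsMarkovKernel kap := ⟨fun l => ⟨by
  rw [kap_apply, Measure.sum_apply _ MeasurableSet.univ]
  simp only [Measure.smul_apply, measure_univ, smul_eq_mul, mul_one]
  rw [← ENNReal.ofReal_tsum_of_nonneg (fun j => wt_nonneg (yv_mem l).1 j) (wt_hasSum (yv_mem l).1).summable,
    (wt_hasSum (yv_mem l).1).tsum_eq, ENNReal.ofReal_one]⟩⟩

lemma kap_int {E : Type*} [NormedAddCommGroup E] [NormedSpace ℝ E] [FiniteDimensional ℝ E] (l : List ℕ) (f : ℕ → E) :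
    ∫ j, f j ∂(kap l) = ∑' j, wt (yv l) j • f j := by
  rw [kap_apply, integral_sum_dirac (fun j => ENNReal.ofReal_ne_top)]
  refine tsum_congr fun j => ?_
  rw [ENNReal.toReal_ofReal (wt_nonneg (yv_mem l).1 j)]

lemma kap_integrable {E : Type*} [NormedAddCommGroup E] {l : List ℕ} {f : ℕ → E} {M : ℝ}
    (hf : ∀ j : ℕ, ‖f j‖ ≤ M * Real.sqrt ((j:ℝ)+1)) : Integrable f (kap l) := by
  rw [kap_apply]
  refine integrable_sum_dirac (fun j => ENNReal.ofReal_ne_top) ?_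
  have := wt_summable (E := ℝ) (yv_mem l) (g := fun j => ‖f j‖) (M := M) (fun j => by rw [norm_norm]; exact hf j)
  refine this.congr fun j => ?_
  rw [ENNReal.toReal_ofReal (wt_nonneg (yv_mem l).1 j), smul_eq_mul]

lemma gm_meas : Measurable gaussMap := by
  unfold gaussMap
  refine Measurable.ite (measurableSet_singleton 0) measurable_const ?_
  have h1 : Measurable (fun x : ℝ => 1/x) := by fun_prop
  have h2 : Measurable (fun x : ℝ => ((⌊1/x⌋ : ℤ) : ℝ)) := (measurable_from_top (f := fun z : ℤ => (z:ℝ))).comp (Int.measurable_floor.comp h1)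
  exact h1.sub h2

lemma dig_meas (n : ℕ) : Measurable (dig n) := by
  have h1 : Measurable (fun x : ℝ => ⌊1/gaussMap^[n] x⌋) :=
    Int.measurable_floor.comp (by have := gm_meas.iterate n; fun_prop)
  exact (measurable_from_top (f := fun z : ℤ => z.toNat - 1)).comp h1

lemma hist_meas (n : ℕ) : Measurable (hist n) := by
  induction n with
  | zero => exact measurable_const
  | succ n ih =>
    have : hist (n+1) = (fun p : ℕ × List ℕ => p.1 :: p.2) ∘ fun x => (dig n x, hist n x) := rfl
    rw [this]
    exact (Measurable.of_discrete).comp ((dig_meas n).prodMk ih)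

lemma markov (n : ℕ) : lam.map (fun x => (hist n x, dig n x)) = (lam.map (hist n)) ⊗ₘ kap := by
  refine Measure.ext_of_singleton fun p => ?_
  obtain ⟨l, j⟩ := p
  rw [Measure.map_apply ((hist_meas n).prodMk (dig_meas n)) (measurableSet_singleton _)]
  rw [← singleton_prod_singleton, Measure.compProd_apply_prod (measurableSet_singleton _) (measurableSet_singleton _)]
  rw [lintegral_singleton, Measure.map_apply (hist_meas n) (measurableSet_singleton _), kap_single]
  by_cases hl : l.length = n
  · have e1 : (fun x => (hist n x, dig n x)) ⁻¹' ({l} ×ˢ {j}) = {x | hist (j::l).length x = j::l} := by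
      ext x
      simp only [mem_preimage, mem_prod, mem_singleton_iff, mem_setOf_eq, List.length_cons, hist, List.cons.injEq, hl]
      tauto
    have e2 : hist n ⁻¹' {l} = {x | hist l.length x = l} := by rw [hl]; rfl
    rw [e1, e2, cyl_meas, cyl_meas, ← ENNReal.ofReal_mul (wt_nonneg (yv_mem l).1 j)]
    congr 1
    obtain ⟨qa, qb, qc⟩ := qv_bd l
    have hq : (qv l).2 = (qv l).1 * yv l := by unfold yv; field_simp
    have hy := (yv_mem l).1
    rw [qv_cons, show (qv (j::l)).2 = (qv l).1 from rfl, hq, wt]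
    field_simp
    ring
  · have e1 : (fun x => (hist n x, dig n x)) ⁻¹' ({l} ×ˢ {j}) = ∅ := by
      ext x
      simp only [mem_preimage, mem_prod, mem_singleton_iff, mem_empty_iff_false, iff_false]
      rintro ⟨h, -⟩; apply hl; rw [← h, hist_length]
    have e2 : hist n ⁻¹' {l} = ∅ := by
      ext x
      simp only [mem_preimage, mem_singleton_iff, mem_empty_iff_false, iff_false]
      intro h; apply hl; rw [← h, hist_length]
    rw [e1, e2]; simp

lemma integrable_step {E : Type*} [NormedAddCommGroup E] (n : ℕ) {F : List ℕ → ℕ → E} {G : List ℕ → ℝ}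
    (hG : Integrable (fun x => G (hist n x)) lam) (hF : ∀ l j, ‖F l j‖ ≤ G l * Real.sqrt ((j:ℝ)+1)) :
    Integrable (fun x => F (hist n x) (dig n x)) lam := by
  have hm := (hist_meas n).prodMk (dig_meas n)
  have hsm : ∀ ν : Measure (List ℕ × ℕ), AEStronglyMeasurable (fun p : List ℕ × ℕ => F p.1 p.2) ν :=
    fun ν => AEStronglyMeasurable.of_discrete
  have : Integrable (fun p : List ℕ × ℕ => F p.1 p.2) (lam.map (fun x => (hist n x, dig n x))) := by
    rw [markov, Measure.integrable_compProd_iff (hsm _)]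
    refine ⟨ae_of_all _ fun l => kap_integrable (hF l), ?_⟩
    set Sg := ∑' j : ℕ, Real.sqrt ((j:ℝ)+1) / ((j:ℝ)+1)^2
    have hG' : Integrable G (lam.map (hist n)) :=
      (integrable_map_measure AEStronglyMeasurable.of_discrete (hist_meas n).aemeasurable).2 hG
    refine (hG'.const_mul (2*Sg)).mono' AEStronglyMeasurable.of_discrete (ae_of_all _ fun l => ?_)
    rw [kap_int]
    refine (wt_tsum_le (yv_mem l) (M := G l) (fun j => by rw [norm_norm]; exact hF l j)).trans (le_of_eq (by ring))
  exact (integrable_map_measure (hsm _) hm.aemeasurable).1 this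

lemma integral_step {E : Type*} [NormedAddCommGroup E] [NormedSpace ℝ E] [FiniteDimensional ℝ E] (n : ℕ) {F : List ℕ → ℕ → E}
    (hF : Integrable (fun x => F (hist n x) (dig n x)) lam) :
    ∫ x, F (hist n x) (dig n x) ∂lam = ∫ x, (∑' j, wt (yv (hist n x)) j • F (hist n x) j) ∂lam := by
  have hm := (hist_meas n).prodMk (dig_meas n)
  have hsm : ∀ ν : Measure (List ℕ × ℕ), AEStronglyMeasurable (fun p : List ℕ × ℕ => F p.1 p.2) ν :=
    fun ν => AEStronglyMeasurable.of_discrete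
  have h1 := integral_map hm.aemeasurable (hsm (lam.map (fun x => (hist n x, dig n x))))
  simp only at h1
  rw [← h1]
  have h2 := (integrable_map_measure (hsm _) hm.aemeasurable).2 hF
  rw [markov] at h2 ⊢
  rw [Measure.integral_compProd h2]
  simp only [kap_int]
  exact integral_map (f := fun l => ∑' j, wt (yv l) j • F l j) (hist_meas n).aemeasurable AEStronglyMeasurable.of_discrete

lemma condExp_step (n : ℕ) {F : List ℕ → ℕ → ℝ}
    (hF : Integrable (fun x => F (hist n x) (dig n x)) lam) :
    lam[fun x => F (hist n x) (dig n x) | MeasurableSpace.comap (hist n) ⊤] =ᵐ[lam]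
      fun x => ∑' j, wt (yv (hist n x)) j * F (hist n x) j := by
  have h1 := condExp_prod_ae_eq_integral_condDistrib (μ := lam) (f := fun p : List ℕ × ℕ => F p.1 p.2) (hist_meas n) (dig_meas n).aemeasurable
    StronglyMeasurable.of_discrete hF
  have h2 := condDistrib_ae_eq_of_measure_eq_compProd (hist n) (dig_meas n).aemeasurable (markov n)
  have h3 := ae_of_ae_map (hist_meas n).aemeasurable h2
  filter_upwards [h1, h3] with x a b
  refine a.trans ?_
  rw [b, kap_int]; simp

end GK

namespace GK
open ProbabilityTheory

noncomputable def SS (c : ℝ) (n : ℕ) (x : ℝ) : ℝ := Real.log (qv (hist n x)).1 - c * n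

lemma hist_drop (m n : ℕ) (x : ℝ) : (hist (m+n) x).drop n = hist m x := by
  induction n with
  | zero => rfl
  | succ n ih => rw [← add_assoc, hist, List.drop_succ_cons, ih]

noncomputable def FF : Filtration ℕ (inferInstance : MeasurableSpace ℝ) where
  seq n := MeasurableSpace.comap (hist n) ⊤
  mono' := by
    intro m n hmn
    obtain ⟨k, rfl⟩ := Nat.exists_eq_add_of_le hmn
    have e : hist m = (fun l : List ℕ => l.drop k) ∘ hist (m+k) := by
      funext x; simp [hist_drop]
    show MeasurableSpace.comap (hist m) ⊤ ≤ MeasurableSpace.comap (hist (m+k)) ⊤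
    rw [e, ← MeasurableSpace.comap_comp]
    exact MeasurableSpace.comap_mono le_top
  le' n := (hist_meas n).comap_le

lemma FF_meas (n : ℕ) (f : List ℕ → ℝ) : Measurable[FF n] (fun x => f (hist n x)) := by
  have h1 : Measurable[FF n] (hist n) := comap_measurable (hist n)
  exact (Measurable.of_discrete (f := f)).comp h1

lemma log_q_cons (j : ℕ) (l : List ℕ) : Real.log (qv (j::l)).1 = Real.log (qv l).1 + Real.log (j+1+yv l) := by
  obtain ⟨a, b, c⟩ := qv_bd l
  have := (yv_mem l).1
  rw [qv_cons, Real.log_mul (by linarith) (by positivity)]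

lemma SS_succ (c : ℝ) (n : ℕ) (x : ℝ) : SS c (n+1) x = SS c n x + (Real.log ((dig n x:ℝ)+1+yv (hist n x)) - c) := by
  rw [SS, SS, hist, log_q_cons]; push_cast; ring

lemma exp_log_bound {t : ℝ} (ht : |t| ≤ 1/4) (c : ℝ) {y : ℝ} (hy : y ∈ Icc (0:ℝ) 1) (j : ℕ) :
    Real.exp (t * (Real.log (j+1+y) - c)) ≤ Real.exp (1 + |c|) * Real.sqrt ((j:ℝ)+1) := by
  obtain ⟨a1, a2⟩ := log_add_le hy j
  have hj : (0:ℝ) ≤ j := by positivity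
  have hl : 0 ≤ Real.log ((j:ℝ)+1) := Real.log_nonneg (by linarith)
  have e : Real.sqrt ((j:ℝ)+1) = Real.exp (Real.log ((j:ℝ)+1)/2) := by
    rw [Real.sqrt_eq_rpow, Real.rpow_def_of_pos (by positivity)]; congr 1; ring
  rw [e, ← Real.exp_add, Real.exp_le_exp]
  have h1 : t * (Real.log (j+1+y) - c) ≤ |t| * (Real.log ((j:ℝ)+1) + 1 + |c|) := by
    refine (le_abs_self _).trans ?_
    rw [abs_mul]
    refine mul_le_mul_of_nonneg_left ?_ (abs_nonneg _)
    rw [abs_le]; have := abs_le.1 (le_refl |c|); constructor <;> linarith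
  have h2 : |t| * (Real.log ((j:ℝ)+1) + 1 + |c|) ≤ 1/4 * (Real.log ((j:ℝ)+1) + 1 + |c|) :=
    mul_le_mul_of_nonneg_right ht (by positivity)
  have := abs_nonneg c
  linarith

theorem lilData {c σ b : ℝ} {h w : ℝ → ℝ} (H : OpData c σ b h w) :
    ∃ C, LILData lam FF (SS c) (fun n x => h (yv (hist n x))) (fun n x => w (yv (hist n x))) σ b C (1/4) := by
  obtain ⟨C, hC, hexp⟩ := H.expansion
  refine ⟨C, ?_⟩
  have hb := H.b_ge
  constructor
  · intro n; exact FF_meas n (fun l => Real.log (qv l).1 - c * n)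
  · intro n; exact FF_meas n (fun l => h (yv l))
  · intro n; exact FF_meas n (fun l => w (yv l))
  · intro x; simp [SS, hist, qv]
  · intro n x; exact H.h_bd _ (yv_mem _)
  · intro n x; exact H.w_bd _ (yv_mem _)
  · exact H.σ_pos
  · norm_num
  · norm_num
  · exact hC
  · intro t ht m n
    induction n with
    | zero => simp
    | succ n ih =>
      set M := Real.exp (1 + |c|)
      set L : List ℕ → ℝ := fun l => Real.exp (t * (Real.log (qv l).1 - c * (m+n:ℕ) - (Real.log (qv (l.drop n)).1 - c * m))) with hL
      have e1 : ∀ x, Real.exp (t * (SS c (m+n) x - SS c m x)) = L (hist (m+n) x) := by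
        intro x; simp only [hL, hist_drop, SS]
      simp_rw [e1] at ih
      have := integrable_step (E := ℝ) (m+n) (F := fun l j => L l * Real.exp (t * (Real.log (j+1+yv l) - c))) (G := fun l => L l * M) (ih.mul_const M)
        (by
          intro l j
          have hL0 : 0 < L l := Real.exp_pos _
          rw [Real.norm_of_nonneg (by positivity), mul_assoc]
          exact mul_le_mul_of_nonneg_left (exp_log_bound ht c (yv_mem l) j) hL0.le)
      refine this.congr (ae_of_all _ fun x => ?_)
      simp only
      rw [← e1, ← Real.exp_add, ← add_assoc, SS_succ]; congr 1; ring
  · intro t ht n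
    set F : List ℕ → ℕ → ℝ := fun l j => Real.exp (t * (Real.log (j+1+yv l) - c + h (nx (yv l) j) - h (yv l)) + t^2/2 * (w (nx (yv l) j) - w (yv l))) with hF
    have e : (fun x => Real.exp (t * (SS c (n+1) x - SS c n x + h (yv (hist (n+1) x)) - h (yv (hist n x)))
      + t^2/2 * (w (yv (hist (n+1) x)) - w (yv (hist n x))))) = fun x => F (hist n x) (dig n x) := by
      funext x
      simp only [hF]
      rw [SS_succ, hist, yv_cons, nx]; congr 2; ring
    simp only [e]
    have ht2 : t^2 ≤ 1 := by
      rw [← sq_abs]; have := abs_nonneg t; nlinarith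
    have hFint : Integrable (fun x => F (hist n x) (dig n x)) lam := by
      refine integrable_step (E := ℝ) n (G := fun _ => Real.exp (2*b) * Real.exp (1+|c|)) (integrable_const _) ?_
      intro l j
      have := exp_log_bound ht c (yv_mem l) j
      have hy := yv_mem l
      have hm := nx_mem hy.1 j
      rw [Real.norm_of_nonneg (Real.exp_pos _).le, mul_assoc]
      refine le_trans ?_ (mul_le_mul_of_nonneg_left this (Real.exp_pos _).le)
      rw [← Real.exp_add, Real.exp_le_exp]
      have k1 : t * (h (nx (yv l) j) - h (yv l)) ≤ b := by
        refine (le_abs_self _).trans ?_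
        rw [abs_mul]
        have : |h (nx (yv l) j) - h (yv l)| ≤ 2*b := (abs_sub _ _).trans (by linarith [H.h_bd _ hm, H.h_bd _ hy])
        calc _ ≤ 1/4 * (2*b) := mul_le_mul ht this (abs_nonneg _) (by norm_num)
          _ ≤ b := by linarith
      have k2 : t^2/2 * (w (nx (yv l) j) - w (yv l)) ≤ b := by
        refine (le_abs_self _).trans ?_
        rw [abs_mul, abs_of_nonneg (by positivity)]
        have : |w (nx (yv l) j) - w (yv l)| ≤ 2*b := (abs_sub _ _).trans (by linarith [H.w_bd _ hm, H.w_bd _ hy])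
        calc _ ≤ 1/2 * (2*b) := mul_le_mul (by linarith) this (abs_nonneg _) (by norm_num)
          _ = b := by ring
      linarith
    have hce := condExp_step n hFint
    filter_upwards [hce] with x hx
    have hx' : (lam[fun x => F (hist n x) (dig n x) | (FF n)]) x = ∑' j, wt (yv (hist n x)) j * F (hist n x) j := hx
    rw [hx']
    have := hexp (t:ℂ) (by rw [Complex.norm_real]; exact ht) (yv (hist n x)) (yv_mem _)
    rw [Complex.norm_real, Real.norm_eq_abs] at this
    refine le_trans (le_of_eq ?_) this
    rw [← Real.norm_eq_abs, ← Complex.norm_real]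
    congr 1
    rw [Complex.ofReal_sub, Complex.ofReal_tsum]
    congr 1
    · refine tsum_congr fun j => ?_
      rw [Complex.ofReal_mul, hF]
      simp only [ZZ, Complex.ofReal_exp]
      congr 2; push_cast; ring
    · push_cast; ring

end GK

namespace GK
open ProbabilityTheory

noncomputable def Zf (c : ℝ) (h w : ℝ → ℝ) (u : ℝ) (n : ℕ) (l : List ℕ) : ℂ :=
  Complex.exp (((u * (Real.log (qv l).1 - c * n) : ℝ) : ℂ) * Complex.I) *
    Complex.exp (((u * h (yv l) : ℝ):ℂ) * Complex.I - ((u^2/2 * w (yv l) : ℝ):ℂ))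

lemma Zf_norm {c σ b : ℝ} {h w : ℝ → ℝ} (H : OpData c σ b h w) {u : ℝ} (hu : |u| ≤ 1/4) (n : ℕ) (l : List ℕ) :
    ‖Zf c h w u n l‖ ≤ Real.exp b := by
  rw [Zf, norm_mul, Complex.norm_exp_ofReal_mul_I, one_mul, Complex.norm_exp, Real.exp_le_exp]
  have h1 := abs_le.1 (H.w_bd _ (yv_mem l))
  have hb := H.b_ge
  have hu2 : u^2 ≤ 1 := by rw [← sq_abs]; have := abs_nonneg u; nlinarith
  have e : (((u * h (yv l) : ℝ):ℂ) * Complex.I - ((u^2/2 * w (yv l) : ℝ):ℂ)).re = - (u^2/2 * w (yv l)) := by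
    rw [Complex.sub_re, Complex.re_ofReal_mul, Complex.I_re, Complex.ofReal_re]; ring
  rw [e]
  nlinarith [sq_nonneg u]

lemma Zf_int {c σ b : ℝ} {h w : ℝ → ℝ} (H : OpData c σ b h w) {u : ℝ} (hu : |u| ≤ 1/4) (n : ℕ) :
    Integrable (fun x => Zf c h w u n (hist n x)) lam := by
  refine Integrable.of_bound (C := Real.exp b) ?_ (ae_of_all _ fun x => Zf_norm H hu n _)
  exact ((Measurable.of_discrete (f := Zf c h w u n)).comp (hist_meas n)).aestronglyMeasurable

lemma Zf_cons (c : ℝ) (h w : ℝ → ℝ) (u : ℝ) (n : ℕ) (l : List ℕ) (j : ℕ) :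
    Zf c h w u (n+1) (j::l) = Zf c h w u n l * Complex.exp (ZZ c h w ((u:ℂ)*Complex.I) (yv l) j) := by
  rw [Zf, Zf, ZZ, log_q_cons, yv_cons, ← Complex.exp_add, ← Complex.exp_add, ← Complex.exp_add, nx]
  congr 1
  have : (Complex.I)^2 = -1 := Complex.I_sq
  push_cast
  ring_nf
  rw [this]; ring

lemma clt_step {c σ b : ℝ} {h w : ℝ → ℝ} (H : OpData c σ b h w) : ∃ C, 0 ≤ C ∧ ∀ u : ℝ, |u| ≤ 1/4 → ∀ n : ℕ,
    ‖∫ x, Zf c h w u (n+1) (hist (n+1) x) ∂lam - ((1 - u^2*σ^2/2 : ℝ):ℂ) * ∫ x, Zf c h w u n (hist n x) ∂lam‖ ≤ C * |u|^3 := by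
  obtain ⟨C, hC, hexp⟩ := H.expansion
  refine ⟨Real.exp b * C, by positivity, fun u hu n => ?_⟩
  set F : List ℕ → ℕ → ℂ := fun l j => Zf c h w u (n+1) (j::l)
  have e1 : (fun x => Zf c h w u (n+1) (hist (n+1) x)) = fun x => F (hist n x) (dig n x) := by
    funext x; rw [hist_succ_eq]
  have hint : Integrable (fun x => F (hist n x) (dig n x)) lam := by
    rw [← e1]; exact Zf_int H hu (n+1)
  rw [e1, integral_step n hint, ← integral_const_mul]
  have e2 : ∀ l, ∑' j, wt (yv l) j • F l j = Zf c h w u n l * ∑' j, (wt (yv l) j:ℂ) * Complex.exp (ZZ c h w ((u:ℂ)*Complex.I) (yv l) j) := by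
    intro l
    rw [← tsum_mul_left]
    refine tsum_congr fun j => ?_
    simp only [F, Zf_cons, Complex.real_smul]; ring
  simp_rw [e2]
  have key : ∀ l, ‖Zf c h w u n l * ∑' j, (wt (yv l) j:ℂ) * Complex.exp (ZZ c h w ((u:ℂ)*Complex.I) (yv l) j)
      - ((1 - u^2*σ^2/2 : ℝ):ℂ) * Zf c h w u n l‖ ≤ Real.exp b * C * |u|^3 := by
    intro l
    have hn : ‖(u:ℂ) * Complex.I‖ = |u| := by simp
    have h1 := hexp ((u:ℂ)*Complex.I) (by rw [hn]; exact hu) (yv l) (yv_mem l)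
    rw [hn] at h1
    have e3 : (1 + ((u:ℂ)*Complex.I)^2*(σ:ℂ)^2/2) = ((1 - u^2*σ^2/2 : ℝ):ℂ) := by
      rw [mul_pow, Complex.I_sq]; push_cast; ring
    rw [e3] at h1
    rw [mul_comm (((1 - u^2*σ^2/2 : ℝ):ℂ)), ← mul_sub, norm_mul, mul_assoc]
    exact mul_le_mul (Zf_norm H hu n l) h1 (norm_nonneg _) (Real.exp_pos _).le
  have hZ := Zf_int H hu n
  have hm1 : Integrable (fun x => Zf c h w u n (hist n x) * ∑' j, (wt (yv (hist n x)) j:ℂ) * Complex.exp (ZZ c h w ((u:ℂ)*Complex.I) (yv (hist n x)) j)) lam := by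
    have hd : Integrable (fun x => Zf c h w u n (hist n x) * ∑' j, (wt (yv (hist n x)) j:ℂ) * Complex.exp (ZZ c h w ((u:ℂ)*Complex.I) (yv (hist n x)) j) - ((1 - u^2*σ^2/2 : ℝ):ℂ) * Zf c h w u n (hist n x)) lam := by
      refine Integrable.of_bound (C := Real.exp b * C * |u|^3) ?_ (ae_of_all _ fun x => key _)
      exact ((Measurable.of_discrete (f := fun l => Zf c h w u n l * ∑' j, (wt (yv l) j:ℂ) * Complex.exp (ZZ c h w ((u:ℂ)*Complex.I) (yv l) j) - ((1 - u^2*σ^2/2 : ℝ):ℂ) * Zf c h w u n l)).comp (hist_meas n)).aestronglyMeasurable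
    refine (hd.add (hZ.const_mul ((1 - u^2*σ^2/2 : ℝ):ℂ))).congr (ae_of_all _ fun x => ?_)
    simp
  rw [← integral_sub hm1 (hZ.const_mul _)]
  have := norm_integral_le_of_norm_le_const (μ := lam) (ae_of_all _ fun x => key (hist n x))
  simpa using this

lemma clt_char {c σ b : ℝ} {h w : ℝ → ℝ} (H : OpData c σ b h w) : ∃ C, 0 ≤ C ∧ ∀ u : ℝ, |u| ≤ 1/4 → |u| * (2*b) ≤ 1 → u^2*σ^2 ≤ 2 →
    ∀ n : ℕ, ‖∫ x, Complex.exp (((u * SS c n x : ℝ):ℂ) * Complex.I) ∂lam - ((1 - u^2*σ^2/2 : ℝ):ℂ)^n‖ ≤ C * n * |u|^3 + 8 * b * |u| := by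
  obtain ⟨C, hC, hs⟩ := clt_step H
  refine ⟨C, hC, fun u hu hub hus n => ?_⟩
  have hb := H.b_ge
  set a : ℂ := ((1 - u^2*σ^2/2 : ℝ):ℂ) with ha
  have ha1 : ‖a‖ ≤ 1 := by
    rw [ha, Complex.norm_real, Real.norm_eq_abs, abs_le]
    constructor <;> nlinarith [mul_nonneg (sq_nonneg u) (sq_nonneg σ)]
  have hit : ∀ n : ℕ, ‖∫ x, Zf c h w u n (hist n x) ∂lam - a^n * ∫ x, Zf c h w u 0 (hist 0 x) ∂lam‖ ≤ C * n * |u|^3 := by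
    intro n
    induction n with
    | zero => simp
    | succ n ih =>
      have e : ∫ x, Zf c h w u (n+1) (hist (n+1) x) ∂lam - a^(n+1) * ∫ x, Zf c h w u 0 (hist 0 x) ∂lam
        = (∫ x, Zf c h w u (n+1) (hist (n+1) x) ∂lam - a * ∫ x, Zf c h w u n (hist n x) ∂lam) +
          a * (∫ x, Zf c h w u n (hist n x) ∂lam - a^n * ∫ x, Zf c h w u 0 (hist 0 x) ∂lam) := by ring
      rw [e]
      refine (norm_add_le _ _).trans ?_
      have h1 := hs u hu n
      have h2 : ‖a * (∫ x, Zf c h w u n (hist n x) ∂lam - a^n * ∫ x, Zf c h w u 0 (hist 0 x) ∂lam)‖ ≤ C * n * |u|^3 := by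
        rw [norm_mul]
        calc _ ≤ 1 * (C * n * |u|^3) := mul_le_mul ha1 ih (norm_nonneg _) zero_le_one
          _ = _ := one_mul _
      push_cast
      linarith
  have hdiff : ∀ n : ℕ, ‖∫ x, Zf c h w u n (hist n x) ∂lam - ∫ x, Complex.exp (((u * SS c n x : ℝ):ℂ) * Complex.I) ∂lam‖ ≤ 4 * b * |u| := by
    intro n
    have hi2 : Integrable (fun x => Complex.exp (((u * SS c n x : ℝ):ℂ) * Complex.I)) lam := by
      refine Integrable.of_bound (C := 1) ?_ (ae_of_all _ fun x => by rw [Complex.norm_exp_ofReal_mul_I])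
      exact ((Measurable.of_discrete (f := fun l => Complex.exp (((u * (Real.log (qv l).1 - c * n) : ℝ):ℂ) * Complex.I))).comp (hist_meas n)).aestronglyMeasurable
    rw [← integral_sub (Zf_int H hu n) hi2]
    have key : ∀ x, ‖Zf c h w u n (hist n x) - Complex.exp (((u * SS c n x : ℝ):ℂ) * Complex.I)‖ ≤ 4 * b * |u| := by
      intro x
      set z : ℂ := ((u * h (yv (hist n x)) : ℝ):ℂ) * Complex.I - ((u^2/2 * w (yv (hist n x)) : ℝ):ℂ) with hz
      have hz1 : ‖z‖ ≤ 2 * b * |u| := by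
        rw [hz]
        refine (norm_sub_le _ _).trans ?_
        rw [norm_mul, Complex.norm_I, mul_one, Complex.norm_real, Complex.norm_real, Real.norm_eq_abs, Real.norm_eq_abs, abs_mul, abs_mul]
        have h1 := H.h_bd _ (yv_mem (hist n x))
        have h2 := H.w_bd _ (yv_mem (hist n x))
        have h3 : |u^2/2| ≤ |u| := by
          rw [abs_of_nonneg (by positivity), ← sq_abs]; nlinarith [abs_nonneg u]
        have k1 := mul_le_mul_of_nonneg_left h1 (abs_nonneg u)
        have k2 := mul_le_mul h3 h2 (abs_nonneg _) (abs_nonneg _)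
        linarith
      have e : Zf c h w u n (hist n x) - Complex.exp (((u * SS c n x : ℝ):ℂ) * Complex.I) = Complex.exp (((u * SS c n x : ℝ):ℂ) * Complex.I) * (Complex.exp z - 1) := by
        rw [mul_sub, mul_one, Zf, SS]
      rw [e, norm_mul, Complex.norm_exp_ofReal_mul_I, one_mul]
      have := Complex.norm_exp_sub_one_le (x := z) (by linarith)
      linarith
    have := norm_integral_le_of_norm_le_const (μ := lam) (ae_of_all _ key)
    simpa using this
  have h0 := hdiff 0
  have hn := hdiff n
  have e0 : ∫ x, Complex.exp (((u * SS c 0 x : ℝ):ℂ) * Complex.I) ∂lam = 1 := by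
    have : ∀ x, SS c 0 x = 0 := by intro x; simp [SS, hist, qv]
    simp [this]
  rw [e0] at h0
  have e : ∫ x, Complex.exp (((u * SS c n x : ℝ):ℂ) * Complex.I) ∂lam - a^n =
    -(∫ x, Zf c h w u n (hist n x) ∂lam - ∫ x, Complex.exp (((u * SS c n x : ℝ):ℂ) * Complex.I) ∂lam)
    + ((∫ x, Zf c h w u n (hist n x) ∂lam - a^n * ∫ x, Zf c h w u 0 (hist 0 x) ∂lam)
    + a^n * (∫ x, Zf c h w u 0 (hist 0 x) ∂lam - 1)) := by ring
  rw [e]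
  refine (norm_add_le _ _).trans ?_
  rw [norm_neg]
  have h2 := norm_add_le (∫ x, Zf c h w u n (hist n x) ∂lam - a^n * ∫ x, Zf c h w u 0 (hist 0 x) ∂lam) (a^n * (∫ x, Zf c h w u 0 (hist 0 x) ∂lam - 1))
  have h3 : ‖a^n * (∫ x, Zf c h w u 0 (hist 0 x) ∂lam - 1)‖ ≤ 4 * b * |u| := by
    rw [norm_mul, norm_pow]
    calc _ ≤ 1 * (4 * b * |u|) := mul_le_mul (pow_le_one₀ (norm_nonneg _) ha1) h0 (norm_nonneg _) zero_le_one
      _ = _ := one_mul _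
  linarith [hit n]

lemma clt_char_tendsto {c σ b : ℝ} {h w : ℝ → ℝ} (H : OpData c σ b h w) (s : ℝ) :
    Tendsto (fun n : ℕ => ∫ x, Complex.exp (((s * (SS c n x / (σ * Real.sqrt n)) : ℝ):ℂ) * Complex.I) ∂lam) atTop (nhds (Complex.exp (-s^2/2))) := by
  obtain ⟨C, hC, hs⟩ := clt_char H
  have hσ := H.σ_pos
  have hsq : Tendsto (fun n : ℕ => Real.sqrt n) atTop atTop := Real.tendsto_sqrt_atTop.comp tendsto_natCast_atTop_atTop
  set u : ℕ → ℝ := fun n => s / (σ * Real.sqrt n) with hu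
  have hu0 : Tendsto u atTop (nhds 0) := tendsto_const_nhds.div_atTop (hsq.const_mul_atTop hσ)
  have hua : Tendsto (fun n => |u n|) atTop (nhds 0) := by simpa using hu0.abs
  have hus : ∀ n : ℕ, 0 < n → (u n)^2 * σ^2 = s^2/n := by
    intro n hn
    have : (0:ℝ) < n := by exact_mod_cast hn
    simp only [hu]
    rw [div_pow, mul_pow, Real.sq_sqrt this.le]; field_simp
  have hlim1 : Tendsto (fun n : ℕ => ((1 - (u n)^2*σ^2/2 : ℝ):ℂ)^n) atTop (nhds (Complex.exp (-s^2/2))) := by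
    have := Complex.tendsto_one_add_div_pow_exp (-(s:ℂ)^2/2)
    refine this.congr' ?_
    filter_upwards [eventually_gt_atTop 0] with n hn
    rw [hus n hn]; congr 1; push_cast; ring
  have hlim2 : Tendsto (fun n : ℕ => C * n * |u n|^3 + 8 * b * |u n|) atTop (nhds 0) := by
    have h1 : Tendsto (fun n : ℕ => C * (s^2/σ^2) * |u n| + 8*b*|u n|) atTop (nhds 0) := by
      simpa using (hua.const_mul (C * (s^2/σ^2))).add (hua.const_mul (8*b))
    refine h1.congr' ?_
    filter_upwards [eventually_gt_atTop 0] with n hn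
    have h2 := hus n hn
    have hn' : (0:ℝ) < n := by exact_mod_cast hn
    have h3 : (n:ℝ) * |u n|^2 = s^2/σ^2 := by
      rw [sq_abs]; field_simp at h2 ⊢; linarith
    congr 1
    rw [← h3]; ring
  have hdist : Tendsto (fun n : ℕ => ∫ x, Complex.exp (((s * (SS c n x / (σ * Real.sqrt n)) : ℝ):ℂ) * Complex.I) ∂lam - ((1 - (u n)^2*σ^2/2 : ℝ):ℂ)^n) atTop (nhds 0) := by
    refine squeeze_zero_norm' ?_ hlim2
    have v1 := hua.eventually (ge_mem_nhds (by norm_num : (0:ℝ) < 1/4))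
    have v2 := (by simpa using hua.mul_const (2*b) : Tendsto (fun n => |u n| * (2*b)) atTop (nhds 0)).eventually (ge_mem_nhds (by norm_num : (0:ℝ) < 1))
    have v3 := (by simpa using (hu0.pow 2).mul_const (σ^2) : Tendsto (fun n => (u n)^2 * σ^2) atTop (nhds 0)).eventually (ge_mem_nhds (by norm_num : (0:ℝ) < 2))
    filter_upwards [v1, v2, v3] with n k1 k2 k3
    have := hs (u n) k1 k2 k3 n
    refine le_trans (le_of_eq ?_) this
    have e : ∀ x, s * (SS c n x / (σ * Real.sqrt n)) = u n * SS c n x := by intro x; simp only [hu]; ring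
    simp_rw [e]
  simpa using hdist.add hlim1

lemma SS_meas (c : ℝ) (n : ℕ) : Measurable (SS c n) :=
  (Measurable.of_discrete (f := fun l => Real.log (qv l).1 - c * n)).comp (hist_meas n)

theorem clt {c σ b : ℝ} {h w : ℝ → ℝ} (H : OpData c σ b h w) (y : ℝ) :
    Tendsto (fun n : ℕ => (volume {x ∈ Set.Ico (0:ℝ) 1 | (Real.log (cfQ x n) - c * n) / (σ * Real.sqrt n) ≤ y}).toReal) atTop
      (nhds ((1 / Real.sqrt (2 * Real.pi)) * ∫ t in Set.Iic y, Real.exp (-t ^ 2 / 2))) := by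
  set X : ℕ → ℝ → ℝ := fun n x => SS c n x / (σ * Real.sqrt n) with hX
  have hXm : ∀ n, Measurable (X n) := fun n => (SS_meas c n).div_const _
  set P : ℕ → ProbabilityMeasure ℝ := fun n => ⟨lam.map (X n), Measure.isProbabilityMeasure_map (hXm n).aemeasurable⟩ with hP
  set G : ProbabilityMeasure ℝ := ⟨gaussianReal 0 1, inferInstance⟩ with hG
  have hPG : Tendsto P atTop (nhds G) := by
    refine ProbabilityMeasure.tendsto_iff_tendsto_charFun.2 fun s => ?_
    have := clt_char_tendsto H s
    have e2 : charFun (G : Measure ℝ) s = Complex.exp (-s^2/2) := by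
      show charFun (gaussianReal 0 1) s = _
      rw [charFun_gaussianReal]; congr 1; simp; ring
    rw [e2]
    refine this.congr fun n => ?_
    show _ = charFun (lam.map (X n)) s
    rw [charFun_apply_real, integral_map (hXm n).aemeasurable (by fun_prop)]
    refine integral_congr_ae (ae_of_all _ fun x => ?_)
    simp only [hX]; push_cast; rfl
  have hfr : G (frontier (Iic y)) = 0 := by
    rw [frontier_Iic]
    have : gaussianReal 0 1 {y} = 0 := (gaussianReal_absolutelyContinuous 0 (by norm_num)) (measure_singleton y)
    simp [hG, this]
  have hlim := ProbabilityMeasure.tendsto_measure_of_null_frontier_of_tendsto hPG hfr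
  have e1 : ((G (Iic y) : NNReal) : ℝ) = (1 / Real.sqrt (2 * Real.pi)) * ∫ t in Set.Iic y, Real.exp (-t ^ 2 / 2) := by
    have : ((G (Iic y) : NNReal) : ℝ) = (gaussianReal 0 1 (Iic y)).toReal := rfl
    rw [this, gaussianReal_apply_eq_integral 0 (by norm_num), ENNReal.toReal_ofReal (integral_nonneg fun t => gaussianPDFReal_nonneg _ _ _), ← integral_const_mul]
    refine integral_congr_ae (ae_of_all _ fun t => ?_)
    simp [gaussianPDFReal]
  rw [← e1]
  have hlim' : Tendsto (fun n => ((P n (Iic y) : NNReal) : ℝ)) atTop (nhds ((G (Iic y) : NNReal) : ℝ)) :=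
    (NNReal.continuous_coe.tendsto _).comp hlim
  refine hlim'.congr fun n => ?_
  have : ((P n (Iic y) : NNReal) : ℝ) = (lam.map (X n) (Iic y)).toReal := rfl
  rw [this, Measure.map_apply (hXm n) measurableSet_Iic]
  congr 1
  have e3 : lam (X n ⁻¹' Iic y) = lam {x ∈ Set.Ico (0:ℝ) 1 | (Real.log (cfQ x n) - c * n) / (σ * Real.sqrt n) ≤ y} := by
    refine measure_congr ?_
    filter_upwards [ae_irr] with x hx
    apply propext
    show X n x ≤ y ↔ (x ∈ Set.Ico (0:ℝ) 1 ∧ _)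
    rw [(cfQ_eq hx.1 hx.2 n).1]
    simp only [hX, SS]
    exact ⟨fun h => ⟨hx.2, h⟩, fun h => h.2⟩
  rw [e3, lam, Measure.restrict_apply' measurableSet_Ico]
  congr 1
  ext x; simp only [mem_inter_iff, mem_setOf_eq]; tauto

end GK

namespace GK

lemma bt_mem (β y : ℝ) : betaT β y ∈ Ico (0:ℝ) 1 := ⟨Int.fract_nonneg _, Int.fract_lt_one _⟩

lemma bt_iter_mem (β : ℝ) {y : ℝ} (hy : y ∈ Ico (0:ℝ) 1) (n : ℕ) : (betaT β)^[n] y ∈ Ico (0:ℝ) 1 := by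
  cases n with
  | zero => exact hy
  | succ n => rw [Function.iterate_succ_apply']; exact bt_mem _ _

lemma bt_meas (β : ℝ) : Measurable (betaT β) := by
  have : betaT β = fun x => Int.fract (β * x) := rfl
  rw [this]; exact measurable_fract.comp (measurable_const_mul β)

lemma bt_shift {β : ℝ} (hβ : 1 < β) (n : ℕ) : ∀ {y s : ℝ}, y ∈ Ico (0:ℝ) 1 → 0 ≤ s → s ≤ (betaT β)^[n] y →
    y - s / β^n ∈ Ico (0:ℝ) 1 ∧ (betaT β)^[n] (y - s/β^n) = (betaT β)^[n] y - s ∧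
    ∀ i, 1 ≤ i → i ≤ n → betaEps β i (y - s/β^n) = betaEps β i y := by
  have hβ0 : 0 < β := by linarith
  induction n with
  | zero =>
    intro y s hy hs hs2
    simp only [Function.iterate_zero, id, pow_zero, div_one] at *
    refine ⟨⟨by linarith, by linarith [hy.2]⟩, trivial, fun i h1 h2 => by omega⟩
  | succ n ih =>
    intro y s hy hs hs2
    rw [Function.iterate_succ_apply'] at hs2
    set z := (betaT β)^[n] y with hz
    have hz1 := bt_iter_mem β hy n
    rw [← hz] at hz1
    have hfl : (0:ℝ) ≤ ⌊β * z⌋ := by exact_mod_cast Int.floor_nonneg.2 (mul_nonneg hβ0.le hz1.1)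
    have hs3 : s / β ≤ z := by
      rw [div_le_iff₀ hβ0]; unfold betaT at hs2; nlinarith
    obtain ⟨i1, i2, i3⟩ := ih (y := y) (s := s/β) hy (by positivity) hs3
    have e : y - s/β/β^n = y - s/β^(n+1) := by rw [div_div, pow_succ']
    rw [e] at i1 i2 i3
    rw [← hz] at i2
    have e2 : β * (z - s/β) = β * z - s := by field_simp
    have hfe : ⌊β * (z - s/β)⌋ = ⌊β * z⌋ := by
      rw [e2, Int.floor_eq_iff]
      unfold betaT at hs2
      have := Int.lt_floor_add_one (β * z)
      constructor <;> linarith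
    refine ⟨i1, ?_, ?_⟩
    · rw [Function.iterate_succ_apply', Function.iterate_succ_apply', i2, ← hz]
      unfold betaT; rw [hfe, e2]; ring
    · intro i h1 h2
      rcases Nat.lt_or_ge n i with h | h
      · have : i = n+1 := by omega
        subst this
        unfold betaEps
        rw [Nat.add_sub_cancel, i2, ← hz, hfe]
      · exact i3 i h1 h

lemma betaCyl_low {β : ℝ} (hβ : 1 < β) (n : ℕ) {x : ℝ} (hx : x ∈ Ico (0:ℝ) 1) :
    x - (betaT β)^[n] x / β^n ∈ betaCyl β n x := by
  obtain ⟨h1, h2, h3⟩ := bt_shift hβ n hx (bt_iter_mem β hx n).1 le_rfl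
  exact ⟨h1, h3⟩

lemma betaCyl_eq {β : ℝ} (hβ : 1 < β) (n : ℕ) {x y : ℝ} (hy : ∀ i, 1 ≤ i → i ≤ n → betaEps β i y = betaEps β i x) :
    y - x = ((betaT β)^[n] y - (betaT β)^[n] x) / β^n := by
  have hβ0 : 0 < β := by linarith
  induction n with
  | zero => simp
  | succ n ih =>
    have := ih (fun i h1 h2 => hy i h1 (by omega))
    have h2 := hy (n+1) (by omega) le_rfl
    unfold betaEps at h2
    rw [Nat.add_sub_cancel] at h2
    rw [Function.iterate_succ_apply', Function.iterate_succ_apply', this]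
    unfold betaT
    unfold betaT at h2
    rw [h2, pow_succ]
    field_simp
    ring

lemma betaCyl_dist {β : ℝ} (hβ : 1 < β) (n : ℕ) {x y : ℝ} (hx : x ∈ Ico (0:ℝ) 1) (hy : y ∈ betaCyl β n x) :
    |y - x| ≤ 1 / β^n := by
  have hβ0 : 0 < β := by linarith
  rw [betaCyl_eq hβ n hy.2, abs_div, abs_of_pos (pow_pos hβ0 n)]
  have h1 := bt_iter_mem β hx n
  have h2 := bt_iter_mem β hy.1 n
  refine div_le_div_of_nonneg_right ?_ (pow_pos hβ0 n).le
  rw [abs_le]; constructor <;> linarith [h1.1, h1.2, h2.1, h2.2]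

lemma bt_E {β : ℝ} (hβ : 1 < β) (n : ℕ) {ε : ℝ} (h0 : 0 < ε) (h1 : ε ≤ 1) :
    lam {x | (betaT β)^[n+1] x < ε ∧ 1 ≤ β * (betaT β)^[n] x} ≤ ENNReal.ofReal (2 * ε) := by
  have hβ0 : 0 < β := by linarith
  have hmT : ∀ n, Measurable ((betaT β)^[n]) := fun n => (bt_meas β).iterate n
  set E := {x | (betaT β)^[n+1] x < ε ∧ 1 ≤ β * (betaT β)^[n] x} with hE
  have hEm : MeasurableSet E := (measurableSet_lt (hmT _) measurable_const).inter
    (measurableSet_le measurable_const ((hmT n).const_mul β))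
  set K := ⌊1/ε⌋₊ with hK
  have hK1 : (1:ℝ) ≤ K := by
    have : 1 ≤ K := Nat.le_floor (by rw [Nat.cast_one, le_div_iff₀ h0]; linarith)
    exact_mod_cast this
  have hK2 : K * ε ≤ 1 := by
    have := Nat.floor_le (by positivity : 0 ≤ 1/ε)
    rwa [le_div_iff₀ h0] at this
  have hK3 : 1 < (K+1) * ε := by
    have := Nat.lt_floor_add_one (1/ε)
    rwa [div_lt_iff₀ h0] at this
  set B : ℕ → Set ℝ := fun k => {x | (betaT β)^[n+1] x ∈ Ico (1 - (k+1)*ε) (1 - k*ε)} with hB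
  have hBm : ∀ k, MeasurableSet (B k) := fun k => (hmT _) measurableSet_Ico
  have hdisj : ∀ i j : ℕ, i < j → Disjoint (B i) (B j) := by
    intro i j hij
    rw [Set.disjoint_left]
    rintro x ⟨a1, a2⟩ ⟨b1, b2⟩
    have : (i:ℝ) + 1 ≤ j := by exact_mod_cast hij
    nlinarith
  have hpd : Pairwise (Function.onFun Disjoint B) := by
    intro i j hij
    rcases lt_or_gt_of_ne hij with h | h
    · exact hdisj i j h
    · exact (hdisj j i h).symm
  have hle : ∀ k < K, lam E ≤ lam (B k) := by
    intro k hk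
    have hk' : (k:ℝ) + 1 ≤ K := by exact_mod_cast hk
    set r := (k+1)*ε/β/β^n with hr
    rw [lam, Measure.restrict_apply hEm, Measure.restrict_apply (hBm k)]
    rw [← measure_preimage_add_right volume (-r) (B k ∩ Ico 0 1)]
    refine measure_mono ?_
    rintro x ⟨⟨x1, x2⟩, x3⟩
    have hke : (k+1)*ε ≤ 1 := by nlinarith
    obtain ⟨s1, s2, s3⟩ := bt_shift hβ n (y := x) (s := (k+1)*ε/β) x3 (by positivity)
      (by rw [div_le_iff₀ hβ0]; linarith)
    show x + -r ∈ B k ∩ Ico 0 1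
    rw [← sub_eq_add_neg]
    refine ⟨?_, s1⟩
    show (betaT β)^[n+1] (x - r) ∈ Ico (1 - (k+1)*ε) (1 - k*ε)
    rw [Function.iterate_succ_apply', s2]
    rw [Function.iterate_succ_apply'] at x1
    have hn0 := (bt_mem β ((betaT β)^[n] x)).1
    set z := (betaT β)^[n] x
    have e2 : β * (z - (k+1)*ε/β) = β * z - (k+1)*ε := by field_simp
    have hfe : ⌊β * (z - (k+1)*ε/β)⌋ = ⌊β * z⌋ - 1 := by
      rw [e2, Int.floor_eq_iff]
      unfold betaT at x1 hn0
      push_cast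
      constructor <;> nlinarith
    unfold betaT at x1 hn0 ⊢
    rw [hfe, e2]
    push_cast
    constructor <;> nlinarith
  have hsum : (K:ENNReal) * lam E ≤ 1 := by
    calc (K:ENNReal) * lam E = ∑ k ∈ Finset.range K, lam E := by simp
      _ ≤ ∑ k ∈ Finset.range K, lam (B k) := Finset.sum_le_sum fun k hk => hle k (Finset.mem_range.1 hk)
      _ = lam (⋃ k ∈ Finset.range K, B k) := (measure_biUnion_finset (fun i _ j _ hij => hpd hij) (fun k _ => hBm k)).symm
      _ ≤ 1 := prob_le_one
  have hr : (K:ℝ) * (lam E).toReal ≤ 1 := by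
    have := ENNReal.toReal_mono ENNReal.one_ne_top hsum
    simpa using this
  rw [← ENNReal.ofReal_toReal (measure_ne_top lam E)]
  refine ENNReal.ofReal_le_ofReal ?_
  have : (0:ℝ) ≤ (lam E).toReal := ENNReal.toReal_nonneg
  have h5 : 1 ≤ 2 * ε * K := by nlinarith
  nlinarith

lemma bt_small {β : ℝ} (hβ : 1 < β) (n : ℕ) : ∀ {ε : ℝ}, 0 < ε → ε ≤ 1 →
    lam {x | (betaT β)^[n] x < ε} ≤ ENNReal.ofReal (2*β/(β-1) * ε) := by
  have hβ0 : 0 < β := by linarith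
  have hβ1 : 0 < β - 1 := by linarith
  induction n with
  | zero =>
    intro ε h0 h1
    have : lam {x | (betaT β)^[0] x < ε} ≤ volume (Ico 0 ε) := by
      rw [lam, Measure.restrict_apply' measurableSet_Ico]
      refine measure_mono ?_
      rintro x ⟨h1, h2⟩
      exact ⟨h2.1, h1⟩
    refine this.trans ?_
    rw [Real.volume_Ico]
    refine ENNReal.ofReal_le_ofReal ?_
    have : 1 ≤ 2*β/(β-1) := by rw [le_div_iff₀ hβ1]; linarith
    nlinarith
  | succ n ih =>
    intro ε h0 h1
    have hsub : {x | (betaT β)^[n+1] x < ε} ∩ Ico 0 1 ⊆ {x | (betaT β)^[n] x < ε/β} ∪ {x | (betaT β)^[n+1] x < ε ∧ 1 ≤ β * (betaT β)^[n] x} := by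
      rintro x ⟨hx, hx2⟩
      rcases le_or_gt 1 (β * (betaT β)^[n] x) with h | h
      · right; exact ⟨hx, h⟩
      · left
        show (betaT β)^[n] x < ε/β
        have hx : (betaT β)^[n+1] x < ε := hx
        rw [Function.iterate_succ_apply'] at hx
        unfold betaT at hx h ⊢
        have hz := (bt_iter_mem β hx2 n).1
        unfold betaT at hz
        rw [Int.floor_eq_zero_iff.2 ⟨mul_nonneg hβ0.le hz, h⟩] at hx
        rw [lt_div_iff₀ hβ0]
        push_cast at hx
        linarith
    have e : lam {x | (betaT β)^[n+1] x < ε} ≤ lam ({x | (betaT β)^[n+1] x < ε} ∩ Ico 0 1) := by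
      rw [lam, Measure.restrict_apply' measurableSet_Ico, Measure.restrict_apply' measurableSet_Ico, inter_assoc, inter_self]
    have hεβ : ε/β ≤ 1 := by rw [div_le_iff₀ hβ0]; linarith
    calc _ ≤ _ := e
      _ ≤ _ := measure_mono hsub
      _ ≤ _ := measure_union_le _ _
      _ ≤ ENNReal.ofReal (2*β/(β-1) * (ε/β)) + ENNReal.ofReal (2*ε) := add_le_add (ih (by positivity) hεβ) (bt_E hβ n h0 h1)
      _ = ENNReal.ofReal (2*β/(β-1) * (ε/β) + (2*ε)) := (ENNReal.ofReal_add (by positivity) (by positivity)).symm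
      _ = _ := by congr 1; field_simp; ring

lemma summ_sq : Summable (fun n : ℕ => 1/((n:ℝ)+1)^2) := by
  have := (summable_nat_add_iff 1).2 (Real.summable_one_div_nat_pow.2 (by norm_num : 1 < 2))
  simpa using this

lemma bt_bc {β : ℝ} (hβ : 1 < β) : ∀ᵐ x ∂lam, ∀ᶠ n : ℕ in atTop, 1/((n:ℝ)+1)^2 ≤ (betaT β)^[n] x := by
  have := bc_helper (μ := lam) (E := fun n : ℕ => {x | (betaT β)^[n] x < 1/((n:ℝ)+1)^2}) (g := fun n : ℕ => 2*β/(β-1) * (1/((n:ℝ)+1)^2))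
    (summ_sq.mul_left _) (Eventually.of_forall fun n => bt_small hβ n (by positivity)
      (by rw [div_le_one (by positivity)]; have : (0:ℝ) ≤ n := by positivity
          nlinarith))
  filter_upwards [this] with x hx
  filter_upwards [hx] with n hn
  exact not_lt.1 hn

end GK

namespace GK

lemma dig_tail (n K : ℕ) : lam {x | K ≤ dig n x} ≤ ENNReal.ofReal (2/((K:ℝ)+1)) := by
  have hm : MeasurableSet {x | K ≤ dig n x} := (dig_meas n) (MeasurableSet.of_discrete (s := {j | K ≤ j}))
  set F : List ℕ → ℕ → ℝ := fun l j => if K ≤ j then 1 else 0 with hF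
  have hint : Integrable (fun x => F (hist n x) (dig n x)) lam := by
    refine integrable_step (E := ℝ) n (G := fun _ => 1) (integrable_const _) ?_
    intro l j
    have : (1:ℝ) ≤ Real.sqrt ((j:ℝ)+1) := Real.one_le_sqrt.2 (by linarith [(by positivity : (0:ℝ) ≤ j)])
    simp only [hF]
    split_ifs
    · simpa using this
    · simp
  have h1 := integral_step n hint
  have h2 : ∫ x, F (hist n x) (dig n x) ∂lam = (lam {x | K ≤ dig n x}).toReal := by
    have := integral_indicator_one (μ := lam) hm
    rw [Measure.real] at this
    rw [← this]
    refine integral_congr_ae (ae_of_all _ fun x => ?_)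
    simp [hF, Set.indicator, apply_ite]
  have key : ∀ y ∈ Icc (0:ℝ) 1, ∑' j, wt y j • (if K ≤ j then (1:ℝ) else 0) ≤ 2/((K:ℝ)+1) := by
    intro y hy
    have s1 := wt_hasSum hy.1
    have s2 : HasSum (fun j => if j ∈ Finset.range K then wt y j else 0) (∑ j ∈ Finset.range K, (if j ∈ Finset.range K then wt y j else 0)) :=
      hasSum_sum_of_ne_finset_zero (fun j hj => by rw [if_neg hj])
    have s3 := s1.sub s2
    have e : (fun j => wt y j • (if K ≤ j then (1:ℝ) else 0)) = fun j => wt y j - if j ∈ Finset.range K then wt y j else 0 := by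
      funext j
      by_cases hj : K ≤ j
      · have : ¬ j < K := by omega
        simp [hj, this]
      · have : j < K := by omega
        simp [hj, this]
    rw [e, s3.tsum_eq, Finset.sum_ite_mem, Finset.inter_self, wt_sum y hy.1]
    have hK : (0:ℝ) ≤ K := by positivity
    have := hy.1; have := hy.2
    rw [sub_sub_cancel, div_le_div_iff₀ (by positivity) (by positivity)]
    nlinarith
  have h3 : (lam {x | K ≤ dig n x}).toReal ≤ 2/((K:ℝ)+1) := by
    rw [← h2, h1]
    have := norm_integral_le_of_norm_le_const (μ := lam) (f := fun x => ∑' j, wt (yv (hist n x)) j • F (hist n x) j) (C := 2/((K:ℝ)+1)) (ae_of_all _ fun x => by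
      rw [Real.norm_of_nonneg (tsum_nonneg fun j => ?_)]
      · exact key _ (yv_mem _)
      · refine mul_nonneg (wt_nonneg (yv_mem _).1 j) ?_
        simp only [hF]; split_ifs <;> norm_num)
    refine (le_abs_self _).trans ?_
    simpa using this
  rw [← ENNReal.ofReal_toReal (measure_ne_top lam _)]
  exact ENNReal.ofReal_le_ofReal h3

lemma dig_bc : ∀ᵐ x ∂lam, ∀ᶠ n : ℕ in atTop, (dig n x : ℝ) ≤ ((n:ℝ)+1)^2 := by
  have := bc_helper (μ := lam) (E := fun n : ℕ => {x | (n+1)^2 ≤ dig n x}) (g := fun n : ℕ => 2 * (1/((n:ℝ)+1)^2))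
    (summ_sq.mul_left _) (Eventually.of_forall fun n => (dig_tail n ((n+1)^2)).trans (ENNReal.ofReal_le_ofReal (by
      push_cast
      rw [mul_one_div]
      exact div_le_div_of_nonneg_left (by norm_num) (by positivity) (by linarith))))
  filter_upwards [this] with x hx
  filter_upwards [hx] with n hn
  have : dig n x < (n+1)^2 := not_le.1 hn
  exact_mod_cast this.le

lemma cfCyl_dist {x z : ℝ} (hx : Irrational x) (hx' : x ∈ Ico (0:ℝ) 1) {m : ℕ} (hz : z ∈ cfCyl m x) :
    |x - z| ≤ 1/((qv (hist m x)).1)^2 := by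
  obtain ⟨h1, h2⟩ := (cfA_iff_hist hx hx' hz.1 m).1 hz.2
  have ez := ph_hist hz.1 h1
  rw [h2] at ez
  have ex := ph_hist hx' (n := m) (fun i _ => (gm_iter_Ioo hx hx' i).1.ne')
  have hu := gm_iter_mem hx' m
  have hv := gm_iter_mem hz.1 m
  set u := gaussMap^[m] x
  set v := gaussMap^[m] z
  set l := hist m x
  obtain ⟨q1, q2, q3⟩ := qv_bd l
  have hA : ∀ u : ℝ, u ∈ Ico (0:ℝ) 1 → 0 ≤ u / ((qv l).1 * ((qv l).1 + u * (qv l).2)) ∧ u / ((qv l).1 * ((qv l).1 + u * (qv l).2)) ≤ 1/((qv l).1)^2 := by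
    intro u hu
    have h0 := hu.1
    have : 0 ≤ u * (qv l).2 := by positivity
    constructor
    · positivity
    · have := hu.2
      exact div_le_div₀ zero_le_one this.le (by positivity) (by nlinarith)
  have e : x - z = (-1)^l.length * (u / ((qv l).1 * ((qv l).1 + u * (qv l).2)) - v / ((qv l).1 * ((qv l).1 + v * (qv l).2))) := by
    rw [mul_sub, ← ph_sub_zero l hu.1, ← ph_sub_zero l hv.1, ← ex, ← ez]; ring
  rw [e, abs_mul, abs_pow, abs_neg, abs_one, one_pow, one_mul, abs_le]
  obtain ⟨a1, a2⟩ := hA u hu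
  obtain ⟨b1, b2⟩ := hA v hv
  constructor <;> linarith

lemma cfCyl_inner {x y : ℝ} (hx : Irrational x) (hx' : x ∈ Ico (0:ℝ) 1) {m : ℕ} {d : ℝ} (hd1 : d ≤ gaussMap^[m] x)
    (hd2 : d ≤ 1 - gaussMap^[m] x) (hy : |y - x| < d / (4 * ((qv (hist m x)).1)^2)) : y ∈ cfCyl m x := by
  have ex := ph_hist hx' (n := m) (fun i _ => (gm_iter_Ioo hx hx' i).1.ne')
  have hu := gm_iter_Ioo hx hx' m
  have hl := hist_length m x
  set u := gaussMap^[m] x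
  set l := hist m x with hlx
  obtain ⟨q1, q2, q3⟩ := qv_bd l
  have h1 := ph_sub_zero l hu.1.le
  have h2 := ph_one_sub l hu.1.le
  rw [← ex] at h1 h2
  have hqq : 0 ≤ u * (qv l).2 := mul_nonneg hu.1.le q2
  have hqq2 : u * (qv l).2 ≤ (qv l).1 := by nlinarith [hu.2]
  have hd : 0 < d := by
    by_contra hd
    push Not at hd
    have : d / (4 * ((qv l).1)^2) ≤ 0 := div_nonpos_of_nonpos_of_nonneg hd (by positivity)
    linarith [abs_nonneg (y-x)]
  have k1 : d / (4 * ((qv l).1)^2) ≤ u / ((qv l).1 * ((qv l).1 + u * (qv l).2)) := by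
    refine div_le_div₀ hu.1.le hd1 (by positivity) (by nlinarith)
  have k2 : d / (4 * ((qv l).1)^2) ≤ (1-u) / (((qv l).1 + (qv l).2) * ((qv l).1 + u * (qv l).2)) := by
    refine div_le_div₀ (by linarith [hu.2]) hd2 (by positivity) ?_
    calc _ ≤ (2 * (qv l).1) * (2 * (qv l).1) := mul_le_mul (by linarith) (by linarith) (by positivity) (by positivity)
      _ = _ := by ring
  obtain ⟨y1, y2⟩ := abs_lt.1 hy
  have hex : y ∈ ph l '' Ioo 0 1 := by
    rcases neg_one_pow_eq_or ℝ l.length with hs | hs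
    · rw [hs] at h1 h2
      exact intermediate_value_Ioo zero_le_one (ph_cont l) ⟨by linarith, by linarith⟩
    · rw [hs] at h1 h2
      exact intermediate_value_Ioo' zero_le_one (ph_cont l) ⟨by linarith, by linarith⟩
  obtain ⟨v, hv, rfl⟩ := hex
  have hmem := ph_mem_Ico l hv
  have hmem' : ph l v ∈ Ico (0:ℝ) 1 := ⟨hmem.1.le, hmem.2⟩
  obtain ⟨g1, g2⟩ := hist_ph l hv
  rw [hl] at g1 g2
  refine ⟨hmem', (cfA_iff_hist hx hx' hmem' m).2 ⟨?_, g1⟩⟩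
  intro i hi h0
  have h00 : ∀ k, gaussMap^[k] 0 = 0 := by
    intro k
    induction k with
    | zero => rfl
    | succ k ih => rw [Function.iterate_succ_apply', ih]; simp [gaussMap]
  have : gaussMap^[m] (ph l v) = 0 := by
    obtain ⟨k, rfl⟩ := Nat.exists_eq_add_of_lt hi
    have : i + k + 1 = (k+1) + i := by ring
    rw [this, Function.iterate_add_apply, h0, h00]
  rw [g2] at this
  exact hv.1.ne' this

lemma u_low {x : ℝ} (hx : Irrational x) (hx' : x ∈ Ico (0:ℝ) 1) {m : ℕ} {A : ℝ} (hA : 2 ≤ A)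
    (h1 : (dig m x : ℝ) ≤ A) (h2 : (dig (m+1) x : ℝ) ≤ A) :
    1/(4*A) ≤ gaussMap^[m] x ∧ 1/(4*A) ≤ 1 - gaussMap^[m] x := by
  have e1 := gm_rec (gm_iter_Ioo hx hx' m)
  have e2 := gm_rec (gm_iter_Ioo hx hx' (m+1))
  have u0 := gm_iter_Ioo hx hx' m
  have u1 := gm_iter_Ioo hx hx' (m+1)
  have u2 := gm_iter_Ioo hx hx' (m+1+1)
  set a := gaussMap^[m] x
  set b := gaussMap^[m+1] x
  set c := gaussMap^[m+1+1] x
  have hb : 1/(2*A) ≤ b := by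
    rw [e2]; exact one_div_le_one_div_of_le (by have := u2.1; positivity) (by linarith [u2.2])
  have hb' := u1.1
  constructor
  · rw [e1]; exact one_div_le_one_div_of_le (by positivity) (by linarith [u1.2])
  · have e3 : 1 - a = ((dig m x:ℝ) + b)/((dig m x:ℝ)+1+b) := by rw [e1]; field_simp; ring
    rw [e3]
    have h5 : 1/(4*A) = (1/(2*A))/2 := by field_simp; ring
    rw [h5, div_le_div_iff₀ (by norm_num) (by positivity)]
    have hj : (0:ℝ) ≤ dig m x := by positivity
    have hp : 0 < 1/(2*A) := by positivity
    have hp2 : 1/(2*A) ≤ 1 := by rw [div_le_one (by positivity)]; linarith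
    have hb1 := u1.2
    nlinarith

end GK

namespace GK

noncomputable def Lq (m : ℕ) (x : ℝ) : ℝ := Real.log (qv (hist m x)).1

lemma Lq_nonneg (m : ℕ) (x : ℝ) : 0 ≤ Lq m x := Real.log_nonneg (qv_bd _).1

lemma Lq_mono (x : ℝ) : Monotone (fun m => Lq m x) := by
  refine monotone_nat_of_le_succ fun m => ?_
  show Lq m x ≤ Lq (m+1) x
  rw [Lq, Lq, hist, log_q_cons]
  have := Real.log_nonneg (x := (dig m x:ℝ)+1+yv (hist m x)) (by linarith [(yv_mem (hist m x)).1, (by positivity : (0:ℝ) ≤ dig m x)])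
  linarith

lemma Lq_succ_le (m : ℕ) (x : ℝ) : Lq (m+1) x ≤ Lq m x + Real.log ((dig m x:ℝ)+2) := by
  rw [Lq, Lq, hist, log_q_cons]
  have := Real.log_le_log (x := (dig m x:ℝ)+1+yv (hist m x)) (y := (dig m x:ℝ)+2) (by have := (yv_mem (hist m x)).1; positivity) (by linarith [(yv_mem (hist m x)).2])
  linarith

lemma Lq_two (m : ℕ) (x : ℝ) : Lq m x + Real.log 2 ≤ Lq (m+2) x := by
  have h0 := qv_bd (hist m x)
  have e1 : (qv (hist (m+1) x)).1 = (dig m x + 1) * (qv (hist m x)).1 + (qv (hist m x)).2 := by rw [hist, qv]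
  have e2 : (qv (hist (m+2) x)).1 = (dig (m+1) x + 1) * (qv (hist (m+1) x)).1 + (qv (hist m x)).1 := by
    rw [hist, qv, hist, qv]
  have d0 : (0:ℝ) ≤ dig m x := by positivity
  have d1 : (0:ℝ) ≤ dig (m+1) x := by positivity
  obtain ⟨a, b, c⟩ := h0
  have h1 : (qv (hist m x)).1 ≤ (qv (hist (m+1) x)).1 := by rw [e1]; nlinarith
  rw [Lq, Lq, ← Real.log_mul (by linarith) (by norm_num)]
  refine Real.log_le_log (by linarith) ?_
  rw [e2]; nlinarith

lemma Lq_growth (x : ℝ) (k : ℕ) : ∀ d : ℕ, Lq k x + ((d:ℝ)-1)/2 * Real.log 2 ≤ Lq (k+d) x := by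
  have hl : 0 < Real.log 2 := Real.log_pos (by norm_num)
  intro d
  induction d using Nat.twoStepInduction with
  | zero => simp only [Nat.cast_zero, add_zero]; nlinarith
  | one =>
    have := Lq_mono x (Nat.le_succ k)
    simp only [Nat.cast_one, sub_self, zero_div, zero_mul, add_zero]; exact this
  | more d h1 h2 =>
    have := Lq_two (k+d) x
    rw [show k + (d+2) = k+d+2 by ring]
    push_cast
    linarith

lemma kCF_facts {β : ℝ} (hβ : 1 < β) {x : ℝ} (hx : Irrational x) (hx' : x ∈ Ico (0:ℝ) 1) {n : ℕ}
    (hT : 1/((n:ℝ)+1)^2 ≤ (betaT β)^[n] x) :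
    BddAbove {m | betaCyl β n x ⊆ cfCyl m x} ∧ 2 * Lq (kCF β n x) x ≤ n * Real.log β + 2 * Real.log ((n:ℝ)+1)
     ∧ ∃ y ∈ betaCyl β n x, y ∉ cfCyl (kCF β n x + 1) x := by
  have hβ0 : 0 < β := by linarith
  have hl : 0 < Real.log 2 := Real.log_pos (by norm_num)
  have hn : (0:ℝ) < (n:ℝ)+1 := by positivity
  have h1 : ∀ m, betaCyl β n x ⊆ cfCyl m x → 2 * Lq m x ≤ n * Real.log β + 2 * Real.log ((n:ℝ)+1) := by
    intro m hm
    have hd := cfCyl_dist hx hx' (hm (betaCyl_low hβ n hx'))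
    have hq := (qv_bd (hist m x)).1
    rw [sub_sub_cancel, abs_of_nonneg (div_nonneg (bt_iter_mem β hx' n).1 (by positivity))] at hd
    have hd2 : 1/((n:ℝ)+1)^2/β^n ≤ 1/((qv (hist m x)).1)^2 := (div_le_div_of_nonneg_right hT (by positivity)).trans hd
    rw [div_div] at hd2
    have hd3 := (one_div_le_one_div (by positivity) (by positivity)).1 hd2
    have := Real.log_le_log (by positivity) hd3
    rw [Real.log_mul (by positivity) (by positivity), Real.log_pow, Real.log_pow, Real.log_pow] at this
    rw [Lq]; push_cast at this; linarith
  have hb : BddAbove {m | betaCyl β n x ⊆ cfCyl m x} := by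
    refine ⟨⌈((n * Real.log β + 2 * Real.log ((n:ℝ)+1)))/Real.log 2 + 1⌉₊, ?_⟩
    intro m hm
    have h2 := h1 m hm
    have h3 := Lq_growth x 0 m
    rw [zero_add] at h3
    have h4 := Lq_nonneg 0 x
    have : (m:ℝ) ≤ ((n * Real.log β + 2 * Real.log ((n:ℝ)+1)))/Real.log 2 + 1 := by
      rw [← sub_le_iff_le_add, le_div_iff₀ hl]; linarith
    exact_mod_cast this.trans (Nat.le_ceil _)
  refine ⟨hb, ?_, ?_⟩
  · refine h1 _ (Nat.sSup_mem (s := {m | betaCyl β n x ⊆ cfCyl m x}) ⟨0, ?_⟩ hb)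
    intro y hy; exact ⟨hy.1, fun i h1 h2 => by omega⟩
  · by_contra hcon
    push Not at hcon
    have : kCF β n x + 1 ≤ kCF β n x := le_csSup hb hcon
    omega

lemma kCF_tendsto {β : ℝ} (hβ : 1 < β) {x : ℝ} (hx : Irrational x) (hx' : x ∈ Ico (0:ℝ) 1)
    (hT : ∀ᶠ n : ℕ in atTop, 1/((n:ℝ)+1)^2 ≤ (betaT β)^[n] x) : Tendsto (fun n => kCF β n x) atTop atTop := by
  have hβ0 : 0 < β := by linarith
  refine tendsto_atTop.2 fun M => ?_
  have hu := gm_iter_Ioo hx hx' M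
  set d := min (gaussMap^[M] x) (1 - gaussMap^[M] x) with hd
  have hd0 : 0 < d := lt_min hu.1 (by linarith [hu.2])
  have hq := (qv_bd (hist M x)).1
  have hlim : Tendsto (fun n : ℕ => (1/β)^n) atTop (nhds 0) := tendsto_pow_atTop_nhds_zero_of_lt_one (by positivity) (by rw [div_lt_one hβ0]; exact hβ)
  have hev := hlim.eventually (gt_mem_nhds (by positivity : 0 < d / (4 * ((qv (hist M x)).1)^2)))
  filter_upwards [hT, hev] with n h1 h2
  refine le_csSup (kCF_facts hβ hx hx' h1).1 ?_
  intro y hy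
  refine cfCyl_inner hx hx' (min_le_left _ _) (min_le_right _ _) (lt_of_le_of_lt (betaCyl_dist hβ n hx' hy) ?_)
  rwa [one_div_pow] at h2

lemma kCF_low {β : ℝ} (hβ : 1 < β) {x : ℝ} (hx : Irrational x) (hx' : x ∈ Ico (0:ℝ) 1) {n : ℕ}
    (hT : 1/((n:ℝ)+1)^2 ≤ (betaT β)^[n] x)
    (hD : ∀ m, kCF β n x ≤ m → (dig m x : ℝ) ≤ ((m:ℝ)+1)^2) :
    n * Real.log β ≤ 2 * Lq (kCF β n x) x + 6 * Real.log ((kCF β n x:ℝ) + 3) + Real.log 16 := by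
  have hβ0 : 0 < β := by linarith
  obtain ⟨-, -, y, hy, hy2⟩ := kCF_facts hβ hx hx' hT
  set k := kCF β n x with hk
  have hk0 : (0:ℝ) ≤ k := by positivity
  set A : ℝ := ((k:ℝ)+3)^2 with hA
  have hA2 : 2 ≤ A := by nlinarith
  have d0 := hD k le_rfl
  have d1 := hD (k+1) (by omega)
  have d2 := hD (k+1+1) (by omega)
  push_cast at d1 d2
  obtain ⟨u1, u2⟩ := u_low hx hx' (m := k+1) hA2 (by nlinarith) (by nlinarith)
  have hq := (qv_bd (hist (k+1) x)).1
  have h1 : 1/(4*A) / (4 * ((qv (hist (k+1) x)).1)^2) ≤ 1/β^n := by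
    by_contra hcon
    push Not at hcon
    exact hy2 (cfCyl_inner hx hx' u1 u2 (lt_of_le_of_lt (betaCyl_dist hβ n hx' hy) hcon))
  rw [div_div] at h1
  have h2 := (one_div_le_one_div (by positivity) (by positivity)).1 h1
  have h3 := Real.log_le_log (by positivity) h2
  have e : 4*A*(4 * ((qv (hist (k+1) x)).1)^2) = 16 * (((k:ℝ)+3)^2 * ((qv (hist (k+1) x)).1)^2) := by rw [hA]; ring
  rw [e, Real.log_mul (by positivity) (by positivity), Real.log_mul (by positivity) (by positivity), Real.log_pow, Real.log_pow, Real.log_pow] at h3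
  have h4 := Lq_succ_le k x
  have h5 : Real.log ((dig k x:ℝ)+2) ≤ 2 * Real.log ((k:ℝ)+3) := by
    rw [← Nat.cast_two, ← Real.log_pow]
    exact Real.log_le_log (by positivity) (by push_cast; nlinarith)
  push_cast at h3
  have h6 : Real.log (qv (hist (k+1) x)).1 = Lq (k+1) x := rfl
  rw [h6] at h3
  linarith

lemma Lq_upper {x : ℝ} (hD : ∀ᶠ n : ℕ in atTop, (dig n x : ℝ) ≤ ((n:ℝ)+1)^2) : ∃ C, 0 ≤ C ∧ ∀ᶠ m : ℕ in atTop, Lq m x ≤ C + ((m:ℝ)+3)^2 := by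
  obtain ⟨M, hM⟩ := eventually_atTop.1 hD
  refine ⟨Lq M x, Lq_nonneg _ _, eventually_atTop.2 ⟨M, fun m hm => ?_⟩⟩
  induction m, hm using Nat.le_induction with
  | base => nlinarith [sq_nonneg ((M:ℝ)+3)]
  | succ m hm ih =>
    have h1 := Lq_succ_le m x
    have h2 := hM m hm
    have hm0 : (0:ℝ) ≤ m := by positivity
    have h5 : Real.log ((dig m x:ℝ)+2) ≤ 2 * Real.log ((m:ℝ)+3) := by
      rw [← Nat.cast_two, ← Real.log_pow]
      exact Real.log_le_log (by positivity) (by push_cast; nlinarith)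
    have h6 := Real.log_le_sub_one_of_pos (by positivity : 0 < (m:ℝ)+3)
    push_cast
    nlinarith

lemma kCF_close {β : ℝ} (hβ : 1 < β) {x : ℝ} (hx : Irrational x) (hx' : x ∈ Ico (0:ℝ) 1) (c : ℝ)
    (hT : ∀ᶠ n : ℕ in atTop, 1/((n:ℝ)+1)^2 ≤ (betaT β)^[n] x)
    (hD : ∀ᶠ n : ℕ in atTop, (dig n x : ℝ) ≤ ((n:ℝ)+1)^2) :
    ∃ A B, 0 ≤ B ∧ ∀ᶠ n : ℕ in atTop, ∀ m, kCF β n x ≤ m → m ≤ kCF β (n+1) x →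
      |SS c m x - SS c (kCF β n x) x| ≤ A + B * Real.log ((kCF β n x : ℝ) + 3) := by
  have hl : 0 < Real.log 2 := Real.log_pos (by norm_num)
  have hlβ : 0 < Real.log β := Real.log_pos hβ
  have hkt := kCF_tendsto hβ hx hx' hT
  obtain ⟨C, hC, hCe⟩ := Lq_upper hD
  set D : ℝ := (2*C + 24)/Real.log β + 2 with hDdef
  have hD0 : 0 < D := by positivity
  set A1 : ℝ := Real.log β / 2 + Real.log D + Real.log 16 / 2 with hA1
  refine ⟨(1 + 2*|c|/Real.log 2) * A1 + |c|, (1 + 2*|c|/Real.log 2) * 5, by positivity, ?_⟩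
  have hD' : ∀ᶠ k : ℕ in atTop, ∀ m, k ≤ m → (dig m x : ℝ) ≤ ((m:ℝ)+1)^2 := by
    obtain ⟨M, hM⟩ := eventually_atTop.1 hD
    exact eventually_atTop.2 ⟨M, fun k hk m hm => hM m (hk.trans hm)⟩
  have hT1 := (tendsto_add_atTop_nat 1).eventually hT
  filter_upwards [hT, hT1, hkt.eventually hCe, hkt.eventually hD'] with n t0 t1 hc hd m hm1 hm2
  have low := kCF_low hβ hx hx' t0 hd
  have up := (kCF_facts hβ hx hx' t1).2.1
  have hmono := Lq_mono x hm2
  simp only at hmono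
  have hmono2 := Lq_mono x hm1
  simp only at hmono2
  set k := kCF β n x with hk
  have hk0 : (0:ℝ) ≤ k := by positivity
  have hlk : Real.log ((k:ℝ)+3) ≤ (k:ℝ)+3-1 := Real.log_le_sub_one_of_pos (by positivity)
  have h16 : Real.log 16 ≤ 16 - 1 := Real.log_le_sub_one_of_pos (by norm_num)
  have hn1 : (n:ℝ) + 2 ≤ D * ((k:ℝ)+3)^2 := by
    have g1 : (k:ℝ)+3 ≤ ((k:ℝ)+3)^2 := by nlinarith
    have g2 : (1:ℝ) ≤ ((k:ℝ)+3)^2 := by nlinarith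
    have g3 : C * 1 ≤ C * ((k:ℝ)+3)^2 := mul_le_mul_of_nonneg_left g2 hC
    have : (n:ℝ) * Real.log β ≤ (2*C+24) * ((k:ℝ)+3)^2 := by
      rw [add_mul]; linarith
    have h2 : (n:ℝ) ≤ (2*C+24)/Real.log β * ((k:ℝ)+3)^2 := by
      rw [div_mul_eq_mul_div, le_div_iff₀ hlβ]; exact this
    rw [hDdef]; nlinarith
  have hlog : Real.log ((n:ℝ)+2) ≤ Real.log D + 2 * Real.log ((k:ℝ)+3) := by
    have := Real.log_le_log (by positivity) hn1
    rw [Real.log_mul hD0.ne' (by positivity), Real.log_pow] at this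
    exact_mod_cast this
  push_cast at up
  have e1 : (n:ℝ)+1+1 = n+2 := by ring
  rw [e1] at up
  set R : ℝ := A1 + 5 * Real.log ((k:ℝ)+3) with hR
  have hR1 : Lq m x - Lq k x ≤ R := by rw [hR, hA1]; nlinarith
  obtain ⟨d, rfl⟩ := Nat.exists_eq_add_of_le hm1
  have hg := Lq_growth x k d
  have hd1 : (d:ℝ) ≤ 2*R/Real.log 2 + 1 := by
    rw [← sub_le_iff_le_add, le_div_iff₀ hl]; linarith
  have hd0 : (0:ℝ) ≤ d := by positivity
  have eS : SS c (k+d) x - SS c k x = (Lq (k+d) x - Lq k x) - c * d := by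
    simp only [SS, Lq]; push_cast; ring
  rw [eS]
  refine (abs_sub _ _).trans ?_
  rw [abs_mul, abs_of_nonneg (by linarith : 0 ≤ Lq (k+d) x - Lq k x), abs_of_nonneg hd0]
  have h7 := mul_le_mul_of_nonneg_left hd1 (abs_nonneg c)
  have e8 : (1 + 2*|c|/Real.log 2) * A1 + |c| + (1 + 2*|c|/Real.log 2) * 5 * Real.log ((k:ℝ)+3) = R + |c| * (2*R/Real.log 2 + 1) := by
    rw [hR]; field_simp; ring
  rw [e8]
  linarith

end GK

namespace GK

lemma phi_big {σ : ℝ} (hσ : 0 < σ) (A B : ℝ) (hB : 0 ≤ B) {ε : ℝ} (hε : 0 < ε) :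
    ∀ᶠ k : ℕ in atTop, A + B * Real.log ((k:ℝ)+3) ≤ ε * phi σ k ∧ 0 < phi σ k ∧ Real.exp 1 ≤ (k:ℝ) := by
  have h1 : (fun x : ℝ => (|A| + B * Real.log 2) + B * Real.log x) =o[atTop] fun x : ℝ => x^((1:ℝ)/2) := by
    refine Asymptotics.IsLittleO.add ?_ ((isLittleO_log_rpow_atTop (by norm_num)).const_mul_left B)
    rw [Asymptotics.isLittleO_const_left]
    right
    exact tendsto_norm_atTop_atTop.comp (tendsto_rpow_atTop (by norm_num))
  have h2 := h1.bound (mul_pos hε hσ)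
  have h3 : ∀ᶠ x : ℝ in atTop, (1:ℝ) ≤ Real.log (Real.log x) :=
    (Real.tendsto_log_atTop.comp Real.tendsto_log_atTop).eventually (eventually_ge_atTop 1)
  have h4 := h2.and (h3.and ((eventually_ge_atTop (3:ℝ)).and (eventually_ge_atTop (Real.exp 1))))
  filter_upwards [tendsto_natCast_atTop_atTop.eventually h4] with k hk
  obtain ⟨k1, k2, k3, k4⟩ := hk
  have hk0 : (0:ℝ) < k := by linarith
  have e : Real.sqrt (k:ℝ) = (k:ℝ)^((1:ℝ)/2) := Real.sqrt_eq_rpow _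
  have hs : 0 < Real.sqrt (k:ℝ) := Real.sqrt_pos.2 hk0
  have hphi : σ * Real.sqrt k ≤ phi σ k := by
    unfold phi
    refine mul_le_mul_of_nonneg_left (Real.sqrt_le_sqrt ?_) hσ.le
    nlinarith
  refine ⟨?_, lt_of_lt_of_le (by positivity) hphi, k4⟩
  have hl : Real.log ((k:ℝ)+3) ≤ Real.log 2 + Real.log k := by
    rw [← Real.log_mul (by norm_num) hk0.ne']
    exact Real.log_le_log (by positivity) (by linarith)
  have h5 := mul_le_mul_of_nonneg_left hl hB
  rw [← e, Real.norm_of_nonneg hs.le] at k1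
  have h6 := (le_abs_self _).trans k1
  have h7 := le_abs_self A
  have h8 := mul_le_mul_of_nonneg_left hphi hε.le
  linarith

lemma sub_lil {S : ℕ → ℝ} {k : ℕ → ℕ} {σ A B : ℝ} (hσ : 0 < σ) (hB : 0 ≤ B) (hk : Tendsto k atTop atTop)
    (hc : ∀ᶠ n in atTop, ∀ m, k n ≤ m → m ≤ k (n+1) → |S m - S (k n)| ≤ A + B * Real.log ((k n:ℝ)+3))
    (h : ∀ ε : ℝ, 0 < ε → (∀ᶠ n : ℕ in atTop, S n ≤ (1+ε) * phi σ n) ∧ ∃ᶠ n : ℕ in atTop, (1-ε) * phi σ n ≤ S n) :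
    ∀ ε : ℝ, 0 < ε → ε < 1 → (∀ᶠ n in atTop, S (k n) / phi σ (k n) ≤ 1+ε) ∧ ∃ᶠ n in atTop, 1-ε ≤ S (k n) / phi σ (k n) := by
  intro ε hε hε1
  constructor
  · filter_upwards [hk.eventually (h ε hε).1, hk.eventually (phi_big hσ 0 0 le_rfl hε)] with n h1 h2
    rw [div_le_iff₀ h2.2.1]; exact h1
  · rw [frequently_atTop]
    intro n0
    obtain ⟨n1, hn1⟩ := eventually_atTop.1 (hc.and (hk.eventually (phi_big hσ A B hB (half_pos hε))))
    set N0 := max n0 n1 with hN0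
    obtain ⟨m, hm1, hm2⟩ := frequently_atTop.1 (h (ε/2) (half_pos hε)).2 (k N0)
    have hex : ∃ N, N0 ≤ N ∧ m < k N := by
      obtain ⟨N1, hN1⟩ := eventually_atTop.1 (hk.eventually (eventually_gt_atTop m))
      exact ⟨max N0 N1, le_max_left _ _, hN1 _ (le_max_right _ _)⟩
    classical
    obtain ⟨f1, f2⟩ := Nat.find_spec hex
    have hmin := fun j (hj : j < Nat.find hex) => Nat.find_min hex hj
    set N := Nat.find hex with hN
    have hne : N ≠ N0 := by
      intro he; rw [he] at f2; omega
    obtain ⟨j, hj⟩ : ∃ j, N = j+1 := ⟨N-1, by omega⟩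
    have hj0 : N0 ≤ j := by omega
    have hkj : k j ≤ m := by
      by_contra hcon
      exact hmin j (by omega) ⟨hj0, by omega⟩
    rw [hj] at f2
    obtain ⟨c1, c2, c3, c4⟩ := hn1 j ((le_max_right _ _).trans hj0)
    refine ⟨j, (le_max_left _ _).trans hj0, ?_⟩
    have g1 := (abs_le.1 (c1 m hkj f2.le)).2
    have g2 := phi_mono hσ.le c4 (show ((k j:ℕ):ℝ) ≤ (m:ℝ) by exact_mod_cast hkj)
    rw [le_div_iff₀ c3]
    have g3 := mul_le_mul_of_nonneg_left g2 (by linarith : 0 ≤ 1 - ε/2)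
    linarith

lemma limsup_one {s : ℕ → ℝ} (h1 : ∀ ε : ℝ, 0 < ε → ε < 1 → (∀ᶠ n in atTop, s n ≤ 1+ε) ∧ ∃ᶠ n in atTop, 1-ε ≤ s n)
    (h2 : ∀ ε : ℝ, 0 < ε → ε < 1 → (∀ᶠ n in atTop, -s n ≤ 1+ε) ∧ ∃ᶠ n in atTop, 1-ε ≤ -s n) :
    limsup s atTop = 1 ∧ liminf s atTop = -1 := by
  have b1 : IsBoundedUnder (· ≤ ·) atTop s := ⟨1+1/2, by simpa using (h1 (1/2) (by norm_num) (by norm_num)).1⟩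
  have b2 : IsBoundedUnder (· ≥ ·) atTop s := ⟨-(1+1/2), by
    have := (h2 (1/2) (by norm_num) (by norm_num)).1
    simp only [ge_iff_le, eventually_map]
    filter_upwards [this] with n hn; linarith⟩
  constructor
  · refine le_antisymm ?_ ?_
    · refine le_of_forall_pos_le_add fun ε hε => ?_
      have hm : 0 < min ε (1/2) := lt_min hε (by norm_num)
      refine (limsup_le_of_le b2.isCoboundedUnder_le (h1 (min ε (1/2)) hm ((min_le_right _ _).trans_lt (by norm_num))).1).trans ?_
      linarith [min_le_left ε (1/2)]
    · refine le_of_forall_pos_le_add fun ε hε => ?_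
      have hm : 0 < min ε (1/2) := lt_min hε (by norm_num)
      have := le_limsup_of_frequently_le (h1 (min ε (1/2)) hm ((min_le_right _ _).trans_lt (by norm_num))).2 b1
      linarith [min_le_left ε (1/2)]
  · refine le_antisymm ?_ ?_
    · refine le_of_forall_pos_le_add fun ε hε => ?_
      have hm : 0 < min ε (1/2) := lt_min hε (by norm_num)
      have := liminf_le_of_frequently_le (a := -(1 - min ε (1/2))) ((h2 (min ε (1/2)) hm ((min_le_right _ _).trans_lt (by norm_num))).2.mono fun n hn => by linarith) b2
      linarith [min_le_left ε (1/2)]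
    · refine le_of_forall_pos_le_add fun ε hε => ?_
      have hm : 0 < min ε (1/2) := lt_min hε (by norm_num)
      have := le_liminf_of_le (a := -(1 + min ε (1/2))) b1.isCoboundedUnder_ge ((h2 (min ε (1/2)) hm ((min_le_right _ _).trans_lt (by norm_num))).1.mono fun n hn => by linarith)
      linarith [min_le_left ε (1/2)]

theorem lil_sub {c σ b : ℝ} {h w : ℝ → ℝ} (H : OpData c σ b h w) {β : ℝ} (hβ : 1 < β) :
    ∀ᵐ x ∂lam,
        Filter.limsup (fun n : ℕ =>
            (Real.log (cfQ x (kCF β n x)) - c * (kCF β n x : ℝ)) /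
              (σ * Real.sqrt (2 * (kCF β n x : ℝ) * Real.log (Real.log (kCF β n x))))) atTop = 1 ∧
        Filter.liminf (fun n : ℕ =>
            (Real.log (cfQ x (kCF β n x)) - c * (kCF β n x : ℝ)) /
              (σ * Real.sqrt (2 * (kCF β n x : ℝ) * Real.log (Real.log (kCF β n x))))) atTop = -1 := by
  obtain ⟨C, L⟩ := lilData H
  filter_upwards [ae_irr, bt_bc hβ, dig_bc, L.lil, L.neg.lil] with x hx hT hD h1 h2
  obtain ⟨A, B, hB, hc⟩ := kCF_close hβ hx.1 hx.2 c hT hD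
  have hkt := kCF_tendsto hβ hx.1 hx.2 hT
  have r1 := sub_lil (S := fun n => SS c n x) (k := fun n => kCF β n x) H.σ_pos hB hkt hc h1
  have r2 := sub_lil (S := fun n => - SS c n x) (k := fun n => kCF β n x) H.σ_pos hB hkt (by
    filter_upwards [hc] with n hn m m1 m2
    have := hn m m1 m2
    rw [neg_sub_neg, abs_sub_comm]; exact this) h2
  simp only [neg_div] at r2
  have := limsup_one r1 r2
  have e : (fun n : ℕ => (Real.log (cfQ x (kCF β n x)) - c * (kCF β n x : ℝ)) /
              (σ * Real.sqrt (2 * (kCF β n x : ℝ) * Real.log (Real.log (kCF β n x))))) =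
      fun n : ℕ => SS c (kCF β n x) x / phi σ (kCF β n x) := by
    funext n
    rw [(cfQ_eq hx.1 hx.2 _).1]; rfl
  rw [e]
  exact this

end GK

theorem clt_log_qn_and_lil_subsequence (β : ℝ) (hβ : 1 < β) :
    ∃ σ₁ : ℝ, 0 < σ₁ ∧
      ((∀ y : ℝ,
        Tendsto (fun n : ℕ =>
            (volume {x ∈ Set.Ico (0:ℝ) 1 |
              (Real.log (cfQ x n) - (Real.pi ^ 2 / (12 * Real.log 2)) * n) /
                (σ₁ * Real.sqrt n) ≤ y}).toReal)
          atTop (nhds ((1 / Real.sqrt (2 * Real.pi)) * ∫ t in Set.Iic y, Real.exp (-t ^ 2 / 2)))) ∧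
      (∀ᵐ x ∂(volume.restrict (Set.Ico (0:ℝ) 1)),
        Filter.limsup (fun n : ℕ =>
            (Real.log (cfQ x (kCF β n x)) - (Real.pi ^ 2 / (12 * Real.log 2)) * (kCF β n x : ℝ)) /
              (σ₁ * Real.sqrt (2 * (kCF β n x : ℝ) * Real.log (Real.log (kCF β n x))))) atTop = 1 ∧
        Filter.liminf (fun n : ℕ =>
            (Real.log (cfQ x (kCF β n x)) - (Real.pi ^ 2 / (12 * Real.log 2)) * (kCF β n x : ℝ)) /
              (σ₁ * Real.sqrt (2 * (kCF β n x : ℝ) * Real.log (Real.log (kCF β n x))))) atTop = -1)) := by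
  obtain ⟨c, σ, b, h, w, H⟩ := GK.opData_exists
  refine ⟨σ, H.σ_pos, ?_, ?_⟩
  · intro y
    have := GK.clt H y
    rw [H.c_eq] at this
    exact this
  · have := GK.lil_sub H hβ
    rw [H.c_eq] at this
    exact this
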